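/- Let f ∈ 𝒜₁, i.e. f : M → M is a continuous piecewise C² map with finite critical set 𝒞, negative Schwarzian derivative, and satisfying summability conditions (I) and (II). Then for every minimal cycle X of intervals for f and every critical point c ∈ 𝒞 ∩ X, the set of preimages ∪_{i≥0} f^{−i}(c) is dense in X. -/

import Mathlib

open Set MeasureTheory Filter Topology

noncomputable section

/-- The unit interval `M = [0,1]`. -/
abbrev unitI : Set ℝ := Set.Icc 0 1

/-- Data of an interval map: the map `f`, the finite critical set `C`,
the one-sided critical orders `l s c` (`s = true` for the right side `c+`,
`s = false` for the left side `c-`), and the one-sided limit values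
`fv s c = f(c±)`. -/
structure CritData where
  f : ℝ → ℝ
  C : Finset ℝ
  l : Bool → ℝ → ℝ
  fv : Bool → ℝ → ℝ

namespace CritData

variable (D : CritData)

/-- One-sided neighbourhood of `c` of radius `ε`. -/
def sideIoo (s : Bool) (c ε : ℝ) : Set ℝ := if s then Ioo c (c + ε) else Ioo (c - ε) c

/-- The one-sided punctured half line at `c`. -/
def sideSet (s : Bool) (c : ℝ) : Set ℝ := if s then Ioi c else Iio c

/-- `f` is piecewise `C²` with critical set `C`: `C ⊆ M`, `f` maps `M` to `M`,
`f` is `C²` with non-vanishing derivative and injective (a diffeomorphism) on each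
connected component of `M \ C`, has one-sided limits `fv s c` at each `c ∈ C`, and
near each `c ∈ C` the map has one-sided critical order `l s c ∈ [1,∞)`. -/
def IsPiecewiseC2 : Prop :=
  (D.C : Set ℝ) ⊆ unitI ∧ MapsTo D.f unitI unitI ∧
  ContDiffOn ℝ 2 D.f (unitI \ (D.C : Set ℝ)) ∧
  (∀ x ∈ unitI \ (D.C : Set ℝ), deriv D.f x ≠ 0) ∧
  (∀ x ∈ unitI \ (D.C : Set ℝ),
    InjOn D.f (connectedComponentIn (unitI \ (D.C : Set ℝ)) x)) ∧
  ∀ c ∈ D.C, ∀ s : Bool,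
    1 ≤ D.l s c ∧
    Tendsto D.f (𝓝[sideSet s c] c) (𝓝 (D.fv s c)) ∧
    ∃ K₁ K₂ ε : ℝ, 0 < K₁ ∧ K₁ ≤ K₂ ∧ 0 < ε ∧
      ∀ x ∈ sideIoo s c ε,
        (K₁ * |x - c| ^ (D.l s c - 1) ≤ |deriv D.f x| ∧
          |deriv D.f x| ≤ K₂ * |x - c| ^ (D.l s c - 1)) ∧
        (K₁ * |x - c| ^ (D.l s c) ≤ |D.f x - D.fv s c| ∧
          |D.f x - D.fv s c| ≤ K₂ * |x - c| ^ (D.l s c)) ∧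
        (K₁ * |x - c| ^ (D.l s c - 2) ≤ |deriv (deriv D.f) x| ∧
          |deriv (deriv D.f) x| ≤ K₂ * |x - c| ^ (D.l s c - 2))

/-- Negative Schwarzian derivative: `|Df|^{-1/2}` is convex on each connected
component of `M \ C`. -/
def NegSchwarzian : Prop :=
  ∀ x ∈ unitI \ (D.C : Set ℝ),
    ConvexOn ℝ (connectedComponentIn (unitI \ (D.C : Set ℝ)) x)
      (fun y => |deriv D.f y| ^ (-(1 : ℝ) / 2))

/-- `f^n(c)` along the side-`s` orbit of the critical point `c` (for `n ≥ 1`):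
`f^n(c) = f^[n-1](f(c±))`. -/
def fnC (s : Bool) (c : ℝ) (n : ℕ) : ℝ := D.f^[n - 1] (D.fv s c)

/-- `Df^n(f(c))`, the derivative of `f^n` at the (one-sided) critical value `f(c±)`. -/
def DfnFc (s : Bool) (c : ℝ) (n : ℕ) : ℝ := deriv (D.f^[n]) (D.fv s c)

/-- A critical point of `C` closest to `y`. -/
def nearest (y : ℝ) : ℝ :=
  if h : D.C.Nonempty then (D.C.exists_min_image (fun c => |y - c|) h).choose else 0

/-- The critical order `l(c̃)` of the critical point `c̃` nearest to `y`, taken on the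
side of `c̃` on which `y` lies. -/
def lNear (y : ℝ) : ℝ := D.l (decide (D.nearest y ≤ y)) (D.nearest y)

/-- The quantity `( |f^n(c)−c̃|^{l(c̃)} / (|f^n(c)−c̃|^{l(c)} |Df^n(f(c))|) )^e`,
where `c̃` is the critical point closest to `f^n(c)`. -/
def sumTerm (s : Bool) (c : ℝ) (e : ℝ) (n : ℕ) : ℝ :=
  (|D.fnC s c n - D.nearest (D.fnC s c n)| ^ D.lNear (D.fnC s c n) /
    (|D.fnC s c n - D.nearest (D.fnC s c n)| ^ D.l s c * |D.DfnFc s c n|)) ^ e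

/-- Summability condition (I). -/
def CondI : Prop :=
  ∀ c ∈ D.C, ∀ s : Bool,
    Summable fun n : ℕ => D.sumTerm s c (1 / (2 * D.l s c - 1)) (n + 1)

/-- Summability condition (II): `∑ₙ |Df^n(f(c))|^{-1/l(c)} < ∞`. -/
def CondII : Prop :=
  ∀ c ∈ D.C, ∀ s : Bool,
    Summable fun n : ℕ => (1 / |D.DfnFc s c (n + 1)|) ^ (1 / D.l s c)

/-- `γ_n(c)`. -/
def gamma (s : Bool) (c : ℝ) (n : ℕ) : ℝ :=
  min (D.sumTerm s c (1 / (2 * D.l s c - 1)) n) (1 / 2)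

/-- `d_n(c) = min_{1 ≤ i < n} (γ_i(c)/|Df^i(f(c))|)^{1/l(c)} |f^i(c)−c̃|^{l(c̃)/l(c)}`. -/
def dSeq (s : Bool) (c : ℝ) (n : ℕ) : ℝ :=
  sInf {t | ∃ i, 1 ≤ i ∧ i < n ∧
    t = (D.gamma s c i / |D.DfnFc s c i|) ^ (1 / D.l s c) *
      |D.fnC s c i - D.nearest (D.fnC s c i)| ^ (D.lNear (D.fnC s c i) / D.l s c)}

end CritData

/-- `μ` is an acip for `f`: an `f`-invariant Borel probability measure on `M = [0,1]`,
absolutely continuous with respect to Lebesgue measure. -/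
def IsAcip (f : ℝ → ℝ) (μ : Measure ℝ) : Prop :=
  IsProbabilityMeasure μ ∧ μ ≪ volume ∧ μ unitIᶜ = 0 ∧
  ∀ A : Set ℝ, MeasurableSet A → μ (f ⁻¹' A) = μ A

/-- `μ` is ergodic for `f`: every `f`-invariant Borel set has measure `0` or `1`. -/
def IsErgodicFor (f : ℝ → ℝ) (μ : Measure ℝ) : Prop :=
  ∀ A : Set ℝ, MeasurableSet A → f ⁻¹' A = A → μ A = 0 ∨ μ A = 1

/-- `X = ⋃_{i<n} f^i(J)` is a cycle of intervals with generating interval `J`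
(a nontrivial closed interval) and period `n`: `n ≥ 1` is least with `f^n(J) ⊆ J`. -/
def IsCycleWith (f : ℝ → ℝ) (J X : Set ℝ) (n : ℕ) : Prop :=
  (∃ a b : ℝ, a < b ∧ J = Icc a b) ∧ J ⊆ unitI ∧ 1 ≤ n ∧
  f^[n] '' J ⊆ J ∧ (∀ m, 1 ≤ m → m < n → ¬ f^[m] '' J ⊆ J) ∧
  X = ⋃ i ∈ Finset.range n, f^[i] '' J

/-- `X` is a cycle of intervals for `f`. -/
def IsCycle (f : ℝ → ℝ) (X : Set ℝ) : Prop := ∃ J n, IsCycleWith f J X n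

/-- A proper cycle: the interiors of the constituent intervals are pairwise disjoint. -/
def IsProperCycleWith (f : ℝ → ℝ) (J X : Set ℝ) (n : ℕ) : Prop :=
  IsCycleWith f J X n ∧
  ∀ i ∈ Finset.range n, ∀ j ∈ Finset.range n, i ≠ j →
    interior (f^[i] '' J) ∩ interior (f^[j] '' J) = ∅

/-- A minimal cycle: a cycle containing no strictly smaller cycle. -/
def IsMinimalCycle (f : ℝ → ℝ) (X : Set ℝ) : Prop :=
  IsCycle f X ∧ ∀ Y, IsCycle f Y → Y ⊆ X → Y = X

/-- `φ` is Hölder continuous on `X`. -/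
def HolderOnSet (φ : ℝ → ℝ) (X : Set ℝ) : Prop :=
  ∃ C > 0, ∃ a : ℝ, 0 < a ∧ a ≤ 1 ∧ ∀ x ∈ X, ∀ y ∈ X, |φ x - φ y| ≤ C * |x - y| ^ a


namespace W17

/-- increasing branch with convex square root of the inverse derivative -/
structure Inc (f g : ℝ → ℝ) (a b : ℝ) : Prop where
  lt : a < b
  cont : ContinuousOn f (Icc a b)
  der : ∀ x ∈ Ioo a b, HasDerivAt f (1 / (g x) ^ 2) x
  pos : ∀ x ∈ Ioo a b, 0 < g x
  conv : ConvexOn ℝ (Ioo a b) g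

theorem le_of_der_nonneg {F F' : ℝ → ℝ} {p q : ℝ} (hpq : p ≤ q) (hc : ContinuousOn F (Icc p q))
    (hd : ∀ x ∈ Ioo p q, HasDerivAt F (F' x) x) (h0 : ∀ x ∈ Ioo p q, 0 ≤ F' x) : F p ≤ F q := by
  have := monotoneOn_of_deriv_nonneg (convex_Icc p q) hc
    (by rw [interior_Icc]; exact fun x hx => (hd x hx).differentiableAt.differentiableWithinAt)
    (by rw [interior_Icc]; intro x hx; rw [(hd x hx).deriv]; exact h0 x hx)
  exact this (left_mem_Icc.2 hpq) (right_mem_Icc.2 hpq) hpq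

theorem lt_of_der_pos {F F' : ℝ → ℝ} {p q : ℝ} (hpq : p < q) (hc : ContinuousOn F (Icc p q))
    (hd : ∀ x ∈ Ioo p q, HasDerivAt F (F' x) x) (h0 : ∀ x ∈ Ioo p q, 0 < F' x) : F p < F q := by
  have := strictMonoOn_of_deriv_pos (convex_Icc p q) hc
    (by rw [interior_Icc]; intro x hx; rw [(hd x hx).deriv]; exact h0 x hx)
  exact this (left_mem_Icc.2 hpq.le) (right_mem_Icc.2 hpq.le) hpq

theorem support {g : ℝ → ℝ} {a b x : ℝ} (hc : ConvexOn ℝ (Ioo a b) g) (hx : x ∈ Ioo a b) :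
    ∃ k, ∀ y ∈ Ioo a b, g x + k * (y - x) ≤ g y := by
  have hxi : x ∈ interior (Ioo a b) := by rwa [interior_Ioo]
  refine ⟨derivWithin g (Ioi x) x, fun y hy => ?_⟩
  rcases lt_trichotomy x y with h | h | h
  · have := hc.rightDeriv_le_slope_of_mem_interior hxi hy h
    rw [slope_def_field, le_div_iff₀ (by linarith)] at this
    linarith
  · subst h; simp
  · have h1 := hc.slope_le_leftDeriv_of_mem_interior hy hxi h
    have h2 := hc.leftDeriv_le_rightDeriv_of_mem_interior hxi
    have := h1.trans h2
    rw [slope_def_field, div_le_iff₀ (by linarith)] at this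
    linarith

namespace Inc
variable {f g : ℝ → ℝ} {a b : ℝ}

theorem sub (h : Inc f g a b) {p q : ℝ} (hp : a ≤ p) (hq : q ≤ b) (hpq : p < q) : Inc f g p q where
  lt := hpq
  cont := h.cont.mono (Icc_subset_Icc hp hq)
  der := fun x hx => h.der x ⟨by linarith [hx.1], by linarith [hx.2]⟩
  pos := fun x hx => h.pos x ⟨by linarith [hx.1], by linarith [hx.2]⟩
  conv := h.conv.subset (Ioo_subset_Ioo hp hq) (convex_Ioo _ _)

theorem slt (h : Inc f g a b) {p q : ℝ} (hp : a ≤ p) (hq : q ≤ b) (hpq : p < q) : f p < f q := by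
  have h' := h.sub hp hq hpq
  exact lt_of_der_pos hpq h'.cont h'.der (fun x hx => by have := h'.pos x hx; positivity)

theorem refl (h : Inc f g a b) : Inc (fun x => - f (-x)) (fun x => g (-x)) (-b) (-a) where
  lt := by linarith [h.lt]
  cont := by
    refine (h.cont.comp continuous_neg.continuousOn ?_).neg
    intro x hx; exact ⟨by linarith [hx.2], by linarith [hx.1]⟩
  der := by
    intro x hx
    have h1 := h.der (-x) ⟨by linarith [hx.2], by linarith [hx.1]⟩
    have h2 := (h1.comp x (hasDerivAt_neg x)).neg
    exact h2.congr_deriv (by ring)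
  pos := fun x hx => h.pos _ ⟨by linarith [hx.2], by linarith [hx.1]⟩
  conv := by
    refine ⟨convex_Ioo _ _, fun x hx y hy s t hs ht hst => ?_⟩
    have := h.conv.2 (x := -x) (y := -y) ⟨by linarith [hx.2], by linarith [hx.1]⟩
      ⟨by linarith [hy.2], by linarith [hy.1]⟩ hs ht hst
    simp only [smul_eq_mul] at this ⊢
    convert this using 2; ring

theorem right (h : Inc f g a b) {x k : ℝ} (hx : x ∈ Ioo a b)
    (hk : ∀ y ∈ Ioo a b, g x + k * (y - x) ≤ g y) :
    1 / (b - x) + k / g x ≤ (1 / (g x) ^ 2) / (f b - f x) := by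
  have hg := h.pos x hx
  have hxb : 0 < b - x := by linarith [hx.2]
  have hfb : 0 < f b - f x := by linarith [h.slt hx.1.le le_rfl hx.2]
  have e : 1 / (b - x) + k / g x = (g x + k * (b - x)) / (g x * (b - x)) := by
    field_simp
  rw [e]
  by_cases hL : g x + k * (b - x) ≤ 0
  · exact (div_nonpos_of_nonpos_of_nonneg hL (by positivity)).trans (by positivity)
  push Not at hL
  have hpos : ∀ y ∈ Icc x b, 0 < g x + k * (y - x) := by
    intro y hy
    by_cases hk0 : 0 ≤ k
    · have := mul_nonneg hk0 (sub_nonneg.2 hy.1); linarith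
    · push Not at hk0
      have : k * (b - x) ≤ k * (y - x) := by
        apply mul_le_mul_of_nonpos_left _ hk0.le; linarith [hy.2]
      linarith
  set H : ℝ → ℝ := fun y => (y - x) / (g x * (g x + k * (y - x))) with hH
  have hHd : ∀ y ∈ Icc x b, HasDerivAt H (1 / (g x + k * (y - x)) ^ 2) y := by
    intro y hy
    have hp := hpos y hy
    have h1 : HasDerivAt (fun y : ℝ => y - x) 1 y := (hasDerivAt_id y).sub_const x
    have h2 : HasDerivAt (fun y : ℝ => g x * (g x + k * (y - x))) (g x * (k * 1)) y :=
      ((h1.const_mul k).const_add (g x)).const_mul (g x)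
    refine (h1.div h2 (by positivity)).congr_deriv ?_
    field_simp
    ring
  have hs := h.sub hx.1.le le_rfl hx.2
  have key := le_of_der_nonneg (F := fun y => H y - f y)
    (F' := fun y => 1 / (g x + k * (y - x)) ^ 2 - 1 / (g y) ^ 2) hx.2.le
    (ContinuousOn.sub (fun y hy => (hHd y hy).continuousAt.continuousWithinAt) hs.cont)
    (fun y hy => (hHd y ⟨hy.1.le, hy.2.le⟩).sub (hs.der y hy))
    (fun y hy => by
      have h1 := hpos y ⟨hy.1.le, hy.2.le⟩
      have h2 := hk y ⟨by linarith [hx.1, hy.1], hy.2⟩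
      rw [sub_nonneg]
      gcongr)
  simp only [hH, sub_self, zero_div] at key
  have key2 : f b - f x ≤ (b - x) / (g x * (g x + k * (b - x))) := by linarith
  rw [le_div_iff₀ hfb]
  calc _ ≤ (g x + k * (b - x)) / (g x * (b - x)) * ((b - x) / (g x * (g x + k * (b - x)))) := by
        gcongr
    _ = _ := by field_simp

theorem left (h : Inc f g a b) {x k : ℝ} (hx : x ∈ Ioo a b)
    (hk : ∀ y ∈ Ioo a b, g x + k * (y - x) ≤ g y) :
    1 / (x - a) - k / g x ≤ (1 / (g x) ^ 2) / (f x - f a) := by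
  have := h.refl.right (x := -x) (k := -k) ⟨by linarith [hx.2], by linarith [hx.1]⟩
    (fun y hy => by
      have := hk (-y) ⟨by linarith [hy.2], by linarith [hy.1]⟩
      simp only [neg_neg]
      linarith)
  simp only [neg_neg] at this
  calc _ = 1 / (-a - -x) + -k / g x := by rw [show -a - -x = x - a by ring]; ring
    _ ≤ _ := this
    _ = _ := by rw [show -f a - -f x = f x - f a by ring]

/-- cross ratio expansion -/
theorem S1 (h : Inc f g a b) {u v : ℝ} (hu : a < u) (huv : u < v) (hv : v < b) :
    (v - a) * (b - u) / ((u - a) * (b - v)) ≤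
      (f v - f a) * (f b - f u) / ((f u - f a) * (f b - f v)) := by
  set F : ℝ → ℝ := fun x => Real.log (f x - f a) - Real.log (f b - f x)
    - (Real.log (x - a) - Real.log (b - x)) with hF
  have hd : ∀ x ∈ Icc u v, HasDerivAt F (1 / (g x) ^ 2 / (f x - f a) - (-(1 / (g x) ^ 2)) / (f b - f x)
      - (1 / (x - a) - (-1) / (b - x))) x := by
    intro x hx
    have hxm : x ∈ Ioo a b := ⟨by linarith [hx.1], by linarith [hx.2]⟩
    have h1 := h.slt le_rfl hxm.2.le hxm.1
    have h2 := h.slt hxm.1.le le_rfl hxm.2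
    have h3 := h.der x hxm
    refine HasDerivAt.sub (HasDerivAt.sub ?_ ?_) (HasDerivAt.sub ?_ ?_)
    · exact (h3.sub_const _).log (by linarith)
    · exact (h3.const_sub _).log (by linarith)
    · exact ((hasDerivAt_id x).sub_const _).log (by simp only [id]; linarith [hxm.1])
    · exact ((hasDerivAt_id x).const_sub _).log (by simp only [id]; linarith [hxm.2])
  have key := le_of_der_nonneg huv.le (fun x hx => (hd x hx).continuousAt.continuousWithinAt)
    (fun x hx => hd x ⟨hx.1.le, hx.2.le⟩) (fun x hx => by
      have hxm : x ∈ Ioo a b := ⟨by linarith [hx.1], by linarith [hx.2]⟩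
      obtain ⟨k, hk⟩ := support h.conv hxm
      have h1 := h.right hxm hk
      have h2 := h.left hxm hk
      have e1 : (-(1 / (g x) ^ 2)) / (f b - f x) = -((1 / (g x) ^ 2) / (f b - f x)) := by ring
      have e2 : (-1) / (b - x) = - (1 / (b - x)) := by ring
      rw [e1, e2]
      linarith)
  have p1 : 0 < f u - f a := by linarith [h.slt le_rfl (by linarith) hu]
  have p2 : 0 < f v - f a := by linarith [h.slt le_rfl (by linarith) (hu.trans huv)]
  have p3 : 0 < f b - f v := by linarith [h.slt (by linarith) le_rfl hv]
  have p4 : 0 < f b - f u := by linarith [h.slt hu.le le_rfl (huv.trans hv)]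
  have q1 : 0 < u - a := by linarith
  have q2 : 0 < v - a := by linarith
  have q3 : 0 < b - v := by linarith
  have q4 : 0 < b - u := by linarith
  rw [← Real.log_le_log_iff (by positivity) (by positivity)]
  rw [Real.log_div (by positivity) (by positivity), Real.log_div (by positivity) (by positivity),
    Real.log_mul (by positivity) (by positivity), Real.log_mul (by positivity) (by positivity),
    Real.log_mul (by positivity) (by positivity), Real.log_mul (by positivity) (by positivity)]
  simp only [hF] at key
  linarith

theorem Bin (h : Inc f g a b) (hc : ConvexOn ℝ (Ico a b) g) (ha : 0 < g a) {x : ℝ}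
    (hx : x ∈ Ioo a b) : (x - a) / (g a * g x) ≤ f x - f a := by
  have hgx := h.pos x hx
  have hxa : 0 < x - a := by linarith [hx.1]
  set k := (g x - g a) / (x - a) with hk
  have hpos : ∀ y ∈ Icc a x, 0 < g a + k * (y - a) := by
    intro y hy
    have e : g a + k * (y - a) = (g a * (x - y) + g x * (y - a)) / (x - a) := by
      rw [hk]; field_simp; ring
    rw [e]
    apply div_pos _ hxa
    rcases eq_or_lt_of_le hy.1 with h1 | h1
    · subst h1; have := mul_pos ha hxa; linarith
    · have := mul_pos hgx (sub_pos.2 h1); have := mul_nonneg ha.le (sub_nonneg.2 hy.2); linarith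
  set H : ℝ → ℝ := fun y => (y - a) / (g a * (g a + k * (y - a))) with hH
  have hHd : ∀ y ∈ Icc a x, HasDerivAt H (1 / (g a + k * (y - a)) ^ 2) y := by
    intro y hy
    have hp := hpos y hy
    have h1 : HasDerivAt (fun y : ℝ => y - a) 1 y := (hasDerivAt_id y).sub_const a
    have h2 : HasDerivAt (fun y : ℝ => g a * (g a + k * (y - a))) (g a * (k * 1)) y :=
      ((h1.const_mul k).const_add (g a)).const_mul (g a)
    refine (h1.div h2 (by positivity)).congr_deriv ?_
    field_simp
    ring
  have hs := h.sub le_rfl hx.2.le hx.1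
  have key := le_of_der_nonneg (F := fun y => f y - H y)
    (F' := fun y => 1 / (g y) ^ 2 - 1 / (g a + k * (y - a)) ^ 2) hx.1.le
    (ContinuousOn.sub hs.cont (fun y hy => (hHd y hy).continuousAt.continuousWithinAt))
    (fun y hy => (hs.der y hy).sub (hHd y ⟨hy.1.le, hy.2.le⟩))
    (fun y hy => by
      have h1 := hpos y ⟨hy.1.le, hy.2.le⟩
      have h3 := hs.pos y hy
      have h2 : g y ≤ g a + k * (y - a) := by
        have := hc.2 (show a ∈ Ico a b from ⟨le_rfl, h.lt⟩) (show x ∈ Ico a b from ⟨hx.1.le, hx.2⟩)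
          (show 0 ≤ (x - y) / (x - a) from div_nonneg (by linarith [hy.2]) hxa.le)
          (show 0 ≤ (y - a) / (x - a) from div_nonneg (by linarith [hy.1]) hxa.le)
          (by field_simp; ring)
        simp only [smul_eq_mul] at this
        have e : (x - y) / (x - a) * a + (y - a) / (x - a) * x = y := by field_simp; ring
        rw [e] at this
        refine this.trans (le_of_eq ?_)
        rw [hk]; field_simp; ring
      rw [sub_nonneg]
      gcongr)
  simp only [hH, sub_self, zero_div, sub_zero] at key
  have e : g a + k * (x - a) = g x := by rw [hk]; field_simp; ring
  rw [e] at key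
  linarith

theorem S2 (h : Inc f g a b) (hc : ConvexOn ℝ (Ico a b) g) (ha : 0 < g a) {u : ℝ}
    (hu : u ∈ Ioo a b) :
    (1 / g a ^ 2) * (f b - f u) / ((f u - f a) * (f b - f a)) ≤ (b - u) / ((u - a) * (b - a)) := by
  have p1 : 0 < f u - f a := by linarith [h.slt le_rfl hu.2.le hu.1]
  have p2 : 0 < f b - f a := by linarith [h.slt le_rfl le_rfl h.lt]
  have q1 : 0 < u - a := by linarith [hu.1]
  have q2 : 0 < b - a := by linarith [h.lt]
  have hs := h.sub hu.1.le le_rfl hu.2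
  have hne : ∀ x ∈ Icc u b, 0 < f x - f a := by
    intro x hx
    linarith [h.slt le_rfl hx.2 (lt_of_lt_of_le hu.1 hx.1)]
  have key := le_of_der_nonneg (F := fun x => (1 / g a ^ 2) * (f x - f a)⁻¹ - (x - a)⁻¹)
    (F' := fun x => (1 / g a ^ 2) * (-(1 / g x ^ 2) / (f x - f a) ^ 2) - (-1 / (x - a) ^ 2)) hu.2.le
    (by
      refine ContinuousOn.sub (ContinuousOn.mul continuousOn_const
        (ContinuousOn.inv₀ (hs.cont.sub continuousOn_const) fun x hx => (hne x hx).ne'))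
        (ContinuousOn.inv₀ (continuousOn_id.sub continuousOn_const) fun x hx => ?_)
      have := hx.1; exact (show (0:ℝ) < x - a by linarith).ne')
    (fun x hx => by
      refine HasDerivAt.sub (((hs.der x hx).sub_const _).inv (hne x ⟨hx.1.le, hx.2.le⟩).ne' |>.const_mul _) ?_
      exact ((hasDerivAt_id x).sub_const a).inv (by simp only [id]; linarith [hx.1]))
    (fun x hx => by
      have hx' : x ∈ Ioo a b := ⟨by linarith [hx.1], hx.2⟩
      have hB := h.Bin hc ha hx'
      have hgx := h.pos x hx'
      have h1 : 0 < x - a := by linarith [hx.1]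
      have h2 := hne x ⟨hx.1.le, hx.2.le⟩
      have h3 : ((x - a) / (g a * g x)) ^ 2 ≤ (f x - f a) ^ 2 := by gcongr
      have e : (1 / g a ^ 2) * (-(1 / g x ^ 2) / (f x - f a) ^ 2) - (-1 / (x - a) ^ 2)
        = ((f x - f a) ^ 2 - ((x - a) / (g a * g x)) ^ 2) / ((x - a) ^ 2 * (f x - f a) ^ 2) := by
        field_simp; ring
      rw [e]
      apply div_nonneg (by linarith) (by positivity))
  have e1 : (1 / g a ^ 2) * (f b - f u) / ((f u - f a) * (f b - f a))
    = (1 / g a ^ 2) * (f u - f a)⁻¹ - (1 / g a ^ 2) * (f b - f a)⁻¹ := by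
    field_simp; ring
  have e2 : (b - u) / ((u - a) * (b - a)) = (u - a)⁻¹ - (b - a)⁻¹ := by field_simp; ring
  rw [e1, e2]
  linarith

end Inc
end W17

namespace W17

theorem Inc.rmin {f g : ℝ → ℝ} {a b : ℝ} (h : Inc f g a b) {N ε : ℝ} (hN : 1 < N)
    (hε : a + N * ε < b)
    (hg : ∀ x, a < x → x ≤ a + ε → g (a + N * (x - a)) ≤ g x / 2) {u v : ℝ} (hu : a < u)
    (huv : u ≤ v) (hv : v ≤ a + ε) :
    (1 + 1 / (2 * (N - 1))) * Real.log ((v - a) / (u - a)) ≤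
      Real.log ((f v - f a) / (f u - f a)) := by
  set rm := 1 + 1 / (2 * (N - 1)) with hrm
  have hε0 : 0 < ε := by linarith
  have hvb : v < b := by nlinarith
  have hN1 : 0 < N - 1 := by linarith
  set F : ℝ → ℝ := fun x => Real.log (f x - f a) - rm * Real.log (x - a) with hF
  have hd : ∀ x ∈ Icc u v, HasDerivAt F (1 / (g x) ^ 2 / (f x - f a) - rm * (1 / (x - a))) x := by
    intro x hx
    have hxm : x ∈ Ioo a b := ⟨by linarith [hx.1], by linarith [hx.2]⟩
    have h1 := h.slt le_rfl hxm.2.le hxm.1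
    have h3 := h.der x hxm
    refine HasDerivAt.sub ?_ (HasDerivAt.const_mul _ ?_)
    · exact (h3.sub_const _).log (by linarith)
    · exact ((hasDerivAt_id x).sub_const _).log (by simp only [id]; linarith [hxm.1])
  have key := le_of_der_nonneg huv (fun x hx => (hd x hx).continuousAt.continuousWithinAt)
    (fun x hx => hd x ⟨hx.1.le, hx.2.le⟩) (fun x hx => by
      have hxm : x ∈ Ioo a b := ⟨by linarith [hx.1], by linarith [hx.2]⟩
      have hxa : 0 < x - a := by linarith [hxm.1]
      have hgx := h.pos x hxm
      obtain ⟨k, hk⟩ := support h.conv hxm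
      have h2 := h.left hxm hk
      have hxe : x - a ≤ ε := by linarith [hx.2]
      have h3 := hk (a + N * (x - a)) ⟨by nlinarith, by nlinarith⟩
      have h4 := hg x hxm.1 (by linarith)
      have h5 : k * ((N - 1) * (x - a)) ≤ - g x / 2 := by
        have : a + N * (x - a) - x = (N - 1) * (x - a) := by ring
        rw [this] at h3; linarith
      have h6 : k / g x ≤ - (1 / (2 * (N - 1)) * (1 / (x - a))) := by
        rw [div_le_iff₀ hgx]
        rw [← le_div_iff₀ (by positivity)] at h5
        refine h5.trans (le_of_eq ?_)
        field_simp
      have : rm * (1 / (x - a)) = 1 / (x - a) + 1 / (2 * (N - 1)) * (1 / (x - a)) := by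
        rw [hrm]; ring
      rw [this]
      linarith)
  have p1 : 0 < f u - f a := by linarith [h.slt le_rfl (by linarith) hu]
  have p2 : 0 < f v - f a := by linarith [h.slt le_rfl (by linarith) (lt_of_lt_of_le hu huv)]
  have q1 : 0 < u - a := by linarith
  have q2 : 0 < v - a := by linarith
  rw [Real.log_div (by positivity) (by positivity), Real.log_div (by positivity) (by positivity)]
  simp only [hF] at key
  linarith

/-- chain of four points, in one of the two orders -/
def Ch (a u v b : ℝ) : Prop := (a < u ∧ u < v ∧ v < b) ∨ (b < v ∧ v < u ∧ u < a)
/-- strictly between -/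
def Bt (a u b : ℝ) : Prop := (a < u ∧ u < b) ∨ (b < u ∧ u < a)

theorem Ch.swap {a u v b : ℝ} (h : Ch a u v b) : Ch b v u a := by
  unfold Ch at *; tauto
theorem Ch.bt1 {a u v b : ℝ} (h : Ch a u v b) : Bt a u b := by
  rcases h with h | h
  · exact Or.inl ⟨h.1, by linarith⟩
  · exact Or.inr ⟨by linarith, h.2.2⟩
theorem Ch.bt2 {a u v b : ℝ} (h : Ch a u v b) : Bt a v b := by
  rcases h with h | h
  · exact Or.inl ⟨by linarith, by linarith⟩
  · exact Or.inr ⟨by linarith, by linarith⟩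
theorem Bt.swap {a u b : ℝ} (h : Bt a u b) : Bt b u a := by
  unfold Bt at *; tauto
theorem Bt.ne {a u b : ℝ} (h : Bt a u b) : a ≠ b := by
  rcases h with h | h <;> intro e <;> linarith

variable (D : CritData)
/-- the convex function -/
def gD (y : ℝ) : ℝ := |deriv D.f y| ^ (-(1 : ℝ) / 2)

/-- the standing hypotheses -/
structure Hyp (D : CritData) : Prop where
  pc : D.IsPiecewiseC2
  cont : ContinuousOn D.f unitI
  sch : D.NegSchwarzian

variable {D}

theorem Hyp.dne (H : Hyp D) {x : ℝ} (hx : x ∈ unitI) (hC : x ∉ D.C) : deriv D.f x ≠ 0 :=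
  H.pc.2.2.2.1 x ⟨hx, by simpa using hC⟩

theorem Hyp.diff (H : Hyp D) {x : ℝ} (hx : x ∈ unitI) (hC : x ∉ D.C) :
    HasDerivAt D.f (deriv D.f x) x :=
  (differentiableAt_of_deriv_ne_zero (H.dne hx hC)).hasDerivAt

theorem Hyp.gpos (H : Hyp D) {x : ℝ} (hx : x ∈ unitI) (hC : x ∉ D.C) : 0 < gD D x :=
  Real.rpow_pos_of_pos (abs_pos.2 (H.dne hx hC)) _

theorem Hyp.gsq (H : Hyp D) {x : ℝ} (hx : x ∈ unitI) (hC : x ∉ D.C) :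
    1 / (gD D x) ^ 2 = |deriv D.f x| := by
  have h := abs_pos.2 (H.dne hx hC)
  unfold gD
  rw [← Real.rpow_natCast, ← Real.rpow_mul h.le, one_div, ← Real.rpow_neg h.le]
  norm_num

theorem Hyp.maps (H : Hyp D) : MapsTo D.f unitI unitI := H.pc.2.1

theorem Hyp.gconv (H : Hyp D) {S : Set ℝ} (hS : S ⊆ unitI) (hC : ∀ x ∈ S, x ∉ D.C)
    (hconv : Convex ℝ S) : ConvexOn ℝ S (gD D) := by
  rcases S.eq_empty_or_nonempty with rfl | ⟨x, hx⟩
  · exact ⟨convex_empty, by simp⟩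
  have hsub : S ⊆ unitI \ (D.C : Set ℝ) := fun y hy => ⟨hS hy, by simpa using hC y hy⟩
  exact (H.sch x (hsub hx)).subset (hconv.isPreconnected.subset_connectedComponentIn hx hsub) hconv

theorem Hyp.inc (H : Hyp D) {a b : ℝ} (ha : a ∈ unitI) (hb : b ∈ unitI) (hab : a < b)
    (hC : ∀ c ∈ D.C, ¬ (a < c ∧ c < b)) :
    Inc D.f (gD D) a b ∨ Inc (fun x => - D.f x) (gD D) a b := by
  have hI : ∀ x ∈ Ioo a b, x ∈ unitI ∧ x ∉ D.C := fun x hx =>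
    ⟨⟨by linarith [ha.1, hx.1], by linarith [hb.2, hx.2]⟩, fun h => hC x h hx⟩
  have hsub : Icc a b ⊆ unitI := fun x hx => ⟨by linarith [ha.1, hx.1], by linarith [hb.2, hx.2]⟩
  have hconv := H.gconv (S := Ioo a b) (fun x hx => (hI x hx).1) (fun x hx => (hI x hx).2)
    (convex_Ioo a b)
  rcases hasDerivWithinAt_forall_lt_or_forall_gt_of_forall_ne (convex_Ioo a b)
    (fun x hx => (H.diff (hI x hx).1 (hI x hx).2).hasDerivWithinAt (s := Ioo a b)) (m := 0)
    (fun x hx => H.dne (hI x hx).1 (hI x hx).2) with h | h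
  · right
    refine ⟨hab, (H.cont.mono hsub).neg, fun x hx => ?_, fun x hx => H.gpos (hI x hx).1 (hI x hx).2,
      hconv⟩
    rw [H.gsq (hI x hx).1 (hI x hx).2, abs_of_neg (h x hx)]
    exact (H.diff (hI x hx).1 (hI x hx).2).neg
  · left
    refine ⟨hab, (H.cont.mono hsub), fun x hx => ?_, fun x hx => H.gpos (hI x hx).1 (hI x hx).2,
      hconv⟩
    rw [H.gsq (hI x hx).1 (hI x hx).2, abs_of_pos (h x hx)]
    exact (H.diff (hI x hx).1 (hI x hx).2)

/-- oriented representation of a branch between `a` and `b` -/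
theorem Hyp.rep (H : Hyp D) {a b : ℝ} (ha : a ∈ unitI) (hb : b ∈ unitI) (hab : a ≠ b)
    (hC : ∀ c ∈ D.C, ¬ Bt a c b) :
    ∃ σ τ : ℝ, (σ = 1 ∨ σ = -1) ∧ (τ = 1 ∨ τ = -1) ∧
      Inc (fun x => σ * D.f (τ * x)) (fun x => gD D (τ * x)) (τ * a) (τ * b) ∧
      (a ∉ D.C → ConvexOn ℝ (Ico (τ * a) (τ * b)) (fun x => gD D (τ * x))) := by
  rcases lt_or_gt_of_ne hab with h | h
  · have hcv : a ∉ D.C → ConvexOn ℝ (Ico a b) (gD D) := fun haC =>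
      H.gconv (fun x hx => ⟨by linarith [ha.1, hx.1], by linarith [hb.2, hx.2]⟩)
        (fun x hx hxC => by
          rcases eq_or_lt_of_le hx.1 with e | e
          · exact haC (e ▸ hxC)
          · exact hC x hxC (Or.inl ⟨e, hx.2⟩)) (convex_Ico a b)
    rcases H.inc ha hb h (fun c hc hh => hC c hc (Or.inl hh)) with h1 | h1
    · exact ⟨1, 1, Or.inl rfl, Or.inl rfl, by simpa using h1, by simpa using hcv⟩
    · exact ⟨-1, 1, Or.inr rfl, Or.inl rfl, by simpa using h1, by simpa using hcv⟩
  · have hcv : a ∉ D.C → ConvexOn ℝ (Ico (-a) (-b)) (fun x => gD D (-x)) := fun haC => by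
      have := H.gconv (S := Ioc b a) (fun x hx => ⟨by linarith [hb.1, hx.1], by linarith [ha.2, hx.2]⟩)
        (fun x hx hxC => by
          rcases eq_or_lt_of_le hx.2 with e | e
          · exact haC (e ▸ hxC)
          · exact hC x hxC (Or.inr ⟨hx.1, e⟩)) (convex_Ioc b a)
      refine ⟨convex_Ico _ _, fun x hx y hy s t hs ht hst => ?_⟩
      have := this.2 (x := -x) (y := -y) ⟨by linarith [hx.2], by linarith [hx.1]⟩
        ⟨by linarith [hy.2], by linarith [hy.1]⟩ hs ht hst
      simp only [smul_eq_mul] at this ⊢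
      convert this using 2; ring
    rcases H.inc hb ha h (fun c hc hh => hC c hc (Or.inr hh)) with h1 | h1
    · exact ⟨-1, -1, Or.inr rfl, Or.inr rfl, by simpa using h1.refl, by simpa using hcv⟩
    · exact ⟨1, -1, Or.inl rfl, Or.inr rfl, by simpa using h1.refl, by simpa using hcv⟩

/-- cross ratio -/
def cr (a u v b : ℝ) : ℝ := |v - a| * |u - b| / (|u - a| * |v - b|)

theorem Hyp.ch (H : Hyp D) {a b u v : ℝ} (ha : a ∈ unitI) (hb : b ∈ unitI)
    (hC : ∀ c ∈ D.C, ¬ Bt a c b) (hch : Ch a u v b) :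
    Ch (D.f a) (D.f u) (D.f v) (D.f b) ∧ cr a u v b ≤ cr (D.f a) (D.f u) (D.f v) (D.f b) := by
  obtain ⟨σ, τ, hσ, hτ, hI, -⟩ := H.rep ha hb hch.bt1.ne hC
  have hlt := hI.lt
  have hττ : ∀ x : ℝ, τ * (τ * x) = x := by rcases hτ with rfl | rfl <;> simp
  have hord : τ * a < τ * u ∧ τ * u < τ * v ∧ τ * v < τ * b := by
    rcases hτ with rfl | rfl <;> rcases hch with h | h <;> refine ⟨?_, ?_, ?_⟩ <;> linarith
  obtain ⟨h1, h2, h3⟩ := hord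
  have s1 := hI.slt le_rfl (by linarith) h1
  have s2 := hI.slt h1.le h3.le h2
  have s3 := hI.slt (by linarith) le_rfl h3
  have key := hI.S1 h1 h2 h3
  simp only [hττ] at s1 s2 s3 key
  constructor
  · rcases hσ with rfl | rfl
    · left; refine ⟨?_, ?_, ?_⟩ <;> linarith
    · right; refine ⟨?_, ?_, ?_⟩ <;> linarith
  · have eτ : ∀ x y : ℝ, |x - y| = |τ * x - τ * y| := by
      intro x y; rw [← mul_sub, abs_mul]; rcases hτ with rfl | rfl <;> simp
    have eσ : ∀ x y : ℝ, |x - y| = |σ * x - σ * y| := by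
      intro x y; rw [← mul_sub, abs_mul]; rcases hσ with rfl | rfl <;> simp
    unfold cr
    rw [eτ v a, eτ u b, eτ u a, eτ v b, eσ (D.f v), eσ (D.f u) (D.f b), eσ (D.f u) (D.f a),
      eσ (D.f v) (D.f b)]
    rw [abs_of_pos (show 0 < τ * v - τ * a by linarith), abs_of_neg (show τ * u - τ * b < 0 by linarith),
      abs_of_pos (show 0 < τ * u - τ * a by linarith), abs_of_neg (show τ * v - τ * b < 0 by linarith),
      abs_of_pos (show 0 < σ * D.f v - σ * D.f a by linarith),
      abs_of_neg (show σ * D.f u - σ * D.f b < 0 by linarith),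
      abs_of_pos (show 0 < σ * D.f u - σ * D.f a by linarith),
      abs_of_neg (show σ * D.f v - σ * D.f b < 0 by linarith)]
    simpa using key

/-- monotonicity: between-ness is preserved on branches -/
theorem Hyp.bt (H : Hyp D) {a b u : ℝ} (ha : a ∈ unitI) (hb : b ∈ unitI)
    (hC : ∀ c ∈ D.C, ¬ Bt a c b) (hb : Bt a u b) : Bt (D.f a) (D.f u) (D.f b) := by
  have : Ch a u ((u + b) / 2) b := by
    rcases hb with h | h
    · exact Or.inl ⟨h.1, by linarith, by linarith⟩
    · exact Or.inr ⟨by linarith, by linarith, h.2⟩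
  exact (H.ch ha ‹_› hC this).1.bt1

theorem Hyp.s2 (H : Hyp D) {a b u : ℝ} (ha : a ∈ unitI) (hb : b ∈ unitI) (haC : a ∉ D.C)
    (hC : ∀ c ∈ D.C, ¬ Bt a c b) (hbt : Bt a u b) :
    |deriv D.f a| * |D.f u - D.f b| / (|D.f u - D.f a| * |D.f a - D.f b|) ≤
      |u - b| / (|u - a| * |a - b|) := by
  obtain ⟨σ, τ, hσ, hτ, hI, hcv⟩ := H.rep ha hb hbt.ne hC
  have hlt := hI.lt
  have hττ : ∀ x : ℝ, τ * (τ * x) = x := by rcases hτ with rfl | rfl <;> simp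
  have hord : τ * a < τ * u ∧ τ * u < τ * b := by
    rcases hτ with rfl | rfl <;> rcases hbt with h | h <;> refine ⟨?_, ?_⟩ <;> linarith
  obtain ⟨h1, h2⟩ := hord
  have s1 := hI.slt le_rfl h2.le h1
  have s2 := hI.slt h1.le le_rfl h2
  have key := hI.S2 (hcv haC) (by simp only [hττ]; exact H.gpos ha haC) ⟨h1, h2⟩
  simp only [hττ] at s1 s2 key
  rw [H.gsq ha haC] at key
  have eτ : ∀ x y : ℝ, |x - y| = |τ * x - τ * y| := by
    intro x y; rw [← mul_sub, abs_mul]; rcases hτ with rfl | rfl <;> simp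
  have eσ : ∀ x y : ℝ, |x - y| = |σ * x - σ * y| := by
    intro x y; rw [← mul_sub, abs_mul]; rcases hσ with rfl | rfl <;> simp
  rw [eτ u b, eτ u a, eτ a b, eσ (D.f u) (D.f b), eσ (D.f u) (D.f a), eσ (D.f a) (D.f b)]
  rw [abs_of_neg (show τ * u - τ * b < 0 by linarith),
      abs_of_pos (show 0 < τ * u - τ * a by linarith), abs_of_neg (show τ * a - τ * b < 0 by linarith),
      abs_of_neg (show σ * D.f u - σ * D.f b < 0 by linarith),
      abs_of_pos (show 0 < σ * D.f u - σ * D.f a by linarith),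
      abs_of_neg (show σ * D.f a - σ * D.f b < 0 by linarith)]
  simpa using key

end W17

namespace W17
variable {D : CritData}

/-- sign of a side -/
def sg (s : Bool) : ℝ := if s then 1 else -1

theorem sg_abs (s : Bool) : |sg s| = 1 := by cases s <;> simp [sg]
theorem sg_sq (s : Bool) : sg s * sg s = 1 := by cases s <;> simp [sg]

theorem mem_sideIoo {s : Bool} {c ε r : ℝ} (h0 : 0 < r) (h1 : r < ε) :
    c + sg s * r ∈ CritData.sideIoo s c ε := by
  cases s <;> simp [sg, CritData.sideIoo] <;> constructor <;> linarith

theorem seg_mem {c τ r r' : ℝ} (hc : c ∈ unitI) (h : c + τ * r' ∈ unitI) (h0 : 0 ≤ r) (h1 : r ≤ r') :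
    c + τ * r ∈ unitI := by
  have hr' : 0 ≤ r' := h0.trans h1
  rcases eq_or_lt_of_le hr' with e | e
  · have : r = 0 := by linarith
    subst this; simpa using hc
  have := (convex_Icc (0:ℝ) 1) hc h (a := 1 - r / r') (b := r / r')
    (by rw [sub_nonneg, div_le_one e]; exact h1) (by positivity) (by ring)
  convert this using 1
  simp only [smul_eq_mul]; field_simp; ring

theorem Hyp.fv_eq (H : Hyp D) {c : ℝ} (hc : c ∈ D.C) {s : Bool} {r₁ : ℝ} (h₁ : 0 < r₁)
    (hx : c + sg s * r₁ ∈ unitI) : D.fv s c = D.f c := by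
  have hcI : c ∈ unitI := H.pc.1 hc
  have ht := (H.pc.2.2.2.2.2 c hc s).2.1
  have h1 : Tendsto (fun r => c + sg s * r) (𝓝[>] 0) (𝓝 c) := by
    have : Tendsto (fun r => c + sg s * r) (𝓝 0) (𝓝 (c + sg s * 0)) := by
      apply Continuous.tendsto; fun_prop
    simpa using this.mono_left nhdsWithin_le_nhds
  have h2 : Tendsto (fun r => c + sg s * r) (𝓝[>] 0) (𝓝[CritData.sideSet s c] c) := by
    refine tendsto_nhdsWithin_iff.2 ⟨h1, ?_⟩
    filter_upwards [self_mem_nhdsWithin] with r hr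
    have : (0:ℝ) < r := hr
    cases s <;> simp [sg, CritData.sideSet] <;> linarith
  have h3 : Tendsto (fun r => c + sg s * r) (𝓝[>] 0) (𝓝[unitI] c) := by
    refine tendsto_nhdsWithin_iff.2 ⟨h1, ?_⟩
    filter_upwards [Ioo_mem_nhdsGT h₁] with r hr
    exact seg_mem hcI hx hr.1.le hr.2.le
  exact tendsto_nhds_unique (ht.comp h2) ((H.cont c hcI).tendsto.comp h3)

theorem Hyp.l_gt (H : Hyp D) {c : ℝ} (hc : c ∈ D.C) {s : Bool} : 1 < D.l s c := by
  obtain ⟨hl, -, K₁, K₂, ε, hK1, hK12, hε, hb⟩ := H.pc.2.2.2.2.2 c hc s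
  rcases eq_or_lt_of_le hl with e | e
  swap
  · exact e
  exfalso
  have hb1 : ∀ r, 0 < r → r < ε → |deriv D.f (c + sg s * r)| ≤ K₂ := by
    intro r h0 h1
    have := (hb _ (mem_sideIoo h0 h1)).1.2
    rw [← e] at this; simpa using this
  have hb2 : ∀ r, 0 < r → r < ε → K₁ / r ≤ |deriv (deriv D.f) (c + sg s * r)| := by
    intro r h0 h1
    have := (hb _ (mem_sideIoo h0 h1)).2.2.1
    have e3 : (1:ℝ) - 2 = -1 := by norm_num
    rw [← e, e3, add_sub_cancel_left, abs_mul, sg_abs, one_mul, abs_of_pos h0, Real.rpow_neg_one] at this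
    exact this
  have hd : ∀ r ∈ Ioo 0 ε, HasDerivAt (fun r => deriv D.f (c + sg s * r))
      (deriv (deriv D.f) (c + sg s * r) * sg s) r := by
    intro r hr
    have hne : deriv (deriv D.f) (c + sg s * r) ≠ 0 := by
      have h1 := hb2 r hr.1 hr.2
      have : 0 < K₁ / r := div_pos hK1 hr.1
      intro h; rw [h] at h1; simp at h1; linarith
    have h1 := (differentiableAt_of_deriv_ne_zero hne).hasDerivAt
    have h2 : HasDerivAt (fun r => c + sg s * r) (sg s) r := by
      simpa using ((hasDerivAt_id r).const_mul (sg s)).const_add c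
    exact h1.comp r h2
  have habs : ∀ r ∈ Ioo 0 ε, K₁ / r ≤ |deriv (deriv D.f) (c + sg s * r) * sg s| := by
    intro r hr; rw [abs_mul, sg_abs, mul_one]; exact hb2 r hr.1 hr.2
  have hne : ∀ r ∈ Ioo 0 ε, deriv (deriv D.f) (c + sg s * r) * sg s ≠ 0 := by
    intro r hr h0
    have h1 := habs r hr
    have : 0 < K₁ / r := div_pos hK1 hr.1
    rw [h0] at h1; simp at h1; linarith
  -- in both cases a sign choice
  have key : ∀ σ : ℝ, |σ| = 1 → (∀ r ∈ Ioo 0 ε, 0 < σ * (deriv (deriv D.f) (c + sg s * r) * sg s)) → False := by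
    intro σ hσ hpos
    set q := ε / 2
    set p := q * Real.exp (-(2 * K₂ / K₁ + 1))
    have hq : 0 < q := by positivity
    have hp : 0 < p := by positivity
    have hpq : p < q := by
      have : Real.exp (-(2 * K₂ / K₁ + 1)) < 1 := by
        rw [Real.exp_lt_one_iff]
        have : 0 ≤ 2 * K₂ / K₁ := by have := hK1.le.trans hK12; positivity
        linarith
      nlinarith
    have hsub : ∀ r ∈ Icc p q, r ∈ Ioo 0 ε := fun r hr =>
      ⟨by linarith [hr.1], by have := hr.2; simp only [q] at this; linarith⟩
    have hdd : ∀ r ∈ Icc p q, HasDerivAt (fun r => σ * deriv D.f (c + sg s * r) - K₁ * Real.log r)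
        (σ * (deriv (deriv D.f) (c + sg s * r) * sg s) - K₁ * r⁻¹) r := fun r hr =>
      ((hd r (hsub r hr)).const_mul σ).sub ((Real.hasDerivAt_log (hsub r hr).1.ne').const_mul K₁)
    have := le_of_der_nonneg hpq.le (fun r hr => (hdd r hr).continuousAt.continuousWithinAt)
      (fun r hr => hdd r ⟨hr.1.le, hr.2.le⟩) (fun r hr => by
        have h1 := hsub r ⟨hr.1.le, hr.2.le⟩
        have h2 := habs r h1
        rw [← one_mul |_|, ← hσ, ← abs_mul, abs_of_pos (hpos r h1)] at h2
        rw [div_eq_mul_inv] at h2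
        linarith)

    have hlp : Real.log p = Real.log q - (2 * K₂ / K₁ + 1) := by
      simp only [p]; rw [Real.log_mul hq.ne' (Real.exp_pos _).ne', Real.log_exp]; ring
    rw [hlp] at this
    have b1 : |σ * deriv D.f (c + sg s * p)| ≤ K₂ := by
      rw [abs_mul, hσ, one_mul]
      exact hb1 p (hsub p ⟨le_rfl, hpq.le⟩).1 (hsub p ⟨le_rfl, hpq.le⟩).2
    have b2 : |σ * deriv D.f (c + sg s * q)| ≤ K₂ := by
      rw [abs_mul, hσ, one_mul]
      exact hb1 q (hsub q ⟨hpq.le, le_rfl⟩).1 (hsub q ⟨hpq.le, le_rfl⟩).2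
    have e5 : K₁ * (2 * K₂ / K₁) = 2 * K₂ := by field_simp
    have := (abs_le.1 b1).1
    have := (abs_le.1 b2).2
    nlinarith
  rcases hasDerivWithinAt_forall_lt_or_forall_gt_of_forall_ne (convex_Ioo 0 ε)
    (fun x hx => (hd x hx).hasDerivWithinAt (s := Ioo 0 ε)) (m := 0) hne with h | h
  · exact key (-1) (by simp) (fun r hr => by have := h r hr; linarith)
  · exact key 1 (by simp) (fun r hr => by have := h r hr; linarith)

/-- local estimates on one side, with one constant -/
def Q (D : CritData) (c : ℝ) (s : Bool) (ε : ℝ) : Prop :=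
  1 + ε ≤ D.l s c ∧ D.l s c ≤ 1 / ε ∧
  (∀ r, 0 < r → r ≤ ε → c + sg s * r ∈ unitI →
    c + sg s * r ∉ D.C ∧ ε * |deriv D.f (c + sg s * r)| ≤ r ^ (D.l s c - 1) ∧
    ε * r ^ (D.l s c) ≤ |D.f (c + sg s * r) - D.f c| ∧
    ε * |D.f (c + sg s * r) - D.f c| ≤ r ^ (D.l s c)) ∧
  (∀ r r', 0 < r → r ≤ r' → r' ≤ ε → c + sg s * r' ∈ unitI →
    (1 + ε) * Real.log (r' / r) ≤
      Real.log (|D.f (c + sg s * r') - D.f c| / |D.f (c + sg s * r) - D.f c|))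

theorem exists_free (C : Finset ℝ) (c : ℝ) : ∃ δ > 0, ∀ x, 0 < |x - c| → |x - c| ≤ δ → x ∉ C := by
  induction C using Finset.induction with
  | empty => exact ⟨1, one_pos, by simp⟩
  | insert a t _ ih =>
    obtain ⟨δ, h0, h⟩ := ih
    by_cases hac : a = c
    · refine ⟨δ, h0, fun x hx hx' => ?_⟩
      rw [Finset.mem_insert, not_or]
      refine ⟨?_, h x hx hx'⟩
      rintro rfl; subst hac; simp at hx
    · have hp : 0 < |a - c| := abs_pos.2 (sub_ne_zero.2 hac)
      refine ⟨min δ (|a - c| / 2), lt_min h0 (by positivity), fun x hx hx' => ?_⟩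
      rw [Finset.mem_insert, not_or]
      refine ⟨?_, h x hx (hx'.trans (min_le_left _ _))⟩
      rintro rfl
      have := hx'.trans (min_le_right _ _)
      linarith

theorem Hyp.evQ (H : Hyp D) {c : ℝ} (hc : c ∈ D.C) (s : Bool) :
    ∃ ε₀ > 0, ∀ ε, 0 < ε → ε ≤ ε₀ → Q D c s ε := by
  have hl := H.l_gt hc (s := s)
  have hcI : c ∈ unitI := H.pc.1 hc
  obtain ⟨-, -, K₁, K₂, ε₁, hK1, hK12, hε, hb⟩ := H.pc.2.2.2.2.2 c hc s
  obtain ⟨δ, hδ, hfree⟩ := exists_free D.C c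
  set l := D.l s c with hldef
  have hK2 : 0 < K₂ := hK1.trans_le hK12
  have hl1 : 0 < l - 1 := by linarith
  -- N
  set N := (4 * K₂ / K₁ + 1) ^ (1 / (l - 1)) with hN
  have hb1 : 1 < 4 * K₂ / K₁ + 1 := by have : 0 < 4 * K₂ / K₁ := by positivity
                                       linarith
  have hN1 : 1 < N := Real.one_lt_rpow hb1 (by positivity)
  have hNp : N ^ (l - 1) = 4 * K₂ / K₁ + 1 := by
    rw [hN, ← Real.rpow_mul (by positivity)]
    rw [one_div, inv_mul_cancel₀ hl1.ne', Real.rpow_one]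
  by_cases hin : ∃ r₁ > 0, c + sg s * r₁ ∈ unitI
  swap
  · refine ⟨min (l - 1) (1 / l), lt_min hl1 (by positivity), fun ε h0 h1 => ⟨?_, ?_, ?_, ?_⟩⟩
    · linarith [h1.trans (min_le_left _ _)]
    · have := h1.trans (min_le_right _ _)
      rw [le_div_iff₀ (by linarith)] at this
      rw [le_div_iff₀ h0]; linarith
    · intro r hr _ hm; exact absurd ⟨r, hr, hm⟩ hin
    · intro r r' hr hr' _ hm; exact absurd ⟨r', by linarith, hm⟩ hin
  obtain ⟨r₁, hr₁, hr₁m⟩ := hin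
  have hfv := H.fv_eq hc hr₁ hr₁m
  set R := min r₁ (min (ε₁ / 2) δ) with hR
  have hR0 : 0 < R := lt_min hr₁ (lt_min (by linarith) hδ)
  have hRr : R ≤ r₁ := min_le_left _ _
  have hRε : R < ε₁ := ((min_le_right _ _).trans (min_le_left _ _)).trans_lt (by linarith)
  have hRδ : R ≤ δ := (min_le_right _ _).trans (min_le_right _ _)
  have hmem : ∀ r, 0 ≤ r → r ≤ R → c + sg s * r ∈ unitI := fun r h0 h1 =>
    seg_mem hcI hr₁m h0 (h1.trans hRr)
  have hdist : ∀ r, 0 < r → |c + sg s * r - c| = r := by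
    intro r h0; rw [add_sub_cancel_left, abs_mul, sg_abs, one_mul, abs_of_pos h0]
  have hfr : ∀ r, 0 < r → r ≤ R → c + sg s * r ∉ D.C := by
    intro r h0 h1
    apply hfree
    · rw [hdist r h0]; exact h0
    · rw [hdist r h0]; linarith
  set ε₀ := min (R / (2 * N)) (min (min (l - 1) (1 / l)) (min (min K₁ (1 / K₂)) (1 / (2 * (N - 1))))) with hε0
  have hN0 : 0 < N - 1 := by linarith
  refine ⟨ε₀, by positivity, fun ε h0 h1 => ?_⟩
  have a1 : ε ≤ R / (2 * N) := h1.trans (min_le_left _ _)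
  have hh := h1.trans (min_le_right _ _)
  have a2 : ε ≤ l - 1 := hh.trans ((min_le_left _ _).trans (min_le_left _ _))
  have a3 : ε ≤ 1 / l := hh.trans ((min_le_left _ _).trans (min_le_right _ _))
  have a4 : ε ≤ K₁ := hh.trans ((min_le_right _ _).trans ((min_le_left _ _).trans (min_le_left _ _)))
  have a5 : ε ≤ 1 / K₂ := hh.trans ((min_le_right _ _).trans ((min_le_left _ _).trans (min_le_right _ _)))
  have a6 : ε ≤ 1 / (2 * (N - 1)) := hh.trans ((min_le_right _ _).trans (min_le_right _ _))
  have a1' : N * ε < R := by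
    rw [le_div_iff₀ (by positivity)] at a1; nlinarith
  have aR : ε < R := by nlinarith
  rw [le_div_iff₀ hK2] at a5
  refine ⟨by linarith, ?_, ?_, ?_⟩
  · rw [le_div_iff₀ (by linarith)] at a3
    rw [le_div_iff₀ h0]; linarith
  · intro r hr hr' _
    have hb' := hb _ (mem_sideIoo hr (by linarith : r < ε₁))
    rw [hdist r hr, hfv] at hb'
    obtain ⟨⟨-, b1⟩, ⟨b2, b3⟩, -⟩ := hb'
    have p1 : 0 < r ^ (l - 1) := by positivity
    have p2 : 0 < r ^ l := by positivity
    refine ⟨hfr r hr (by linarith), ?_, ?_, ?_⟩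
    · calc _ ≤ ε * (K₂ * r ^ (l - 1)) := by gcongr
        _ = (ε * K₂) * r ^ (l - 1) := by ring
        _ ≤ 1 * r ^ (l - 1) := by gcongr
        _ = _ := one_mul _
    · exact le_trans (by gcongr) b2
    · calc _ ≤ ε * (K₂ * r ^ l) := by gcongr
        _ = (ε * K₂) * r ^ l := by ring
        _ ≤ 1 * r ^ l := by gcongr
        _ = _ := one_mul _
  · intro r r' hr hrr' hr' _
    have hne : c ≠ c + sg s * R := by
      intro h
      have := hdist R hR0
      rw [← h] at this; simp at this; linarith
    have hnoC : ∀ c' ∈ D.C, ¬ Bt c c' (c + sg s * R) := by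
      intro c' hc' hbt
      have : ∃ t, 0 < t ∧ t ≤ R ∧ c' = c + sg s * t := by
        refine ⟨sg s * (c' - c), ?_, ?_, ?_⟩
        · cases s <;> simp [sg, Bt] at hbt ⊢ <;> rcases hbt with h | h <;> linarith
        · cases s <;> simp [sg, Bt] at hbt ⊢ <;> rcases hbt with h | h <;> linarith
        · rw [← mul_assoc, sg_sq]; ring
      obtain ⟨t, h1, h2, h3⟩ := this
      exact hfr t h1 h2 (h3 ▸ hc')
    obtain ⟨σ, τ, hσ, hτ, hI, -⟩ := H.rep hcI (hmem R hR0.le le_rfl) hne hnoC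
    have hlt := hI.lt
    have hττ : ∀ x : ℝ, τ * (τ * x) = x := by rcases hτ with rfl | rfl <;> simp
    have hτs : τ = sg s := by
      rcases hτ with rfl | rfl <;> cases s <;> simp [sg] at hlt ⊢ <;> linarith
    subst hτs
    have hmul : ∀ t, sg s * (c + sg s * t) = sg s * c + t := by
      intro t; rw [mul_add, hττ]
    rw [hmul] at hI
    have hr'0 : 0 < r' := by linarith
    have key := hI.rmin (N := N) (ε := ε) hN1 (by linarith)
      (fun x hx hx' => by
        set t := x - sg s * c with ht
        have ht0 : 0 < t := by linarith
        have htε : t ≤ ε := by linarith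
        have hx1 : sg s * x = c + sg s * t := by rw [ht, mul_sub, hττ]; ring
        have hx2 : sg s * (sg s * c + N * t) = c + sg s * (N * t) := by rw [mul_add, hττ]
        simp only [hx1, hx2]
        have hNt : 0 < N * t := by positivity
        have hNt' : N * t ≤ N * ε := by gcongr
        have d1 := (hb _ (mem_sideIoo ht0 (by linarith : t < ε₁))).1.2
        have d2 := (hb _ (mem_sideIoo hNt (by linarith : N * t < ε₁))).1.1
        rw [hdist t ht0] at d1
        rw [hdist _ hNt, Real.mul_rpow (by linarith) ht0.le, hNp] at d2
        have q0 : 0 < t ^ (l - 1) := by positivity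
        have d3 : 4 * |deriv D.f (c + sg s * t)| ≤ |deriv D.f (c + sg s * (N * t))| := by
          refine le_trans ?_ d2
          calc _ ≤ 4 * (K₂ * t ^ (l - 1)) := by gcongr
            _ = K₁ * (4 * K₂ / K₁ * t ^ (l - 1)) := by field_simp
            _ ≤ _ := by gcongr; linarith
        have q1 := abs_pos.2 (H.dne (hmem t ht0.le (by linarith)) (hfr t ht0 (by linarith)))
        unfold gD
        calc _ ≤ (4 * |deriv D.f (c + sg s * t)|) ^ (-(1:ℝ) / 2) :=
              Real.rpow_le_rpow_of_nonpos (by positivity) d3 (by norm_num)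
          _ = _ := by
            rw [Real.mul_rpow (by norm_num) q1.le]
            have : (4:ℝ) ^ (-(1:ℝ) / 2) = 1 / 2 := by
              rw [show (4:ℝ) = 2 ^ (2:ℝ) by norm_num, ← Real.rpow_mul (by norm_num)]
              norm_num
            rw [this]; ring)
      (u := sg s * c + r) (v := sg s * c + r') (by linarith) (by linarith) (by linarith)
    simp only [mul_add, hττ, add_sub_cancel_left] at key
    have p1 := hI.slt le_rfl (by linarith : sg s * c + r ≤ _) (by linarith)
    have p2 := hI.slt le_rfl (by linarith : sg s * c + r' ≤ _) (by linarith)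
    simp only [mul_add, hττ] at p1 p2
    have eσ : ∀ x y : ℝ, |x - y| = |σ * x - σ * y| := by
      intro x y; rw [← mul_sub, abs_mul]; rcases hσ with rfl | rfl <;> simp
    rw [eσ (D.f (c + sg s * r')), eσ (D.f (c + sg s * r)), abs_of_pos (by linarith), abs_of_pos (by linarith)]
    refine le_trans ?_ key
    have : 0 ≤ Real.log (r' / r) := Real.log_nonneg (by rw [le_div_iff₀ hr]; linarith)
    gcongr

theorem Hyp.exQ (H : Hyp D) : ∃ ε₀ > 0, ∀ ε, 0 < ε → ε ≤ ε₀ → ∀ c ∈ D.C, ∀ s, Q D c s ε := by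
  have : ∀ᶠ ε in 𝓝[>] (0:ℝ), ∀ c ∈ D.C, ∀ s, Q D c s ε := by
    rw [Filter.eventually_all_finset]
    intro c hc
    rw [Filter.eventually_all]
    intro s
    obtain ⟨ε₀, h0, h⟩ := H.evQ hc s
    filter_upwards [Ioc_mem_nhdsGT h0] with ε hε
    exact h ε hε.1 hε.2
  have h2 := (mem_nhdsGT_iff_exists_Ioc_subset (a := (0:ℝ))).1 this
  obtain ⟨u, hu, hs⟩ := h2
  exact ⟨u, hu, fun ε h0 h1 => hs ⟨h0, h1⟩⟩

/-- the local order at `c` on the side of `x` -/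
def lo (D : CritData) (c x : ℝ) : ℝ := D.l (decide (c < x)) c

theorem side_rep {c x : ℝ} (h : x ≠ c) : x = c + sg (decide (c < x)) * |x - c| := by
  rcases lt_or_gt_of_ne h with h | h
  · rw [abs_of_neg (by linarith)]; simp [sg, not_lt.2 h.le]
  · rw [abs_of_pos (by linarith)]; simp [sg, h]

/-- packaged local estimates -/
structure Loc (D : CritData) (ε : ℝ) : Prop where
  pos : 0 < ε
  half : ε ≤ 1 / 2
  l1 : ∀ c ∈ D.C, ∀ x, 1 + ε ≤ lo D c x
  l2 : ∀ c ∈ D.C, ∀ x, lo D c x ≤ 1 / ε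
  nC : ∀ c ∈ D.C, ∀ x ∈ unitI, x ≠ c → |x - c| ≤ ε → x ∉ D.C
  der : ∀ c ∈ D.C, ∀ x ∈ unitI, x ≠ c → |x - c| ≤ ε →
    ε * |deriv D.f x| ≤ |x - c| ^ (lo D c x - 1)
  lb : ∀ c ∈ D.C, ∀ x ∈ unitI, x ≠ c → |x - c| ≤ ε → ε * |x - c| ^ (lo D c x) ≤ |D.f x - D.f c|
  ub : ∀ c ∈ D.C, ∀ x ∈ unitI, x ≠ c → |x - c| ≤ ε → ε * |D.f x - D.f c| ≤ |x - c| ^ (lo D c x)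
  rm : ∀ c ∈ D.C, ∀ x ∈ unitI, ∀ y ∈ unitI, x ≠ c → (c < x ↔ c < y) → |x - c| ≤ |y - c| → |y - c| ≤ ε →
    (1 + ε) * Real.log (|y - c| / |x - c|) ≤ Real.log (|D.f y - D.f c| / |D.f x - D.f c|)

theorem Hyp.exLoc (H : Hyp D) : ∃ ε, Loc D ε := by
  obtain ⟨ε₀, h0, h⟩ := H.exQ
  set ε := min ε₀ (1 / 2)
  have hε : 0 < ε := by positivity
  have hQ := h ε hε (min_le_left _ _)
  refine ⟨ε, hε, min_le_right _ _, ?_, ?_, ?_, ?_, ?_, ?_, ?_⟩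
  · intro c hc x; exact (hQ c hc _).1
  · intro c hc x; exact (hQ c hc _).2.1
  all_goals intro c hc x hx
  · intro hne hle
    have := (hQ c hc (decide (c < x))).2.2.1 _ (abs_pos.2 (sub_ne_zero.2 hne)) hle
    rw [← side_rep hne] at this; exact (this hx).1
  · intro hne hle
    have := (hQ c hc (decide (c < x))).2.2.1 _ (abs_pos.2 (sub_ne_zero.2 hne)) hle
    rw [← side_rep hne] at this; exact (this hx).2.1
  · intro hne hle
    have := (hQ c hc (decide (c < x))).2.2.1 _ (abs_pos.2 (sub_ne_zero.2 hne)) hle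
    rw [← side_rep hne] at this; exact (this hx).2.2.1
  · intro hne hle
    have := (hQ c hc (decide (c < x))).2.2.1 _ (abs_pos.2 (sub_ne_zero.2 hne)) hle
    rw [← side_rep hne] at this; exact (this hx).2.2.2
  · intro y hy hne hiff hle hle'
    have hyne : y ≠ c := by
      rintro rfl; simp at hle; exact hne (by linarith)
    have := (hQ c hc (decide (c < x))).2.2.2 _ _ (abs_pos.2 (sub_ne_zero.2 hne)) hle hle'
    rw [← side_rep hne, show decide (c < x) = decide (c < y) by simp [hiff], ← side_rep hyne] at this
    exact this hy

end W17

namespace W17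

structure Kst where
  (lm lM rm C₁ C₂ B b ε' η γ c₁ k A d₀ LG ρ0 c0 t₀ M₀ ε : ℝ)
  hlm : 1 < lm
  hlm2 : lm ≤ 2
  hlM : lm ≤ lM
  hε : 0 < ε
  hε2 : ε ≤ 1 / 2
  hrm : 1 ≤ rm
  hC1 : 0 ≤ C₁
  hC2 : 0 ≤ C₂
  hb1 : 1 < b
  hbB : b < B
  hb2 : b ≤ 2
  hε' : 0 < ε'
  hη : 0 < η
  hγ0 : 0 < γ
  hγ1 : γ ≤ 1
  hc1 : 0 < c₁
  hc1' : 2 * lM + 3 ≤ (lm - 1) * c₁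
  hk1 : 4 * c₁ ≤ k
  hk2 : 2 * c₁ * (1 + 1 / ε') ≤ k
  hA : 0 ≤ A
  hd2 : 2 ≤ d₀
  hd3 : C₁ + k * C₂ ≤ d₀
  hd4 : 2 * Real.exp (-(d₀ / 2)) ≤ η
  hd5 : 3 * Real.exp (-(d₀ / 2)) ≤ 1
  hd6 : ∀ d, d₀ ≤ d → 3 * Real.exp (-(γ * d / 2)) ≤ 1
  hd7 : ∀ d, d₀ ≤ d → 3 * Real.exp (-(γ * d / 2)) * (2 * lM * d + C₁) ≤ 1
  hLG : (2 * lM + 1) * d₀ + C₁ + 2 ≤ LG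
  hρ0 : 0 < ρ0
  hρ1 : ρ0 < 1
  hc0 : 0 < c0
  hc01 : c0 ≤ 1
  ht1 : -Real.log ε ≤ t₀ / 2
  ht2 : 4 ≤ t₀ * (ε' / (1 + ε'))
  ht3 : -Real.log ρ0 ≤ t₀ / (1 + ε')
  ht4 : 2 * (-Real.log ρ0 + Real.log 4 - Real.log c0) + 2 * C₁ + A ≤ (B - b) * t₀
  ht5 : Real.log 2 + -Real.log ρ0 + Real.log 4 + 2 * C₁ + A ≤ ε' * t₀
  hM1 : 2 * lM * t₀ + C₁ ≤ M₀
  hM2 : 2 * lM * (-Real.log ρ0 + d₀) + C₁ + 1 ≤ M₀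
  hM3 : ∀ y, 0 ≤ y → 3 * Real.exp (-(γ * y / 2)) * (2 * lM * (1 + 1 / ε') * y + C₁) ≤ M₀

/-- abstract properties of the gauge function -/
structure FP (K : Kst) (F : ℝ → ℝ) : Prop where
  F0 : ∀ x, 0 < x → 0 ≤ F x
  F1 : ∀ x y, 0 < x → x ≤ y → K.k * (y - x) ≤ F y - F x
  F2 : ∀ θ x, 0 < θ → θ ≤ 1 → 0 < x → F (θ * x) ≤ θ ^ K.γ * F x
  Fd : ∀ x y τ l, 0 < x → K.lm ≤ l → l ≤ K.lM → x ≤ (1 + K.η) * τ → l * τ - K.C₂ ≤ y →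
    K.rm * τ ≤ y → F x ≤ K.b / l * F y + K.A

/-- `log ((y+κ)/(x+κ)) ≤ (y - x)/(x+κ)` style bound -/
theorem log_ratio_le {p q : ℝ} (hq : 0 < q) (hp : 0 < p) : Real.log (p / q) ≤ (p - q) / q := by
  have := Real.log_le_sub_one_of_pos (div_pos hp hq)
  rw [sub_div, div_self hq.ne']; exact this

theorem one_sub_le_log {r rv : ℝ} (hr : 0 < r) (hrv : r < rv) : (rv - r) / rv ≤ Real.log (rv / r) := by
  have h := Real.log_le_sub_one_of_pos (div_pos hr (hr.trans hrv))
  rw [Real.log_div hr.ne' (hr.trans hrv).ne'] at h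
  rw [Real.log_div (hr.trans hrv).ne' hr.ne', sub_div, div_self (hr.trans hrv).ne']
  linarith

set_option maxHeartbeats 8000000 in
theorem step_core (K : Kst) {F : ℝ → ℝ} (hF : FP K F)
    {r rv ls ρ κ P Q w₁ w₂ w' l M' Λ' : ℝ}
    (hr : 0 < r) (hrrv : r < rv) (hrvl : rv < ls) (hρ : 0 ≤ ρ) (hκ : 0 ≤ κ)
    (hle : ρ + ls + κ ≤ 1) (hP : K.c0 ≤ P) (hQ : K.c0 ≤ Q) (hw1 : 1 ≤ w₁) (hw2 : 1 ≤ w₂)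
    (hw' : 1 ≤ w') (hww : K.b * w' * (1 + K.ε') ^ 2 ≤ K.lm) (hBw : K.B * w' ≤ 2)
    (hl1 : K.lm ≤ l) (hl2 : l ≤ K.lM)
    (hM : M' ≤ -(w' * l) * Real.log (min r K.ε) + K.C₁)
    (hS1 : Real.log (rv * (ls - r) / (r * (ls - rv))) ≤ Λ')
    (hsh1 : ∀ rz, r ≤ rz → rz ≤ rv → rz ≤ ls / 2 → rz ≤ K.ε →
      (l - 1) * Real.log (rz / r) - K.C₂ ≤ Λ' - Real.log (rv * (ls - r) / (r * (ls - rv))))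
    (hsh2 : rv ≤ ls / 2 → rv ≤ K.ε → l * Real.log (rv / r) - K.C₂ ≤ Λ' ∧
      K.rm * Real.log (rv / r) ≤ Λ')
    (hnear : ls ≤ K.ρ0 → κ = 0 ∧ K.LG ≤ Real.log Q + (w' * l - 1) * Real.log ls)
    (hR : ρ = 0 → w₁ = K.B * w')
    (hK : 0 < ρ → ρ ≤ K.ρ0 → 0 ≤ Real.log P + (K.lm - 1) * Real.log ρ)
    (hFM : F Λ' ≤ M') :
    F (Real.log ((rv + ρ) * (ls - r + κ) / ((r + ρ) * (ls - rv + κ)))) ≤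
      max (max (w₁ * Real.log (P * (ls - r + κ) / ((r + ρ) * (ρ + ls + κ))))
        (w₂ * Real.log (Q * (rv + ρ) / ((ls - rv + κ) * (ρ + ls + κ))))) K.M₀ := by
  have hlm := K.hlm
  have hlM := K.hlM
  have hε := K.hε
  have hC1 := K.hC1
  have hC2 := K.hC2
  have hb1 := K.hb1
  have hε' := K.hε'
  have hc1 := K.hc1
  have hk1 := K.hk1
  have hk0 : 0 < K.k := by linarith
  have hd2 := K.hd2
  have hrv : 0 < rv := hr.trans hrrv
  have hls : 0 < ls := hrv.trans hrvl
  have hhu : 0 < ls - r := by linarith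
  have hhv : 0 < ls - rv := by linarith
  have hP0 : 0 < P := K.hc0.trans_le hP
  have hQ0 : 0 < Q := K.hc0.trans_le hQ
  have hρ00 := K.hρ0
  set Λ := Real.log ((rv + ρ) * (ls - r + κ) / ((r + ρ) * (ls - rv + κ))) with hΛ
  set Λs := Real.log (rv * (ls - r) / (r * (ls - rv))) with hΛs
  set x := Real.log (P * (ls - r + κ) / ((r + ρ) * (ρ + ls + κ))) with hx
  set y := Real.log (Q * (rv + ρ) / ((ls - rv + κ) * (ρ + ls + κ))) with hy
  have eΛ : Λ = Real.log ((rv + ρ) / (r + ρ)) + Real.log ((ls - r + κ) / (ls - rv + κ)) := by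
    rw [hΛ, ← Real.log_mul (by positivity) (by positivity)]; congr 1; field_simp
  have eΛs : Λs = Real.log (rv / r) + Real.log ((ls - r) / (ls - rv)) := by
    rw [hΛs, ← Real.log_mul (by positivity) (by positivity)]; congr 1; field_simp
  have eτ : Real.log (rv / r) = Real.log rv - Real.log r := Real.log_div hrv.ne' hr.ne'
  have hτ0 : 0 < Real.log (rv / r) := Real.log_pos (by rw [lt_div_iff₀ hr]; linarith)
  set τ := Real.log (rv / r) with hτ
  have hL1 : Real.log ((ls - r + κ) / (ls - rv + κ)) ≤ Real.log ((ls - r) / (ls - rv)) := by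
    apply Real.log_le_log (by positivity)
    rw [div_le_div_iff₀ (by positivity) (by positivity)]
    linarith [mul_le_mul_of_nonneg_left (by linarith : ls - rv ≤ ls - r) hκ]
  have hL2 : Real.log ((rv + ρ) / (r + ρ)) ≤ τ := by
    apply Real.log_le_log (by positivity)
    rw [div_le_div_iff₀ (by positivity) (by positivity)]
    linarith [mul_le_mul_of_nonneg_left hrrv.le hρ]
  have hL3 : 0 < Real.log ((ls - r + κ) / (ls - rv + κ)) := by
    apply Real.log_pos; rw [lt_div_iff₀ (by positivity)]; linarith
  have hL4 : 0 < Real.log ((rv + ρ) / (r + ρ)) := by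
    apply Real.log_pos; rw [lt_div_iff₀ (by positivity)]; linarith
  have hΛ0 : 0 < Λ := by linarith
  have hΛΛs : Λ ≤ Λs := by linarith
  have hFΛ0 := hF.F0 Λ hΛ0
  have hF1 : F Λ ≤ F Λs := by
    have := hF.F1 Λ Λs hΛ0 hΛΛs
    have := mul_nonneg hk0.le (sub_nonneg.2 hΛΛs); linarith
  have hF2 : F Λs ≤ F Λ' - K.k * (Λ' - Λs) := by
    have := hF.F1 Λs Λ' (by linarith) hS1; linarith
  have hF3 : F Λ ≤ M' := by
    have := mul_nonneg hk0.le (sub_nonneg.2 hS1); linarith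
  by_contra hcon
  rw [not_le, max_lt_iff, max_lt_iff] at hcon
  obtain ⟨⟨hX, hY⟩, hM0⟩ := hcon
  have hY' : y < F Λ := by
    by_contra h; rw [not_lt] at h
    linarith [le_mul_of_one_le_left (hFΛ0.trans h) hw2]
  have hX' : x < F Λ := by
    by_contra h; rw [not_lt] at h
    linarith [le_mul_of_one_le_left (hFΛ0.trans h) hw1]
  -- the order parameter
  set α := w' * l with hα
  have hw'2 : w' ≤ 2 := by
    have h1 := K.hbB
    have h2 : 1 ≤ K.B := by linarith
    linarith [le_mul_of_one_le_left (by linarith : 0 ≤ w') h2]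
  have hα1 : 1 ≤ α := by
    rw [hα]; exact one_le_mul_of_one_le_of_one_le hw' (by linarith)
  have hαM : α ≤ 2 * K.lM := by
    rw [hα]; apply mul_le_mul hw'2 hl2 (by linarith) (by norm_num)
  have hlM0 : 0 < K.lM := by linarith
  set S0 := - Real.log K.ρ0 with hS0
  have hS00 : 0 < S0 := by rw [hS0]; linarith [Real.log_neg K.hρ0 K.hρ1]
  have ht0 : 0 < K.t₀ := by
    by_contra h; rw [not_lt] at h
    have := K.ht2
    have : 0 < K.ε' / (1 + K.ε') := by positivity
    linarith [mul_nonpos_of_nonpos_of_nonneg h this.le]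
  have hlogε : Real.log K.ε < 0 := Real.log_neg hε (by linarith [K.hε2])
  have ht1 := K.ht1
  -- r ≤ ε
  have hrε : r ≤ K.ε := by
    by_contra h; rw [not_le] at h
    rw [min_eq_right h.le] at hM
    have := K.hM1
    linarith [mul_le_mul hαM (by linarith : -Real.log K.ε ≤ K.t₀) (by linarith) (by linarith)]
  rw [min_eq_left hrε] at hM
  obtain ⟨t, ht⟩ : ∃ t, t = - Real.log r := ⟨_, rfl⟩
  obtain ⟨tv, htv⟩ : ∃ t, t = - Real.log rv := ⟨_, rfl⟩
  obtain ⟨s, hs⟩ : ∃ t, t = - Real.log ls := ⟨_, rfl⟩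
  have hs0 : 0 ≤ s := by
    rw [hs]; linarith [Real.log_nonpos hls.le (by linarith : ls ≤ 1)]
  have hMt : M' ≤ α * t + K.C₁ := by rw [ht]; linarith
  have httv : tv < t := by rw [ht, htv]; linarith [Real.log_lt_log hr hrrv]
  have htvs : s < tv := by rw [hs, htv]; linarith [Real.log_lt_log hrv hrvl]
  have hτt : τ = t - tv := by rw [eτ, ht, htv]; ring
  obtain ⟨d, hd⟩ : ∃ d, d = t - s := ⟨_, rfl⟩
  obtain ⟨dv, hdv⟩ : ∃ d, d = tv - s := ⟨_, rfl⟩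
  have htbig : K.t₀ < t := by
    by_contra h; rw [not_lt] at h
    have := K.hM1
    have : α * t ≤ 2 * K.lM * K.t₀ := by
      have : 0 < t := by linarith
      apply mul_le_mul hαM h this.le (by linarith)
    linarith
  -- near y bound
  have hynear : ls ≤ K.ρ0 → K.LG + α * s - dv ≤ y := by
    intro hn
    obtain ⟨hκ0, hq⟩ := hnear hn
    have e : Real.log (Q * rv / (ls * ls)) = Real.log Q + Real.log rv - 2 * Real.log ls := by
      rw [Real.log_div (by positivity) (by positivity), Real.log_mul (by positivity) (by positivity),
        Real.log_mul (by positivity) (by positivity)]; ring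
    have h1 : Real.log (Q * rv / (ls * ls)) ≤ y := by
      rw [hy]; apply Real.log_le_log (by positivity)
      rw [hκ0, div_le_div_iff₀ (by positivity) (by positivity), add_zero, add_zero]
      have : rv * ((ls - rv) * (ρ + ls)) ≤ (rv + ρ) * (ls * ls) := by
        have h1 : (ls - rv) * (ρ + ls) ≤ ls * (ρ + ls) := by
          apply mul_le_mul_of_nonneg_right <;> linarith
        have h2 : rv * (ls * (ρ + ls)) ≤ (rv + ρ) * (ls * ls) := by
          have : 0 ≤ ρ * ls * (ls - rv) := by positivity
          linarith
        exact (mul_le_mul_of_nonneg_left h1 hrv.le).trans h2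
      linarith [mul_le_mul_of_nonneg_left this hQ0.le]
    have q1 : Real.log ls = - s := by rw [hs]; ring
    have q2 : Real.log rv = - tv := by rw [htv]; ring
    rw [q1] at hq
    rw [e, q1, q2] at h1
    linarith
  have hLG := K.hLG
  have hlogLG : 2 ≤ K.LG := by
    linarith [mul_nonneg (by linarith : 0 ≤ 2 * K.lM + 1) (by linarith : 0 ≤ K.d₀)]
  have hfar : ¬ ls ≤ K.ρ0 → s ≤ S0 := by
    intro h; rw [not_le] at h
    rw [hs, hS0]; linarith [Real.log_le_log K.hρ0 h.le]
  have hαt : α * t = α * s + α * d := by rw [hd]; ring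
  have hM2 := K.hM2
  -- (a)
  have hdd : K.d₀ < d := by
    by_contra h; rw [not_lt] at h
    have hαd : α * d ≤ 2 * K.lM * K.d₀ := by
      have : 0 < d := by linarith
      apply mul_le_mul hαM h this.le (by linarith)
    by_cases hn : ls ≤ K.ρ0
    · have := hynear hn
      have : dv ≤ K.d₀ := by linarith
      linarith
    · have := hfar hn
      have : α * s ≤ 2 * K.lM * S0 := mul_le_mul hαM this hs0 (by linarith)
      linarith
  have hd0 : 0 < d := by linarith
  -- (b)
  have hb : ∀ rz, r ≤ rz → rz ≤ rv → rz ≤ ls / 2 → rz ≤ K.ε → Real.log (rz / r) < K.c₁ * d / K.k := by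
    intro rz h1 h2 h3 h4
    by_contra h; rw [not_lt, div_le_iff₀ hk0] at h
    have h5 := hsh1 rz h1 h2 h3 h4
    have h6 : F Λ ≤ M' - K.k * ((l - 1) * Real.log (rz / r) - K.C₂) := by
      have := mul_le_mul_of_nonneg_left h5 hk0.le
      linarith
    have h7 : (2 * K.lM + 3) * d ≤ K.k * ((l - 1) * Real.log (rz / r)) := by
      calc _ ≤ ((K.lm - 1) * K.c₁) * d := by have := K.hc1'; gcongr
        _ ≤ ((l - 1) * K.c₁) * d := by gcongr
        _ = (l - 1) * (K.c₁ * d) := by ring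
        _ ≤ (l - 1) * (Real.log (rz / r) * K.k) := by
          apply mul_le_mul_of_nonneg_left h; linarith
        _ = _ := by ring
    have h8 : α * d ≤ 2 * K.lM * d := by gcongr
    have h9 := K.hd3
    have h10 : F Λ ≤ α * s - 2 * d := by linarith
    by_cases hn : ls ≤ K.ρ0
    · have := hynear hn
      linarith
    · have := hfar hn
      have : α * s ≤ 2 * K.lM * S0 := mul_le_mul hαM this hs0 (by linarith)
      linarith [mul_nonneg hlM0.le (by linarith : 0 ≤ K.d₀)]
  have hc1k : K.c₁ * d / K.k ≤ d / 4 := by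
    rw [div_le_div_iff₀ hk0 (by norm_num)]
    linarith [mul_le_mul_of_nonneg_left hk1 hd0.le]
  have hlog2 : Real.log 2 < 1 := by linarith [Real.log_two_lt_d9]
  have hlog2' : 0 < Real.log 2 := Real.log_pos (by norm_num)
  have erz : ∀ rz, 0 < rz → Real.log (rz / r) = Real.log rz + t := by
    intro rz h; rw [Real.log_div h.ne' hr.ne', ht]; ring
  have els2 : Real.log (ls / 2) = - s - Real.log 2 := by
    rw [Real.log_div hls.ne' (by norm_num), hs]; ring
  have hrls : r ≤ ls / 2 := by
    rw [← Real.log_le_log_iff hr (by positivity), els2]; linarith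
  -- (c)
  have hrv2 : rv ≤ ls / 2 ∧ rv ≤ K.ε := by
    by_contra hcon
    by_cases hle2 : ls / 2 ≤ K.ε
    · have h1 : ls / 2 ≤ rv := by
        by_contra h; rw [not_le] at h; exact hcon ⟨h.le, by linarith⟩
      have := hb (ls / 2) hrls h1 le_rfl hle2
      rw [erz _ (by positivity), els2] at this
      linarith
    · rw [not_le] at hle2
      have h1 : K.ε ≤ rv := by
        by_contra h; rw [not_le] at h; exact hcon ⟨by linarith, h.le⟩
      have := hb K.ε hrε h1 hle2.le le_rfl
      rw [erz _ hε] at this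
      have : d ≤ t := by linarith
      linarith
  obtain ⟨hrv2, hrvε⟩ := hrv2
  have hτd : τ < K.c₁ * d / K.k := hb rv hrrv.le le_rfl hrv2 hrvε
  have hdvd : d / 2 ≤ dv := by
    have : dv = d - τ := by rw [hτt]; linarith
    linarith
  obtain ⟨hsa, hsb⟩ := hsh2 hrv2 hrvε
  have hedv : rv / ls = Real.exp (-dv) := by
    rw [← Real.exp_log (show 0 < rv / ls by positivity), Real.log_div hrv.ne' hls.ne']
    congr 1; rw [hdv, htv, hs]; ring
  have hrvr : rv - r ≤ rv * τ := by
    have := one_sub_le_log hr hrrv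
    rw [div_le_iff₀ hrv] at this; linarith
  have hH : Real.log ((ls - r) / (ls - rv)) ≤ 2 * Real.exp (-dv) * τ := by
    have h1 := log_ratio_le hhv hhu
    have h2 : (ls - r - (ls - rv)) / (ls - rv) ≤ (rv * τ) / (ls / 2) := by
      apply div_le_div₀ (by positivity) (by linarith) (by positivity) (by linarith)
    rw [← hedv]
    calc _ ≤ _ := h1
      _ ≤ _ := h2
      _ = _ := by field_simp
  have hΛη : Λ ≤ (1 + K.η) * τ := by
    have : Real.exp (-dv) ≤ Real.exp (-(K.d₀ / 2)) := by
      apply Real.exp_le_exp.2; linarith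
    have h4 := K.hd4
    linarith [mul_le_mul_of_nonneg_right (by linarith : 2 * Real.exp (-dv) ≤ K.η) hτ0.le]
  have hl0 : 0 < l := by linarith
  have hFd : F Λ ≤ K.b * w' * t + 2 * K.C₁ + K.A := by
    have h1 := hF.Fd Λ Λ' τ l hΛ0 hl1 hl2 hΛη hsa hsb
    have h2 : K.b / l * F Λ' ≤ K.b / l * (α * t + K.C₁) := by
      apply mul_le_mul_of_nonneg_left (by linarith) (by positivity)
    have h3 : K.b / l * (α * t + K.C₁) = K.b * w' * t + K.b / l * K.C₁ := by
      rw [hα]; field_simp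
    have h4 : K.b / l * K.C₁ ≤ 2 * K.C₁ := by
      apply mul_le_mul_of_nonneg_right _ hC1
      rw [div_le_iff₀ hl0]; have := K.hb2; linarith
    linarith
  have ht00 : 0 < t := by linarith
  have hrmτ : τ ≤ Λ' := by linarith [le_mul_of_one_le_left hτ0.le K.hrm]
  have hlog4 : 0 < Real.log 4 := Real.log_pos (by norm_num)
  have hFθ : ∀ q, 0 < q → 3 * Real.exp (-q) ≤ 1 → Λ ≤ 3 * Real.exp (-q) * τ →
      F Λ ≤ 3 * Real.exp (-(K.γ * q)) * (α * t + K.C₁) := by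
    intro q hq h1 h2
    have hpos : 0 < 3 * Real.exp (-q) := by positivity
    have h3 : Λ ≤ 3 * Real.exp (-q) * Λ' := h2.trans (mul_le_mul_of_nonneg_left hrmτ hpos.le)
    have h4 := hF.F2 _ Λ' hpos h1 (by linarith)
    have h5 : F Λ ≤ F (3 * Real.exp (-q) * Λ') := by
      have := hF.F1 _ _ hΛ0 h3
      have := mul_nonneg hk0.le (sub_nonneg.2 h3)
      linarith
    have h6 : (3 * Real.exp (-q)) ^ K.γ ≤ 3 * Real.exp (-(K.γ * q)) := by
      rw [Real.mul_rpow (by norm_num) (Real.exp_pos _).le, ← Real.exp_mul]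
      have : (3:ℝ) ^ K.γ ≤ 3 := by
        calc (3:ℝ) ^ K.γ ≤ 3 ^ (1:ℝ) := Real.rpow_le_rpow_of_exponent_le (by norm_num) K.hγ1
          _ = 3 := by norm_num
      rw [show -q * K.γ = -(K.γ * q) by ring]
      gcongr
    calc F Λ ≤ _ := h5
      _ ≤ _ := h4
      _ ≤ (3 * Real.exp (-(K.γ * q))) * (α * t + K.C₁) := by
        have : 0 ≤ α * t + K.C₁ := by positivity
        have : 0 ≤ (3 * Real.exp (-q)) ^ K.γ := by positivity
        calc _ ≤ (3 * Real.exp (-q)) ^ K.γ * (α * t + K.C₁) := by gcongr; linarith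
          _ ≤ _ := by gcongr
  -- x bound
  have hxb : (ρ ≤ ls ∨ ¬ ls ≤ K.ρ0) →
      Real.log P - Real.log (r + ρ) - (S0 + Real.log 4) ≤ x := by
    intro hor
    have key : K.ρ0 / 4 ≤ (ls - r + κ) / (ρ + ls + κ) := by
      rw [div_le_div_iff₀ (by norm_num) (by positivity)]
      by_cases hn : ls ≤ K.ρ0
      · obtain ⟨hκ0, -⟩ := hnear hn
        rw [hκ0]
        have : ρ ≤ ls := hor.resolve_right (not_not_intro hn)
        have := K.hρ1
        linarith [mul_le_mul_of_nonneg_right this.le (by linarith : 0 ≤ ρ + ls)]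
      · rw [not_le] at hn
        linarith [mul_le_mul_of_nonneg_left hle hρ00.le]
    have e : x = Real.log P - Real.log (r + ρ) + Real.log ((ls - r + κ) / (ρ + ls + κ)) := by
      rw [hx, ← Real.log_div (by positivity) (by positivity), ← Real.log_mul (by positivity) (by positivity)]
      congr 1; field_simp
    have h2 := Real.log_le_log (by positivity) key
    rw [Real.log_div hρ00.ne' (by norm_num)] at h2
    linarith
  rcases eq_or_lt_of_le hρ with hρe | hρp
  · -- (c-R)
    have h1 := hxb (Or.inl (by linarith))
    rw [← hρe, add_zero] at h1
    have h2 := hR hρe.symm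
    have h3 := Real.log_le_log K.hc0 hP
    have h4 := K.ht4
    rw [h2] at hX
    have h5 : t + Real.log K.c0 - (S0 + Real.log 4) ≤ x := by linarith
    have hlc0 : Real.log K.c0 ≤ 0 := Real.log_nonpos K.hc0.le K.hc01
    have hBb := K.hbB
    have h6 : K.B * w' * (t + Real.log K.c0 - (S0 + Real.log 4)) < F Λ := by
      refine lt_of_le_of_lt (mul_le_mul_of_nonneg_left h5 ?_) hX
      apply mul_nonneg <;> linarith
    have h7 : (K.B - K.b) * K.t₀ ≤ (K.B - K.b) * (w' * t) := by
      apply mul_le_mul_of_nonneg_left _ (by linarith)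
      linarith [le_mul_of_one_le_left ht00.le hw']
    have h8 : K.B * w' * (S0 + Real.log 4 - Real.log K.c0) ≤ 2 * (S0 + Real.log 4 - Real.log K.c0) := by
      apply mul_le_mul_of_nonneg_right hBw; linarith
    linarith
  by_cases hρls : ls ≤ ρ
  · -- (K1)
    have hg : Real.log ((rv + ρ) / (r + ρ)) ≤ Real.exp (-dv) * τ := by
      have h1 := log_ratio_le (show 0 < r + ρ by positivity) (show 0 < rv + ρ by positivity)
      have h2 : (rv + ρ - (r + ρ)) / (r + ρ) ≤ (rv * τ) / ls :=
        div_le_div₀ (by positivity) (by linarith) hls (by linarith)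
      rw [← hedv]
      calc _ ≤ _ := h1
        _ ≤ _ := h2
        _ = _ := by field_simp
    have hdv2 : Real.exp (-dv) ≤ Real.exp (-(d / 2)) := Real.exp_le_exp.2 (by linarith)
    have hF4 := hFθ (d / 2) (by linarith)
      (by have := K.hd5
          have : Real.exp (-(d / 2)) ≤ Real.exp (-(K.d₀ / 2)) := Real.exp_le_exp.2 (by linarith)
          linarith)
      (by linarith [mul_le_mul_of_nonneg_right hdv2 hτ0.le])
    rw [show K.γ * (d / 2) = K.γ * d / 2 by ring] at hF4
    have h6 := K.hd6 d hdd.le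
    have h7 := K.hd7 d hdd.le
    have h8 : F Λ ≤ α * s + 1 := by
      have e0 : 0 < 3 * Real.exp (-(K.γ * d / 2)) := by positivity
      have : 3 * Real.exp (-(K.γ * d / 2)) * (α * t + K.C₁) ≤
          1 * (α * s) + 3 * Real.exp (-(K.γ * d / 2)) * (2 * K.lM * d + K.C₁) := by
        rw [hαt, show α * s + α * d + K.C₁ = α * s + (α * d + K.C₁) by ring, mul_add]
        gcongr
      linarith
    by_cases hn : ls ≤ K.ρ0
    · obtain ⟨hκ0, hq⟩ := hnear hn
      have h1 : Real.log (Q / (2 * ls)) ≤ y := by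
        rw [hy]; apply Real.log_le_log (by positivity)
        rw [hκ0, div_le_div_iff₀ (by positivity) (by positivity), add_zero, add_zero]
        have : (ls - rv) * (ρ + ls) ≤ (rv + ρ) * (2 * ls) := by
          have h1 : (ls - rv) * (ρ + ls) ≤ ls * (ρ + ls) := by
            apply mul_le_mul_of_nonneg_right <;> linarith
          have h2 : ls * ls ≤ ls * ρ := mul_le_mul_of_nonneg_left hρls hls.le
          linarith [mul_pos hrv hls]
        linarith [mul_le_mul_of_nonneg_left this hQ0.le]
      rw [Real.log_div hQ0.ne' (by positivity), Real.log_mul (by norm_num) hls.ne'] at h1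
      have : Real.log ls = - s := by rw [hs]; ring
      rw [this] at hq h1
      linarith
    · have := hfar hn
      have : α * s ≤ 2 * K.lM * S0 := mul_le_mul hαM this hs0 (by linarith)
      linarith [mul_nonneg hlM0.le (by linarith : 0 ≤ K.d₀)]
  -- (K2)
  rw [not_le] at hρls
  obtain ⟨z, hz⟩ : ∃ z, z = - Real.log (max ρ r) := ⟨_, rfl⟩
  have hmx : 0 < max ρ r := lt_max_of_lt_left hρp
  have hzt : z ≤ t := by
    rw [hz, ht]; linarith [Real.log_le_log hr (le_max_right ρ r)]
  have hzs : s ≤ z := by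
    rw [hz, hs]; linarith [Real.log_le_log hmx (max_le hρls.le (by linarith : r ≤ ls))]
  by_cases hyz : K.ε' * z < t - z
  · have hy1 : t ≤ (1 + 1 / K.ε') * (t - z) := by
      have : z ≤ 1 / K.ε' * (t - z) := by
        rw [div_mul_eq_mul_div, one_mul, le_div_iff₀ hε']; linarith
      linarith
    have hρr : max ρ r = ρ := by
      apply max_eq_left
      by_contra h; rw [not_le] at h
      rw [max_eq_right h.le] at hz
      have : 0 ≤ K.ε' * z := by apply mul_nonneg hε'.le; linarith
      linarith
    rw [hρr] at hz
    have hτy : τ ≤ (t - z) / 2 := by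
      have h1 : K.c₁ * d / K.k ≤ (t - z) / 2 := by
        rw [div_le_div_iff₀ hk0 (by norm_num)]
        calc K.c₁ * d * 2 ≤ K.c₁ * t * 2 := by gcongr; linarith
          _ ≤ K.c₁ * ((1 + 1 / K.ε') * (t - z)) * 2 := by gcongr
          _ = (2 * K.c₁ * (1 + 1 / K.ε')) * (t - z) := by ring
          _ ≤ K.k * (t - z) := by
            apply mul_le_mul_of_nonneg_right K.hk2; linarith
          _ = _ := by ring
      linarith
    have hg : Real.log ((rv + ρ) / (r + ρ)) ≤ Real.exp (-((t - z) / 2)) * τ := by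
      have h1 := log_ratio_le (show 0 < r + ρ by positivity) (show 0 < rv + ρ by positivity)
      have h2 : (rv + ρ - (r + ρ)) / (r + ρ) ≤ (rv * τ) / ρ :=
        div_le_div₀ (by positivity) (by linarith) hρp (by linarith)
      have h3 : rv / ρ ≤ Real.exp (-((t - z) / 2)) := by
        rw [← Real.exp_log (show 0 < rv / ρ by positivity), Real.log_div hrv.ne' hρp.ne']
        apply Real.exp_le_exp.2
        linarith
      calc _ ≤ _ := h1
        _ ≤ _ := h2
        _ = rv / ρ * τ := by field_simp
        _ ≤ _ := by gcongr
    have hdv2 : Real.exp (-dv) ≤ Real.exp (-((t - z) / 2)) := Real.exp_le_exp.2 (by linarith)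
    have hyb : 4 ≤ t - z := by
      have h1 := K.ht2
      have h2 : t * (K.ε' / (1 + K.ε')) ≤ t - z := by
        rw [← le_div_iff₀ (by positivity)]
        refine hy1.trans (le_of_eq ?_)
        field_simp; ring
      have h3 : K.t₀ * (K.ε' / (1 + K.ε')) ≤ t * (K.ε' / (1 + K.ε')) := by gcongr
      linarith
    have hF4 := hFθ ((t - z) / 2) (by linarith)
      (by
        have h1 : Real.exp (-((t - z) / 2)) ≤ Real.exp (-2) := Real.exp_le_exp.2 (by linarith)
        have h2 : Real.exp (-2) ≤ 1 / 3 := by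
          rw [Real.exp_neg, ← one_div]
          apply one_div_le_one_div_of_le (by norm_num)
          have := Real.add_one_le_exp (2:ℝ); linarith
        linarith)
      (by linarith [mul_le_mul_of_nonneg_right hdv2 hτ0.le])
    rw [show K.γ * ((t - z) / 2) = K.γ * (t - z) / 2 by ring] at hF4
    have h3 := K.hM3 (t - z) (by linarith)
    have h4 : α * t + K.C₁ ≤ 2 * K.lM * (1 + 1 / K.ε') * (t - z) + K.C₁ := by
      have : α * t ≤ (2 * K.lM) * ((1 + 1 / K.ε') * (t - z)) :=
        mul_le_mul hαM hy1 ht00.le (by linarith)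
      linarith
    have h5 : 3 * Real.exp (-(K.γ * (t - z) / 2)) * (α * t + K.C₁) ≤
      3 * Real.exp (-(K.γ * (t - z) / 2)) * (2 * K.lM * (1 + 1 / K.ε') * (t - z) + K.C₁) := by gcongr
    linarith
  · rw [not_lt] at hyz
    have hzt' : t / (1 + K.ε') ≤ z := by
      rw [div_le_iff₀ (by positivity)]; linarith
    have hzρ : Real.log ρ ≤ - z := by
      rw [hz]; linarith [Real.log_le_log hρp (le_max_left ρ r)]
    have hρρ0 : ρ ≤ K.ρ0 := by
      rw [← Real.log_le_log_iff hρp hρ00]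
      have h1 := K.ht3
      have h2 : K.t₀ / (1 + K.ε') ≤ t / (1 + K.ε') := by gcongr
      linarith
    have h1 := hK hρp hρρ0
    have h2 := hxb (Or.inl hρls.le)
    have h3 : Real.log (r + ρ) ≤ Real.log 2 - z := by
      rw [hz, sub_neg_eq_add, ← Real.log_mul (by norm_num) hmx.ne']
      apply Real.log_le_log (by positivity)
      linarith [le_max_left ρ r, le_max_right ρ r]
    have h4 : K.lm * z - Real.log 2 - (S0 + Real.log 4) ≤ x := by
      have : (K.lm - 1) * Real.log ρ ≤ (K.lm - 1) * (-z) := by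
        apply mul_le_mul_of_nonneg_left hzρ; linarith
      linarith
    have h5 : (K.b * w' + K.ε') * t ≤ K.lm * z := by
      have h6 : K.b * w' * (1 + K.ε') ^ 2 * (t / (1 + K.ε')) ≤ K.lm * z := by
        apply mul_le_mul hww hzt' (by positivity) (by linarith)
      refine le_trans ?_ h6
      have e : K.b * w' * (1 + K.ε') ^ 2 * (t / (1 + K.ε')) = (K.b * w' + K.b * w' * K.ε') * t := by
        field_simp
      rw [e]
      apply mul_le_mul_of_nonneg_right _ ht00.le
      have : 1 ≤ K.b * w' := one_le_mul_of_one_le_of_one_le hb1.le hw'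
      linarith [le_mul_of_one_le_left hε'.le this]
    have h7 := K.ht5
    have h8 : K.ε' * K.t₀ ≤ K.ε' * t := by gcongr
    linarith

end W17

namespace W17

/-- gauge -/
def phi (Λ1 γ γ2 x : ℝ) : ℝ := min ((x / Λ1) ^ γ2) ((x / Λ1) ^ γ)

theorem phi_pos {Λ1 γ γ2 x : ℝ} (h1 : 0 < Λ1) (hx : 0 < x) : 0 < phi Λ1 γ γ2 x := by
  unfold phi; have := div_pos hx h1; exact lt_min (by positivity) (by positivity)

theorem phi_mono {Λ1 γ γ2 x y : ℝ} (h1 : 0 < Λ1) (hγ : 0 ≤ γ) (hγ2 : 0 ≤ γ2) (hx : 0 < x) (hxy : x ≤ y) :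
    phi Λ1 γ γ2 x ≤ phi Λ1 γ γ2 y := by
  unfold phi
  have := div_pos hx h1
  apply min_le_min <;> gcongr

theorem phi_scale {Λ1 γ γ2 θ x : ℝ} (h1 : 0 < Λ1) (hγ2 : γ ≤ γ2) (hθ : 0 < θ)
    (hθ1 : θ ≤ 1) (hx : 0 < x) :
    phi Λ1 γ γ2 (θ * x) ≤ θ ^ γ * phi Λ1 γ γ2 x := by
  unfold phi
  have := div_pos hx h1
  rw [mul_min_of_nonneg _ _ (by positivity), mul_div_assoc, Real.mul_rpow hθ.le this.le,
    Real.mul_rpow hθ.le this.le]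
  apply min_le_min _ le_rfl
  gcongr ?_ * _
  exact Real.rpow_le_rpow_of_exponent_ge hθ hθ1 hγ2

theorem phi_small {Λ1 γ γ2 x : ℝ} (h1 : 0 < Λ1) (hγ2 : γ ≤ γ2) (hx : 0 < x) (hx1 : x ≤ Λ1) :
    phi Λ1 γ γ2 x = (x / Λ1) ^ γ2 := by
  unfold phi
  exact min_eq_left (Real.rpow_le_rpow_of_exponent_ge (div_pos hx h1) ((div_le_one h1).2 hx1) hγ2)

def Fg (k Λ1 γ γ2 T x : ℝ) : ℝ := k * x + T * phi Λ1 γ γ2 x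

theorem Fg_FP (K : Kst) {Λ1 γ2 T : ℝ} (hT : 0 < T) (h1 : 1 ≤ Λ1) (hγ2 : 1 ≤ γ2)
    (hA : K.A = K.k * Λ1)
    (e1 : (1 + K.η) ^ 2 ≤ √K.b) (e2 : √K.b ≤ K.lm) (e3 : K.lM ^ (1 - K.γ) ≤ √K.b)
    (e4 : K.C₂ ≤ K.η * Λ1) (e5 : 1 + K.η ≤ √K.rm) (e6 : K.lM ≤ (√K.rm) ^ γ2) :
    FP K (Fg K.k Λ1 K.γ γ2 T) := by
  have h0 : 0 < Λ1 := by linarith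
  have hk : 0 < K.k := by have := K.hk1; have := K.hc1; linarith
  have hγ0 := K.hγ0
  have hγ1 := K.hγ1
  have hgg : K.γ ≤ γ2 := by linarith
  refine ⟨?_, ?_, ?_, ?_⟩
  · intro x hx
    have := phi_pos (γ := K.γ) (γ2 := γ2) h0 hx
    unfold Fg; positivity
  · intro x y hx hxy
    have := phi_mono (γ := K.γ) (γ2 := γ2) h0 hγ0.le (by linarith) hx hxy
    have := mul_le_mul_of_nonneg_left this hT.le
    unfold Fg; linarith
  · intro θ x hθ hθ1 hx
    have := mul_le_mul_of_nonneg_left (phi_scale (γ := K.γ) (γ2 := γ2) h0 hgg hθ hθ1 hx) hT.le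
    have h2 : θ ≤ θ ^ K.γ := by
      calc θ = θ ^ (1:ℝ) := by simp
        _ ≤ _ := Real.rpow_le_rpow_of_exponent_ge hθ hθ1 hγ1
    have := mul_le_mul_of_nonneg_right h2 (mul_pos hk hx).le
    unfold Fg; linarith
  · intro x y τ l hx hl1 hl2 hxτ hy1 hy2
    have hη := K.hη
    have hτ : 0 < τ := by
      by_contra h; rw [not_lt] at h
      have := mul_nonpos_of_nonneg_of_nonpos (by linarith : 0 ≤ 1 + K.η) h
      linarith
    have hlm := K.hlm
    have hl : 0 < l := by linarith
    have hb1 := K.hb1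
    have hy0 : 0 < y := by
      have := mul_pos (by linarith [K.hrm] : 0 < K.rm) hτ; linarith
    have hφ := phi_pos (γ := K.γ) (γ2 := γ2) h0 hy0
    have hsb : 0 < √K.b := Real.sqrt_pos.2 (by linarith)
    have hsq : √K.b * √K.b = K.b := Real.mul_self_sqrt (by linarith)
    have hsb1 : 1 ≤ √K.b := by rw [Real.one_le_sqrt]; linarith
    by_cases hyL : Λ1 ≤ y
    · have hθ1 : √K.b / l ≤ 1 := by rw [div_le_one hl]; linarith
      have hθ0 : 0 < √K.b / l := by positivity
      have hxy : x ≤ √K.b / l * y := by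
        have a1 : K.η * Λ1 ≤ K.η * y := by gcongr
        have a2 : l * τ ≤ (1 + K.η) * y := by linarith
        rw [div_mul_eq_mul_div, le_div_iff₀ hl]
        calc x * l ≤ ((1 + K.η) * τ) * l := by gcongr
          _ = (1 + K.η) * (l * τ) := by ring
          _ ≤ (1 + K.η) * ((1 + K.η) * y) := by gcongr
          _ = (1 + K.η) ^ 2 * y := by ring
          _ ≤ _ := by gcongr
      have hbl : √K.b / l ≤ K.b / l := by
        gcongr; nlinarith
      have a3 : (√K.b / l) ^ K.γ ≤ K.b / l := by
        have : √K.b / l = (√K.b / l) ^ K.γ * (√K.b / l) ^ (1 - K.γ) := by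
          rw [← Real.rpow_add hθ0]; simp
        have b1 : 1 ≤ √K.b * (√K.b / l) ^ (1 - K.γ) := by
          rw [Real.div_rpow hsb.le hl.le, ← mul_div_assoc, one_le_div (by positivity)]
          calc l ^ (1 - K.γ) ≤ K.lM ^ (1 - K.γ) := by
                apply Real.rpow_le_rpow hl.le hl2; linarith
            _ ≤ √K.b := e3
            _ ≤ √K.b * √K.b ^ (1 - K.γ) := by
              apply le_mul_of_one_le_right hsb.le
              exact Real.one_le_rpow hsb1 (by linarith)
        calc (√K.b / l) ^ K.γ ≤ (√K.b / l) ^ K.γ * (√K.b * (√K.b / l) ^ (1 - K.γ)) :=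
              le_mul_of_one_le_right (by positivity) b1
          _ = √K.b * ((√K.b / l) ^ K.γ * (√K.b / l) ^ (1 - K.γ)) := by ring
          _ = √K.b * (√K.b / l) := by rw [← this]
          _ = K.b / l := by rw [← mul_div_assoc, hsq]
      have a4 : phi Λ1 K.γ γ2 x ≤ K.b / l * phi Λ1 K.γ γ2 y := by
        calc _ ≤ phi Λ1 K.γ γ2 (√K.b / l * y) := phi_mono h0 hγ0.le (by linarith) hx hxy
          _ ≤ _ := phi_scale h0 hgg hθ0 hθ1 hy0
          _ ≤ _ := by gcongr
      have a5 := mul_le_mul_of_nonneg_left a4 hT.le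
      have a6 : K.k * x ≤ K.k * (K.b / l * y) := by
        gcongr; exact hxy.trans (by gcongr)
      have := K.hA
      unfold Fg; linarith
    · rw [not_le] at hyL
      have hsr : 0 < √K.rm := Real.sqrt_pos.2 (by linarith [K.hrm])
      have hsrq : √K.rm * √K.rm = K.rm := Real.mul_self_sqrt (by linarith [K.hrm])
      have hsr1 : 1 ≤ √K.rm := by rw [Real.one_le_sqrt]; exact K.hrm
      have a1 : √K.rm * x ≤ y := by
        calc √K.rm * x ≤ √K.rm * ((1 + K.η) * τ) := by gcongr
          _ ≤ √K.rm * (√K.rm * τ) := by gcongr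
          _ = K.rm * τ := by rw [← mul_assoc, hsrq]
          _ ≤ y := hy2
      have hxy : x ≤ y := by nlinarith
      have a2 : phi Λ1 K.γ γ2 x ≤ K.b / l * phi Λ1 K.γ γ2 y := by
        rw [phi_small h0 hgg hx (by linarith), phi_small h0 hgg hy0 hyL.le]
        have b1 : (√K.rm) ^ γ2 * (x / Λ1) ^ γ2 ≤ (y / Λ1) ^ γ2 := by
          rw [← Real.mul_rpow hsr.le (by positivity), ← mul_div_assoc]
          gcongr
        have b2 : K.lM * (x / Λ1) ^ γ2 ≤ (y / Λ1) ^ γ2 := by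
          refine le_trans ?_ b1; gcongr
        have b3 : l * (x / Λ1) ^ γ2 ≤ K.b * (y / Λ1) ^ γ2 := by
          have : l * (x / Λ1) ^ γ2 ≤ K.lM * (x / Λ1) ^ γ2 := by gcongr
          have : (y / Λ1) ^ γ2 ≤ K.b * (y / Λ1) ^ γ2 := le_mul_of_one_le_left (by positivity) hb1.le
          linarith
        rw [div_mul_eq_mul_div, le_div_iff₀ hl]; linarith
      have a5 := mul_le_mul_of_nonneg_left a2 hT.le
      have a6 : K.k * x ≤ K.k * Λ1 := by gcongr; linarith
      have a7 : 0 ≤ K.k * (K.b / l * y) := by positivity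
      unfold Fg; rw [hA]; linarith

end W17

namespace W17

theorem exp_tend {a : ℝ} (ha : 0 < a) (L C : ℝ) :
    Tendsto (fun d => 3 * Real.exp (-(a * d)) * (L * d + C)) atTop (𝓝 0) := by
  have h1 : Tendsto (fun d : ℝ => a * d) atTop atTop := tendsto_id.const_mul_atTop ha
  have h2 := (Real.tendsto_pow_mul_exp_neg_atTop_nhds_zero 1).comp h1
  have h3 := (Real.tendsto_pow_mul_exp_neg_atTop_nhds_zero 0).comp h1
  have := (h2.const_mul (3 * L / a)).add (h3.const_mul (3 * C))
  simp only [mul_zero, add_zero] at this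
  refine this.congr (fun d => ?_)
  simp only [Function.comp, pow_one, pow_zero]
  field_simp

theorem exp_bd {a : ℝ} (ha : 0 < a) {L C y : ℝ} (hL : 0 ≤ L) (hC : 0 ≤ C) (hy : 0 ≤ y) :
    3 * Real.exp (-(a * y)) * (L * y + C) ≤ 3 * (L / a + C) := by
  have h1 : Real.exp (-(a * y)) ≤ 1 := Real.exp_le_one_iff.2 (by nlinarith)
  have h2 : Real.exp (-(a * y)) * y ≤ 1 / a := by
    rw [Real.exp_neg, inv_mul_le_iff₀ (Real.exp_pos _)]
    have := Real.add_one_le_exp (a * y)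
    have : y * a ≤ Real.exp (a * y) := by linarith
    calc y ≤ Real.exp (a * y) / a := by rwa [le_div_iff₀ ha]
      _ = _ := by ring
  calc _ = 3 * (L * (Real.exp (-(a * y)) * y) + Real.exp (-(a * y)) * C) := by ring
    _ ≤ 3 * (L * (1 / a) + 1 * C) := by gcongr
    _ = _ := by ring

structure KOut (ε : ℝ) (N : ℕ) (B LG k Λ1 γ γ2 ρ0 c0 M₀ : ℝ) (K : Kst) : Prop where
  e_lm : K.lm = 1 + ε
  e_lM : K.lM = 1 / ε
  e_rm : K.rm = 1 + ε
  e_C1 : K.C₁ = 2 * Real.log (1 / ε)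
  e_C2 : K.C₂ = 2 * Real.log (1 / ε) + Real.log 2
  e_B : K.B = B
  e_k : K.k = k
  e_LG : K.LG = LG
  e_ρ0 : K.ρ0 = ρ0
  e_c0 : K.c0 = c0
  e_M₀ : K.M₀ = M₀
  e_ε : K.ε = ε
  e_hww : B ^ (N + 1) * (1 + K.ε') ^ 2 ≤ 1 + ε
  e_F : ∀ T > 0, FP K (Fg k Λ1 γ γ2 T)

theorem exK {ε : ℝ} (hε : 0 < ε) (hε2 : ε ≤ 1 / 2) (N : ℕ) :
    ∃ B LG k Λ1 γ γ2 : ℝ, 1 < B ∧ 0 < k ∧ 0 < Λ1 ∧ 0 < γ ∧ γ < 1 ∧ 1 ≤ γ2 ∧ B ^ (N + 1) ≤ 1 + ε ∧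
      ∀ ρ0 c0, 0 < ρ0 → ρ0 < 1 → 0 < c0 → c0 ≤ 1 → ∃ M₁, ∀ M₀ ≥ M₁, ∃ K : Kst,
        KOut ε N B LG k Λ1 γ γ2 ρ0 c0 M₀ K := by
  have hlm : 1 < 1 + ε := by linarith
  have hlm0 : 0 < 1 + ε := by linarith
  have hlM2 : 2 ≤ 1 / ε := by rw [le_div_iff₀ hε]; linarith
  obtain ⟨B, hB⟩ : ∃ B, B = (1 + ε) ^ (1 / (2 * ((N:ℝ) + 1))) := ⟨_, rfl⟩
  have hB1 : 1 < B := by rw [hB]; exact Real.one_lt_rpow hlm (by positivity)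
  have hB0 : 0 < B := by linarith
  have hBN : B ^ (N + 1) = √(1 + ε) := by
    rw [hB, ← Real.rpow_natCast, ← Real.rpow_mul hlm0.le, Real.sqrt_eq_rpow]
    congr 1; push_cast; field_simp
  have hs1 : 1 < √(1 + ε) := by rw [Real.lt_sqrt] <;> linarith
  have hss : √(1 + ε) * √(1 + ε) = 1 + ε := Real.mul_self_sqrt hlm0.le
  obtain ⟨ε', hε'⟩ : ∃ e, e = √(√(1 + ε)) - 1 := ⟨_, rfl⟩
  have hε'0 : 0 < ε' := by
    have : 1 < √(√(1 + ε)) := by rw [Real.lt_sqrt] <;> linarith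
    linarith
  have hε'2 : (1 + ε') ^ 2 = √(1 + ε) := by
    rw [hε', add_sub_cancel, Real.sq_sqrt (by positivity)]
  have hBs : B ≤ √(1 + ε) := by
    rw [← hBN]; exact le_self_pow₀ hB1.le (by omega)
  obtain ⟨b, hb⟩ : ∃ e, e = √B := ⟨_, rfl⟩
  have hb1 : 1 < b := by rw [hb, Real.lt_sqrt] <;> linarith
  have hbb : b * b = B := by rw [hb]; exact Real.mul_self_sqrt hB0.le
  have hbB : b < B := by nlinarith
  have hsle : √(1 + ε) ≤ 1 + ε := by nlinarith
  obtain ⟨sb, hsb⟩ : ∃ e, e = √b := ⟨_, rfl⟩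
  have hsb1 : 1 < sb := by rw [hsb, Real.lt_sqrt] <;> linarith
  have hsbb : sb * sb = b := by rw [hsb]; exact Real.mul_self_sqrt (by linarith)
  have hsbb' : sb ≤ b := by nlinarith
  obtain ⟨η, hη⟩ : ∃ e, e = √sb - 1 := ⟨_, rfl⟩
  have hη0 : 0 < η := by
    have : 1 < √sb := by rw [Real.lt_sqrt] <;> linarith
    linarith
  have hη2 : (1 + η) ^ 2 = sb := by rw [hη, add_sub_cancel, Real.sq_sqrt (by linarith)]
  have hη3 : 1 + η ≤ sb := by nlinarith
  have hlM0 : 0 < 1 / ε := by linarith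
  have hlogM : 0 < Real.log (1 / ε) := Real.log_pos (by linarith)
  have hlogsb : 0 < Real.log sb := Real.log_pos hsb1
  obtain ⟨γ, hγ⟩ : ∃ e, e = 1 - min (1 / 2) (Real.log sb / Real.log (1 / ε)) := ⟨_, rfl⟩
  have hq : 0 < Real.log sb / Real.log (1 / ε) := by positivity
  have hγ1 : γ < 1 := by
    have : 0 < min (1 / 2) (Real.log sb / Real.log (1 / ε)) := lt_min (by norm_num) hq
    linarith
  have hγ0 : 0 < γ := by have := min_le_left (1 / 2) (Real.log sb / Real.log (1 / ε)); linarith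
  have hγ3 : (1 / ε) ^ (1 - γ) ≤ sb := by
    rw [Real.rpow_def_of_pos hlM0, ← Real.le_log_iff_exp_le (by linarith)]
    have := min_le_right (1 / 2) (Real.log sb / Real.log (1 / ε))
    rw [mul_comm, ← le_div_iff₀ hlogM]; linarith
  have hlogs : 0 < Real.log (√(1 + ε)) := Real.log_pos hs1
  obtain ⟨γ2, hγ2⟩ : ∃ e, e = max 1 (Real.log (1 / ε) / Real.log (√(1 + ε))) := ⟨_, rfl⟩
  have hγ21 : 1 ≤ γ2 := by rw [hγ2]; exact le_max_left _ _
  have hγ22 : 1 / ε ≤ √(1 + ε) ^ γ2 := by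
    rw [Real.rpow_def_of_pos (by linarith), ← Real.log_le_iff_le_exp hlM0, mul_comm, ← div_le_iff₀ hlogs,
      hγ2]
    exact le_max_right _ _
  have hlog2 : 0 < Real.log 2 := Real.log_pos (by norm_num)
  obtain ⟨C₁, hC1⟩ : ∃ e, e = 2 * Real.log (1 / ε) := ⟨_, rfl⟩
  obtain ⟨C₂, hC2⟩ : ∃ e, e = 2 * Real.log (1 / ε) + Real.log 2 := ⟨_, rfl⟩
  have hC10 : 0 ≤ C₁ := by linarith
  have hC20 : 0 ≤ C₂ := by linarith
  obtain ⟨Λ1, hΛ1⟩ : ∃ e, e = 1 + C₂ / η := ⟨_, rfl⟩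
  have hΛ11 : 1 ≤ Λ1 := by have : 0 ≤ C₂ / η := by positivity
                           linarith
  have hΛ12 : C₂ ≤ η * Λ1 := by rw [hΛ1]; field_simp; linarith
  obtain ⟨lM, hlM⟩ : ∃ e, e = 1 / ε := ⟨_, rfl⟩
  obtain ⟨c₁, hc1⟩ : ∃ e, e = (2 * lM + 3) / ε := ⟨_, rfl⟩
  have hc10 : 0 < c₁ := by rw [hc1, hlM]; positivity
  obtain ⟨k, hk⟩ : ∃ e, e = 4 * c₁ * (1 + 1 / ε') := ⟨_, rfl⟩
  have hk1 : 4 * c₁ ≤ k := by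
    rw [hk]; apply le_mul_of_one_le_right (by positivity)
    have : 0 < 1 / ε' := by positivity
    linarith
  have hk2 : 2 * c₁ * (1 + 1 / ε') ≤ k := by rw [hk]; gcongr; norm_num
  have hk0 : 0 < k := by linarith
  -- d₀
  have q1 : ∀ᶠ d : ℝ in atTop, 3 * Real.exp (-(γ / 2 * d)) * (0 * d + 1) < 1 :=
    (exp_tend (by positivity) 0 1).eventually_lt_const (by norm_num)
  have q2 : ∀ᶠ d : ℝ in atTop, 3 * Real.exp (-(γ / 2 * d)) * (2 * lM * d + C₁) < 1 :=
    (exp_tend (by positivity) (2 * lM) C₁).eventually_lt_const (by norm_num)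
  have q3 : ∀ᶠ d : ℝ in atTop, 3 * Real.exp (-(1 / 2 * d)) * (0 * d + 1) < min 1 η :=
    (exp_tend (by positivity) 0 1).eventually_lt_const (lt_min (by norm_num) hη0)
  obtain ⟨d₀, hd⟩ := eventually_atTop.1 (q1.and (q2.and (q3.and
    ((eventually_ge_atTop 2).and (eventually_ge_atTop (C₁ + k * C₂))))))
  obtain ⟨-, -, p3, p4, p5⟩ := hd d₀ le_rfl
  rw [lt_min_iff, zero_mul, zero_add, mul_one, show 1 / 2 * d₀ = d₀ / 2 by ring] at p3
  refine ⟨B, (2 * lM + 1) * d₀ + C₁ + 2, k, Λ1, γ, γ2, hB1, hk0, by linarith, hγ0, hγ1, hγ21,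
    by rw [hBN]; exact hsle, ?_⟩
  intro ρ0 c0 hρ0 hρ1 hc0 hc01
  -- t₀
  have hBb : 0 < B - b := by linarith
  have lin : ∀ a > 0, ∀ c : ℝ, ∀ᶠ t : ℝ in atTop, c ≤ a * t := fun a ha c =>
    (tendsto_id.const_mul_atTop ha).eventually_ge_atTop c
  obtain ⟨t₀, g1, g2, g3, g4, g5⟩ := ((lin (1 / 2) (by norm_num) (-Real.log ε)).and
    ((lin (ε' / (1 + ε')) (by positivity) 4).and ((lin (1 / (1 + ε')) (by positivity) (-Real.log ρ0)).and
    ((lin (B - b) hBb (2 * (-Real.log ρ0 + Real.log 4 - Real.log c0) + 2 * C₁ + k * Λ1)).and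
    (lin ε' hε'0 (Real.log 2 + -Real.log ρ0 + Real.log 4 + 2 * C₁ + k * Λ1)))))).exists
  refine ⟨max (max (2 * lM * t₀ + C₁) (2 * lM * (-Real.log ρ0 + d₀) + C₁ + 1))
    (3 * ((2 * lM * (1 + 1 / ε')) / (γ / 2) + C₁)), ?_⟩
  intro M₀ hM
  rw [ge_iff_le, max_le_iff, max_le_iff] at hM
  obtain ⟨⟨m1, m2⟩, m3⟩ := hM
  have hlM0' : 0 < lM := by rw [hlM]; exact hlM0
  let K : Kst :=
    { lm := 1 + ε, lM := lM, rm := 1 + ε, C₁ := C₁, C₂ := C₂, B := B, b := b, ε' := ε', η := η, γ := γ,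
      c₁ := c₁, k := k, A := k * Λ1, d₀ := d₀, LG := (2 * lM + 1) * d₀ + C₁ + 2, ρ0 := ρ0, c0 := c0,
      t₀ := t₀, M₀ := M₀, ε := ε
      hlm := hlm
      hlm2 := by linarith
      hlM := by rw [hlM]; linarith
      hε := hε
      hε2 := hε2
      hrm := hlm.le
      hC1 := hC10
      hC2 := hC20
      hb1 := hb1
      hbB := hbB
      hb2 := by linarith
      hε' := hε'0
      hη := hη0
      hγ0 := hγ0
      hγ1 := hγ1.le
      hc1 := hc10
      hc1' := by rw [hc1, add_sub_cancel_left, mul_div_cancel₀ _ hε.ne']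
      hk1 := hk1
      hk2 := hk2
      hA := by positivity
      hd2 := p4
      hd3 := p5
      hd4 := by linarith [p3.2, Real.exp_pos (-(d₀ / 2))]
      hd5 := p3.1.le
      hd6 := by
        intro d h
        have := (hd d h).1.le
        rw [zero_mul, zero_add, mul_one] at this
        rwa [show γ * d / 2 = γ / 2 * d by ring]
      hd7 := by
        intro d h
        have := (hd d h).2.1.le
        rwa [show γ * d / 2 = γ / 2 * d by ring]
      hLG := le_rfl
      hρ0 := hρ0
      hρ1 := hρ1
      hc0 := hc0
      hc01 := hc01
      ht1 := by linarith
      ht2 := by linarith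
      ht3 := by rw [div_eq_mul_one_div]; linarith
      ht4 := g4
      ht5 := g5
      hM1 := m1
      hM2 := m2
      hM3 := by
        intro y hy
        have := exp_bd (a := γ / 2) (by positivity) (L := 2 * lM * (1 + 1 / ε')) (by positivity) hC10 hy
        rw [show γ * y / 2 = γ / 2 * y by ring]
        linarith }
  refine ⟨K, rfl, hlM, rfl, hC1, hC2, rfl, rfl, rfl, rfl, rfl, rfl, rfl, ?_, ?_⟩
  · show B ^ (N + 1) * (1 + ε') ^ 2 ≤ 1 + ε
    rw [hBN, hε'2, hss]
  · intro T hT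
    apply Fg_FP K hT hΛ11 hγ21 rfl
    · show (1 + η) ^ 2 ≤ √b
      rw [hη2, hsb]
    · show √b ≤ 1 + ε
      rw [← hsb]; linarith
    · show lM ^ (1 - γ) ≤ √b
      rw [← hsb, hlM]; exact hγ3
    · exact hΛ12
    · show 1 + η ≤ √(1 + ε)
      linarith
    · show lM ≤ √(1 + ε) ^ γ2
      rw [hlM]; exact hγ22

end W17

namespace W17

variable {D : CritData}

/-- context: invariant set without periodic critical points -/
structure Ctx (D : CritData) (X : Set ℝ) : Prop where
  H : Hyp D
  II : D.CondII
  XI : X ⊆ unitI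
  fX : ∀ x ∈ X, D.f x ∈ X
  np : ∀ c ∈ D.C, c ∈ X → ∀ i, D.f^[i] (D.f c) ≠ c

open Classical in
/-- number of critical points in the forward orbit -/
def nn (D : CritData) (p : ℝ) : ℕ := (D.C.filter (fun c => ∃ i, D.f^[i] p = c)).card

theorem nn_le (p : ℝ) : nn D p ≤ D.C.card := by
  classical
  exact Finset.card_filter_le _ _

theorem nn_step {p : ℝ} (hp : p ∉ D.C) : nn D (D.f p) = nn D p := by
  classical
  unfold nn
  congr 1
  apply Finset.filter_congr
  intro c hc
  constructor
  · rintro ⟨i, h⟩; exact ⟨i + 1, h⟩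
  · rintro ⟨i, h⟩
    cases i with
    | zero => simp at h; subst h; exact absurd hc hp
    | succ i => exact ⟨i, h⟩

theorem Ctx.nn_crit {X : Set ℝ} (K : Ctx D X) {c : ℝ} (hc : c ∈ D.C) (hX : c ∈ X) :
    nn D c = nn D (D.f c) + 1 := by
  classical
  unfold nn
  rw [← Finset.card_insert_of_notMem (a := c) (s := D.C.filter (fun d => ∃ i, D.f^[i] (D.f c) = d))]
  · congr 1
    ext d
    simp only [Finset.mem_filter, Finset.mem_insert]
    constructor
    · rintro ⟨hd, i, h⟩
      cases i with
      | zero => left; simpa using h.symm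
      | succ i => right; exact ⟨hd, i, h⟩
    · rintro (rfl | ⟨hd, i, h⟩)
      · exact ⟨hc, 0, rfl⟩
      · exact ⟨hd, i + 1, h⟩
  · simp only [Finset.mem_filter, not_and]
    rintro - ⟨i, h⟩
    exact K.np c hc hX i h

def wt (D : CritData) (B p : ℝ) : ℝ := B ^ nn D p

/-- orbit derivative product -/
def pr (D : CritData) (q : ℝ) (i : ℕ) : ℝ := ∏ j ∈ Finset.range i, |deriv D.f (D.f^[j] q)|

theorem pr_succ (q : ℝ) (i : ℕ) : pr D q (i + 1) = pr D q i * |deriv D.f (D.f^[i] q)| :=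
  Finset.prod_range_succ _ _

theorem pr_add (q : ℝ) (i m : ℕ) : pr D q (i + m) = pr D q i * pr D (D.f^[i] q) m := by
  unfold pr
  rw [Finset.prod_range_add]
  congr 1
  apply Finset.prod_congr rfl
  intro j _
  rw [← Function.iterate_add_apply, add_comm j i]

theorem Hyp.iter (H : Hyp D) {q : ℝ} (hq : q ∈ unitI) (i : ℕ) : D.f^[i] q ∈ unitI :=
  H.maps.iterate i hq

theorem Hyp.pr_pos (H : Hyp D) {q : ℝ} (hq : q ∈ unitI) {i : ℕ} (h : ∀ j < i, D.f^[j] q ∉ D.C) :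
    0 < pr D q i := by
  unfold pr
  exact Finset.prod_pos fun j hj => abs_pos.2 (H.dne (H.iter hq j) (h j (Finset.mem_range.1 hj)))

theorem Hyp.pr_deriv (H : Hyp D) {q : ℝ} (hq : q ∈ unitI) {i : ℕ} (h : ∀ j < i, D.f^[j] q ∉ D.C) :
    DifferentiableAt ℝ (D.f^[i]) q ∧ |deriv (D.f^[i]) q| = pr D q i := by
  induction i with
  | zero => simp [pr]
  | succ i ih =>
    obtain ⟨h1, h2⟩ := ih (fun j hj => h j (by omega))
    have h3 := H.diff (H.iter hq i) (h i (by omega))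
    have h4 := h3.comp q h1.hasDerivAt
    rw [Function.iterate_succ']
    refine ⟨h4.differentiableAt, ?_⟩
    rw [h4.deriv, abs_mul, h2, pr_succ, mul_comm]

structure BarD (D : CritData) (X : Set ℝ) (p P c : ℝ) (i : ℕ) : Prop where
  hc : c ∈ D.C
  hX : c ∈ X
  hp : p = D.f^[i] (D.f c)
  av : ∀ j < i, D.f^[j] (D.f c) ∉ D.C
  hP : P = pr D (D.f c) i

def Bar (D : CritData) (X : Set ℝ) (p P : ℝ) : Prop := ∃ c i, BarD D X p P c i

theorem Bar.new {X : Set ℝ} {c : ℝ} (hc : c ∈ D.C) (hX : c ∈ X) : Bar D X (D.f c) 1 :=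
  ⟨c, 0, hc, hX, rfl, by simp, by simp [pr]⟩

theorem Bar.next {X : Set ℝ} {p P : ℝ} (h : Bar D X p P) (hp : p ∉ D.C) :
    Bar D X (D.f p) (P * |deriv D.f p|) := by
  obtain ⟨c, i, h⟩ := h
  refine ⟨c, i + 1, h.hc, h.hX, by rw [h.hp, ← Function.iterate_succ_apply' (f := D.f)], ?_, by rw [h.hP, h.hp, pr_succ]⟩
  intro j hj
  rcases Nat.lt_succ_iff_lt_or_eq.1 hj with h1 | rfl
  · exact h.av j h1
  · rw [← h.hp]; exact hp

theorem Ctx.iterX {X : Set ℝ} (K : Ctx D X) {x : ℝ} (hx : x ∈ X) (i : ℕ) : D.f^[i] x ∈ X := by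
  induction i with
  | zero => exact hx
  | succ i ih => rw [Function.iterate_succ_apply']; exact K.fX _ ih

theorem Ctx.barX {X : Set ℝ} (K : Ctx D X) {p P : ℝ} (h : Bar D X p P) : p ∈ X := by
  obtain ⟨c, i, h⟩ := h
  rw [h.hp]; exact K.iterX (K.fX _ h.hX) i

theorem unif {ι : Type} [DecidableEq ι] (S : Finset ι) (Q : ι → ℝ → Prop)
    (mono : ∀ c δ δ', 0 < δ' → δ' ≤ δ → Q c δ → Q c δ') (h : ∀ c ∈ S, ∃ δ > 0, Q c δ) :
    ∃ δ > 0, ∀ c ∈ S, Q c δ := by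
  induction S using Finset.induction_on with
  | empty => exact ⟨1, one_pos, by simp⟩
  | insert a s ha ih =>
    obtain ⟨δ, h0, h1⟩ := ih (fun c hc => h c (Finset.mem_insert_of_mem hc))
    obtain ⟨δ', h0', h1'⟩ := h a (Finset.mem_insert_self _ _)
    refine ⟨min δ δ', lt_min h0 h0', fun c hc => ?_⟩
    rcases Finset.mem_insert.1 hc with rfl | hc
    · exact mono _ _ _ (lt_min h0 h0') (min_le_right _ _) h1'
    · exact mono _ _ _ (lt_min h0 h0') (min_le_left _ _) (h1 c hc)

theorem Ctx.grow {X : Set ℝ} (K : Ctx D X) {c : ℝ} (hc : c ∈ D.C)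
    (hav : ∀ j, D.f^[j] (D.f c) ∉ D.C) : Tendsto (fun i => pr D (D.f c) i) atTop atTop := by
  have hcI := K.H.pc.1 hc
  have hfc : D.f c ∈ unitI := K.H.maps hcI
  obtain ⟨s, hs⟩ : ∃ s, D.fv s c = D.f c := by
    by_cases h : c ≤ 1 / 2
    · refine ⟨true, K.H.fv_eq hc (r₁ := 1 / 2) (by norm_num) ?_⟩
      simp only [sg, if_true]
      exact ⟨by linarith [hcI.1], by linarith⟩
    · refine ⟨false, K.H.fv_eq hc (r₁ := 1 / 2) (by norm_num) ?_⟩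
      simp only [sg]
      exact ⟨by norm_num; linarith, by norm_num; linarith [hcI.2]⟩
  have h1 := (K.II c hc s).tendsto_atTop_zero
  have hl : 1 < D.l s c := K.H.l_gt hc
  have e : ∀ n, |D.DfnFc s c n| = pr D (D.f c) n := by
    intro n; unfold CritData.DfnFc; rw [hs]; exact (K.H.pr_deriv hfc (fun j _ => hav j)).2
  simp only [e] at h1
  have hpos : ∀ n, 0 < pr D (D.f c) n := fun n => K.H.pr_pos hfc (fun j _ => hav j)
  have h2 : Tendsto (fun n => 1 / pr D (D.f c) (n + 1)) atTop (𝓝 0) := by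
    have := h1.rpow_const (p := D.l s c) (Or.inr (by linarith))
    rw [Real.zero_rpow (by linarith)] at this
    refine this.congr (fun n => ?_)
    rw [← Real.rpow_mul (by have := hpos (n+1); positivity), one_div_mul_cancel (by linarith), Real.rpow_one]
  rw [← tendsto_add_atTop_iff_nat 1]
  have h3 : Tendsto (fun n => 1 / pr D (D.f c) (n + 1)) atTop (𝓝[>] 0) :=
    tendsto_nhdsWithin_iff.2 ⟨h2, Eventually.of_forall fun n => by have := hpos (n+1); simp only [mem_Ioi]; positivity⟩
  have h4 := h3.inv_tendsto_nhdsGT_zero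
  refine h4.congr (fun n => ?_)
  simp

theorem Ctx.exc0 {X : Set ℝ} (K : Ctx D X) : ∃ c0 : ℝ, 0 < c0 ∧ c0 ≤ 1 ∧ ∀ p P, Bar D X p P → c0 ≤ P := by
  classical
  have h : ∃ δ > 0, ∀ c ∈ D.C, ∀ p P i, BarD D X p P c i → δ ≤ P := by
    apply unif D.C (fun c δ => ∀ p P i, BarD D X p P c i → δ ≤ P)
    · intro c δ δ' _ hle h p P i hb; exact hle.trans (h p P i hb)
    · intro c hc
      have hfc : D.f c ∈ unitI := K.H.maps (K.H.pc.1 hc)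
      have fin : ∀ N : ℕ, ∃ δ > 0, ∀ i ∈ Finset.range N, ∀ p P, BarD D X p P c i → δ ≤ P := by
        intro N
        apply unif (Finset.range N) (fun i δ => ∀ p P, BarD D X p P c i → δ ≤ P)
        · intro c δ δ' _ hle h p P hb; exact hle.trans (h p P hb)
        · intro i _
          by_cases hav : ∀ j < i, D.f^[j] (D.f c) ∉ D.C
          · exact ⟨_, K.H.pr_pos hfc hav, fun p P hb => hb.hP.ge⟩
          · exact ⟨1, one_pos, fun p P hb => absurd hb.av hav⟩
      by_cases hav : ∀ j, D.f^[j] (D.f c) ∉ D.C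
      · obtain ⟨N, hN⟩ := eventually_atTop.1 ((K.grow hc hav).eventually_ge_atTop 1)
        obtain ⟨δ, h0, h1⟩ := fin N
        refine ⟨min δ 1, lt_min h0 one_pos, fun p P i hb => ?_⟩
        by_cases hi : i < N
        · exact (min_le_left _ _).trans (h1 i (Finset.mem_range.2 hi) p P hb)
        · rw [hb.hP]; exact (min_le_right _ _).trans (hN i (by omega))
      · push Not at hav
        obtain ⟨j, hj⟩ := hav
        obtain ⟨δ, h0, h1⟩ := fin (j + 1)
        refine ⟨δ, h0, fun p P i hb => h1 i ?_ p P hb⟩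
        rw [Finset.mem_range]
        by_contra hi
        exact hb.av j (by omega) hj
  obtain ⟨δ, h0, h1⟩ := h
  refine ⟨min δ 1, lt_min h0 one_pos, min_le_right _ _, ?_⟩
  rintro p P ⟨c, i, hb⟩
  exact (min_le_left _ _).trans (h1 c hb.hc p P i hb)

end W17

namespace W17

variable {D : CritData}

theorem Hyp.derBd (H : Hyp D) {z : ℝ} (hz : z ∈ unitI) (hC : z ∉ D.C) :
    ∃ M > 0, ∀ᶠ q in 𝓝[unitI] z, |deriv D.f q| ≤ M := by
  have hopen : IsOpen ((D.C : Set ℝ)ᶜ) := D.C.finite_toSet.isClosed.isOpen_compl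
  have hu : UniqueDiffOn ℝ (unitI \ (D.C : Set ℝ)) := (uniqueDiffOn_Icc (by norm_num)).inter hopen
  have h1 : ContinuousOn (derivWithin D.f (unitI \ (D.C : Set ℝ))) (unitI \ (D.C : Set ℝ)) :=
    H.pc.2.2.1.continuousOn_derivWithin hu (by norm_num)
  have h2 : ContinuousOn (deriv D.f) (unitI \ (D.C : Set ℝ)) := by
    refine h1.congr (fun x hx => ?_)
    have hx2 : x ∉ D.C := by simpa using hx.2
    rw [(H.diff hx.1 hx2).hasDerivWithinAt.derivWithin (hu x hx)]
  have hz' : z ∈ unitI \ (D.C : Set ℝ) := ⟨hz, by simpa using hC⟩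
  have h3 : 𝓝[unitI \ (D.C : Set ℝ)] z = 𝓝[unitI] z := by
    rw [Set.sdiff_eq, inter_comm, nhdsWithin_inter_of_mem (mem_nhdsWithin_of_mem_nhds (hopen.mem_nhds hz'.2))]
  have h4 := (h2 z hz').abs
  rw [ContinuousWithinAt, h3] at h4
  exact ⟨|deriv D.f z| + 1, by positivity, h4.eventually_le_const (by linarith)⟩

theorem Hyp.iterCont (H : Hyp D) (k : ℕ) : ContinuousOn (D.f^[k]) unitI := by
  induction k with
  | zero => exact continuousOn_id
  | succ k ih => rw [Function.iterate_succ']; exact H.cont.comp ih (H.maps.iterate k)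

theorem Hyp.tendsIter (H : Hyp D) {y : ℝ} (hy : y ∈ unitI) (k : ℕ) :
    Tendsto (D.f^[k]) (𝓝[unitI] y) (𝓝[unitI] (D.f^[k] y)) :=
  tendsto_nhdsWithin_iff.2 ⟨H.iterCont k y hy, by
    filter_upwards [self_mem_nhdsWithin] with x hx using H.iter hx k⟩

theorem Hyp.near (H : Hyp D) {y : ℝ} (hy : y ∈ unitI) {k : ℕ} (hav : ∀ j < k, D.f^[j] y ∉ D.C) :
    ∃ L > 0, ∀ᶠ q in 𝓝[unitI] y, |D.f^[k] q - D.f^[k] y| ≤ L * |q - y| ∧ pr D q k ≤ L := by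
  induction k with
  | zero => exact ⟨1, one_pos, by simp [pr]⟩
  | succ k ih =>
    obtain ⟨L, hL, h⟩ := ih (fun j hj => hav j (by omega))
    have hz := H.iter hy k
    have hzC := hav k (by omega)
    obtain ⟨M, hM, hd⟩ := H.derBd hz hzC
    obtain ⟨M', hM', hb⟩ := (H.diff hz hzC).isBigO_sub.exists_pos
    rw [Asymptotics.isBigOWith_iff] at hb
    have ht := H.tendsIter hy k
    refine ⟨max (L * M) (M' * L), lt_max_of_lt_left (by positivity), ?_⟩
    filter_upwards [h, ht.eventually hd, ht.eventually (nhdsWithin_le_nhds hb)] with q h1 h2 h3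
    rw [Real.norm_eq_abs, Real.norm_eq_abs] at h3
    constructor
    · rw [Function.iterate_succ_apply', Function.iterate_succ_apply']
      calc _ ≤ _ := h3
        _ ≤ M' * (L * |q - y|) := by gcongr; exact h1.1
        _ = (M' * L) * |q - y| := by ring
        _ ≤ _ := by gcongr; exact le_max_right _ _
    · rw [pr_succ]
      refine le_trans ?_ (le_max_left _ _)
      exact mul_le_mul h1.2 h2 (abs_nonneg _) hL.le

theorem Hyp.pass (H : Hyp D) {ε : ℝ} (Lc : Loc D ε) {B : ℝ} (hB : 1 ≤ B) (hBN : B ^ D.C.card ≤ 1 + ε)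
    {c : ℝ} (hc : c ∈ D.C) :
    ∃ K > 0, ∃ m, ∀ᶠ p in 𝓝[unitI] c, p ≠ c → (∀ j < m, D.f^[j] p ∉ D.C) →
      pr D p m ≤ K * |p - c| ^ (wt D B (D.f c) * lo D c p - 1) := by
  have hcI := H.pc.1 hc
  have hfc := H.maps hcI
  have hε := Lc.pos
  have nearε : ∀ δ > 0, ∀ y : ℝ, ∀ᶠ p in 𝓝[unitI] y, |p - y| ≤ δ := by
    intro δ hδ y
    apply nhdsWithin_le_nhds
    filter_upwards [Metric.ball_mem_nhds y hδ] with x hx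
    rw [Metric.mem_ball, Real.dist_eq] at hx; exact hx.le
  by_cases hav : ∀ j, D.f^[j] (D.f c) ∉ D.C
  · have hw : wt D B (D.f c) = 1 := by
      classical
      unfold wt nn
      rw [Finset.filter_false_of_mem]
      · simp
      · rintro d hd ⟨i, h⟩; exact hav i (h ▸ hd)
    refine ⟨1 / ε, by positivity, 1, ?_⟩
    filter_upwards [nearε ε hε c, self_mem_nhdsWithin] with p h1 h2 h3 _
    have := Lc.der c hc p h2 h3 h1
    rw [hw, one_mul, one_div_mul_eq_div, le_div_iff₀ hε]
    simp only [pr, Finset.range_one, Finset.prod_singleton, Function.iterate_zero, id]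
    linarith
  · push Not at hav
    classical
    obtain ⟨k, hk, hmin⟩ : ∃ k, D.f^[k] (D.f c) ∈ D.C ∧ ∀ j < k, D.f^[j] (D.f c) ∉ D.C :=
      ⟨Nat.find hav, Nat.find_spec hav, fun j hj => Nat.find_min hav hj⟩
    obtain ⟨L, hL, hnear⟩ := H.near hfc hmin
    set c1 := D.f^[k] (D.f c) with hc1
    have ht1 : Tendsto D.f (𝓝[unitI] c) (𝓝[unitI] (D.f c)) := H.tendsIter hcI 1
    have ht2 : Tendsto (D.f^[k+1]) (𝓝[unitI] c) (𝓝[unitI] c1) := H.tendsIter hcI (k+1)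
    refine ⟨1 / ε * L * (1 / ε * (L / ε) ^ ε), by positivity, k + 2, ?_⟩
    have hsmall : ∀ᶠ x in 𝓝[unitI] c1, |x - c1| ≤ ε := nearε ε hε c1
    filter_upwards [nearε ε hε c, self_mem_nhdsWithin, ht1.eventually hnear, ht2.eventually hsmall]
      with p h1 h2 h3 h4 h5 h6
    have hρ : 0 < |p - c| := abs_pos.2 (sub_ne_zero.2 h5)
    have hε2 := Lc.half
    have hρ1 : |p - c| ≤ 1 := by linarith
    set ρ := |p - c| with hρd
    set l := lo D c p with hl
    have hl1 : 1 + ε ≤ l := Lc.l1 c hc p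
    have a1 := Lc.der c hc p h2 h5 h1
    have a2 := Lc.ub c hc p h2 h5 h1
    set q := D.f^[k+1] p with hq
    have hqI : q ∈ unitI := H.iter h2 _
    have hqC : q ∉ D.C := h6 (k+1) (by omega)
    have hqne : q ≠ c1 := fun h => hqC (h ▸ hk)
    have a3 := Lc.der c1 hk q hqI hqne h4
    have a4 : |q - c1| ≤ L / ε * ρ ^ l := by
      have : |q - c1| ≤ L * |D.f p - D.f c| := h3.1
      refine this.trans ?_
      rw [div_mul_eq_mul_div, le_div_iff₀ hε]
      calc _ = L * (ε * |D.f p - D.f c|) := by ring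
        _ ≤ _ := by gcongr
    have a5 : |q - c1| ^ (lo D c1 q - 1) ≤ (L / ε) ^ ε * ρ ^ (l * ε) := by
      have b1 : 0 < |q - c1| := abs_pos.2 (sub_ne_zero.2 hqne)
      calc _ ≤ |q - c1| ^ ε := by
            apply Real.rpow_le_rpow_of_exponent_ge b1 (by linarith)
            have := Lc.l1 c1 hk q; linarith
        _ ≤ (L / ε * ρ ^ l) ^ ε := by gcongr
        _ = _ := by rw [Real.mul_rpow (by positivity) (by positivity), ← Real.rpow_mul hρ.le]
    have a6 : |deriv D.f q| ≤ 1 / ε * (L / ε) ^ ε * ρ ^ (l * ε) := by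
      rw [mul_assoc, one_div_mul_eq_div, le_div_iff₀ hε]; linarith
    have a7 : |deriv D.f p| ≤ 1 / ε * ρ ^ (l - 1) := by
      rw [one_div_mul_eq_div, le_div_iff₀ hε]; linarith
    have e1 : pr D p (k + 2) = |deriv D.f p| * pr D (D.f p) k * |deriv D.f q| := by
      rw [show k + 2 = (k + 1) + 1 by ring, pr_succ, add_comm k 1, pr_add]
      simp [pr, hq, add_comm]
    have hw : wt D B (D.f c) ≤ 1 + ε := by
      unfold wt
      exact (pow_le_pow_right₀ hB (nn_le _)).trans hBN
    have hp0 : 0 ≤ pr D (D.f p) k := Finset.prod_nonneg fun _ _ => abs_nonneg _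
    rw [e1]
    calc _ ≤ (1 / ε * ρ ^ (l - 1)) * L * (1 / ε * (L / ε) ^ ε * ρ ^ (l * ε)) := by
          gcongr; exact h3.2
      _ = (1 / ε * L * (1 / ε * (L / ε) ^ ε)) * (ρ ^ (l - 1) * ρ ^ (l * ε)) := by ring
      _ = (1 / ε * L * (1 / ε * (L / ε) ^ ε)) * ρ ^ ((1 + ε) * l - 1) := by
          rw [← Real.rpow_add hρ]; congr 2; ring
      _ ≤ _ := by
          gcongr ?_ * ?_
          apply Real.rpow_le_rpow_of_exponent_ge hρ hρ1
          have : wt D B (D.f c) * l ≤ (1 + ε) * l := by gcongr; linarith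
          linarith

theorem Ctx.B4 {X : Set ℝ} (K : Ctx D X) {ε : ℝ} (Lc : Loc D ε) {B : ℝ} (hB : 1 ≤ B)
    (hBN : B ^ D.C.card ≤ 1 + ε) (G : ℝ) :
    ∃ ρ0 > 0, ∀ p P, Bar D X p P → ∀ c ∈ D.C, p ≠ c → |p - c| ≤ ρ0 →
      G ≤ Real.log P + (wt D B (D.f c) * lo D c p - 1) * Real.log |p - c| := by
  classical
  have key : ∃ ρ0 > 0, ∀ cc ∈ D.C ×ˢ D.C, ∀ p P i, BarD D X p P cc.1 i → p ≠ cc.2 → |p - cc.2| ≤ ρ0 →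
      G ≤ Real.log P + (wt D B (D.f cc.2) * lo D cc.2 p - 1) * Real.log |p - cc.2| := by
    apply unif (D.C ×ˢ D.C) (fun cc ρ0 => ∀ p P i, BarD D X p P cc.1 i → p ≠ cc.2 → |p - cc.2| ≤ ρ0 →
      G ≤ Real.log P + (wt D B (D.f cc.2) * lo D cc.2 p - 1) * Real.log |p - cc.2|)
    · intro cc δ δ' _ hle h p P i hb hne hd; exact h p P i hb hne (hd.trans hle)
    rintro ⟨cb, c⟩ hcc
    obtain ⟨hcb, hc⟩ := Finset.mem_product.1 hcc
    simp only at hcb hc ⊢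
    have hfcb : D.f cb ∈ unitI := K.H.maps (K.H.pc.1 hcb)
    have fin : ∀ N : ℕ, ∃ δ > 0, ∀ i ∈ Finset.range N, ∀ p P, BarD D X p P cb i → p ≠ c → ¬ |p - c| ≤ δ := by
      intro N
      apply unif (Finset.range N) (fun i δ => ∀ p P, BarD D X p P cb i → p ≠ c → ¬ |p - c| ≤ δ)
      · intro c δ δ' _ hle h p P hb hne hd; exact h p P hb hne (hd.trans hle)
      · intro i _
        by_cases he : D.f^[i] (D.f cb) = c
        · exact ⟨1, one_pos, fun p P hb hne => absurd (hb.hp.trans he) hne⟩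
        · have h0 := abs_pos.2 (sub_ne_zero.2 he)
          refine ⟨|D.f^[i] (D.f cb) - c| / 2, by positivity, fun p P hb hne => ?_⟩
          rw [hb.hp]; linarith
    by_cases hav : ∀ j, D.f^[j] (D.f cb) ∉ D.C
    · obtain ⟨Kc, hK, m, hm⟩ := K.H.pass Lc hB hBN hc
      obtain ⟨δ1, hδ1, hball⟩ := Metric.mem_nhdsWithin_iff.1 hm
      obtain ⟨N, hN⟩ := eventually_atTop.1 ((K.grow hcb hav).eventually_ge_atTop (Kc * Real.exp G))
      obtain ⟨δ, h0, h1⟩ := fin N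
      refine ⟨min δ (δ1 / 2), lt_min h0 (by positivity), fun p P i hb hne hd => ?_⟩
      by_cases hi : i < N
      · exact absurd (hd.trans (min_le_left _ _)) (h1 i (Finset.mem_range.2 hi) p P hb hne)
      have hpI : p ∈ unitI := by rw [hb.hp]; exact K.H.iter hfcb i
      have hρ : 0 < |p - c| := abs_pos.2 (sub_ne_zero.2 hne)
      have h2 : pr D p m ≤ Kc * |p - c| ^ (wt D B (D.f c) * lo D c p - 1) := by
        have : p ∈ Metric.ball c δ1 ∩ unitI := by
          refine ⟨?_, hpI⟩
          rw [Metric.mem_ball, Real.dist_eq]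
          have := hd.trans (min_le_right _ _); linarith
        refine hball this hne (fun j _ => ?_)
        rw [hb.hp, ← Function.iterate_add_apply]; exact hav _
      have h3 : Kc * Real.exp G ≤ pr D (D.f cb) (i + m) := hN _ (by omega)
      rw [pr_add, ← hb.hp, ← hb.hP] at h3
      have hP0 : 0 < P := by rw [hb.hP]; exact K.H.pr_pos hfcb hb.av
      have h4 : Real.exp G ≤ P * |p - c| ^ (wt D B (D.f c) * lo D c p - 1) := by
        have := mul_le_mul_of_nonneg_left h2 hP0.le
        have h5 : Kc * Real.exp G ≤ Kc * (P * |p - c| ^ (wt D B (D.f c) * lo D c p - 1)) := by linarith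
        exact le_of_mul_le_mul_left h5 hK
      have h6 := (Real.le_log_iff_exp_le (by positivity)).2 h4
      rwa [Real.log_mul hP0.ne' (by positivity), Real.log_rpow hρ] at h6
    · push Not at hav
      obtain ⟨j, hj⟩ := hav
      obtain ⟨δ, h0, h1⟩ := fin (j + 1)
      refine ⟨δ, h0, fun p P i hb hne hd => absurd hd (h1 i ?_ p P hb hne)⟩
      rw [Finset.mem_range]
      by_contra hi
      exact hb.av j (by omega) hj
  obtain ⟨ρ0, h0, h1⟩ := key
  refine ⟨ρ0, h0, ?_⟩
  rintro p P ⟨cb, i, hb⟩ c hc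
  exact h1 (cb, c) (Finset.mem_product.2 ⟨hb.hc, hc⟩) p P i hb

end W17

namespace W17

variable {D : CritData}

structure Std (D : CritData) (X : Set ℝ) (K : Kst) : Prop where
  cx : Ctx D X
  lc : Loc D K.ε
  lm : K.lm = 1 + K.ε
  lM : K.lM = 1 / K.ε
  rm : K.rm = 1 + K.ε
  C1 : K.C₁ = 2 * Real.log (1 / K.ε)
  C2 : K.C₂ = 2 * Real.log (1 / K.ε) + Real.log 2
  hww : K.B ^ (D.C.card + 1) * (1 + K.ε') ^ 2 ≤ K.lm
  c0 : ∀ p P, Bar D X p P → K.c0 ≤ P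
  b4 : ∀ p P, Bar D X p P → ∀ c ∈ D.C, p ≠ c → |p - c| ≤ K.ρ0 →
      K.LG ≤ Real.log P + (wt D K.B (D.f c) * lo D c p - 1) * Real.log |p - c|
  LG0 : 0 ≤ K.LG
  ρε : K.ρ0 ≤ K.ε

theorem dist_facts {e₁ e₂ c u v b : ℝ} (h : Ch c u v b) (h1 : e₁ = c ∨ Bt e₁ c u) (h2 : b = e₂ ∨ Bt v b e₂) :
    0 < |u - c| ∧ |u - c| < |v - c| ∧ |v - c| < |b - c| ∧ |v - e₁| = |v - c| + |e₁ - c| ∧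
    |u - e₂| = |b - c| - |u - c| + |e₂ - b| ∧ |u - e₁| = |u - c| + |e₁ - c| ∧
    |v - e₂| = |b - c| - |v - c| + |e₂ - b| ∧ |e₁ - e₂| = |e₁ - c| + |b - c| + |e₂ - b| ∧
    |u - b| = |b - c| - |u - c| ∧ |v - b| = |b - c| - |v - c| := by
  rcases h with ⟨a1, a2, a3⟩ | ⟨a1, a2, a3⟩
  · have b1 : e₁ ≤ c := by
      rcases h1 with h | h | h
      · linarith
      · linarith
      · linarith
    have b2 : b ≤ e₂ := by
      rcases h2 with h | h | h
      · linarith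
      · linarith
      · linarith
    rw [abs_of_pos (show 0 < u - c by linarith), abs_of_pos (show 0 < v - c by linarith),
      abs_of_pos (show 0 < b - c by linarith), abs_of_pos (show 0 < v - e₁ by linarith),
      abs_of_neg (show u - e₂ < 0 by linarith), abs_of_pos (show 0 < u - e₁ by linarith),
      abs_of_neg (show v - e₂ < 0 by linarith), abs_of_neg (show e₁ - e₂ < 0 by linarith),
      abs_of_neg (show u - b < 0 by linarith), abs_of_neg (show v - b < 0 by linarith),
      abs_of_nonpos (show e₁ - c ≤ 0 by linarith), abs_of_nonneg (show 0 ≤ e₂ - b by linarith)]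
    refine ⟨?_, ?_, ?_, ?_, ?_, ?_, ?_, ?_, ?_, ?_⟩ <;> linarith
  · have b1 : c ≤ e₁ := by
      rcases h1 with h | h | h
      · linarith
      · linarith
      · linarith
    have b2 : e₂ ≤ b := by
      rcases h2 with h | h | h
      · linarith
      · linarith
      · linarith
    rw [abs_of_neg (show u - c < 0 by linarith), abs_of_neg (show v - c < 0 by linarith),
      abs_of_neg (show b - c < 0 by linarith), abs_of_neg (show v - e₁ < 0 by linarith),
      abs_of_pos (show 0 < u - e₂ by linarith), abs_of_neg (show u - e₁ < 0 by linarith),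
      abs_of_pos (show 0 < v - e₂ by linarith), abs_of_pos (show 0 < e₁ - e₂ by linarith),
      abs_of_pos (show 0 < u - b by linarith), abs_of_pos (show 0 < v - b by linarith),
      abs_of_nonneg (show 0 ≤ e₁ - c by linarith), abs_of_nonpos (show e₂ - b ≤ 0 by linarith)]
    refine ⟨?_, ?_, ?_, ?_, ?_, ?_, ?_, ?_, ?_, ?_⟩ <;> linarith

theorem Ch.facts {c u v b : ℝ} (h : Ch c u v b) :
    0 < |u - c| ∧ |u - c| < |v - c| ∧ |v - c| < |c - b| ∧ |u - b| < |c - b| ∧ |v - b| < |u - b| ∧ 0 < |v - b| := by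
  have := dist_facts (e₁ := c) (e₂ := b) h (Or.inl rfl) (Or.inl rfl)
  obtain ⟨h1, h2, h3, -, -, -, -, -, h4, h5⟩ := this
  rw [abs_sub_comm c b, h4, h5]
  refine ⟨h1, h2, h3, by linarith, by linarith, by linarith⟩

theorem Ch.side {c u v b : ℝ} (h : Ch c u v b) : (c < u ↔ c < v) ∧ (c < u ↔ c < b) := by
  rcases h with ⟨a1, a2, a3⟩ | ⟨a1, a2, a3⟩
  · exact ⟨iff_of_true a1 (by linarith), iff_of_true a1 (by linarith)⟩
  · exact ⟨iff_of_false (by linarith) (by linarith), iff_of_false (by linarith) (by linarith)⟩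

theorem Ch.log_cr {c u v b : ℝ} (h : Ch c u v b) :
    Real.log (cr c u v b) = Real.log (|v - c| / |u - c|) + Real.log (|u - b| / |v - b|) := by
  obtain ⟨h1, h2, h3, h4, h5, h6⟩ := h.facts
  have q1 : 0 < |v - c| := h1.trans h2
  have q2 : 0 < |u - b| := h6.trans h5
  unfold cr
  rw [← Real.log_mul (by positivity) (by positivity)]
  congr 1; field_simp

theorem Ch.cr_pos {c u v b : ℝ} (h : Ch c u v b) : 0 < cr c u v b := by
  obtain ⟨h1, h2, h3, h4, h5, h6⟩ := h.facts
  have q1 : 0 < |v - c| := h1.trans h2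
  have q2 : 0 < |u - b| := h6.trans h5
  unfold cr; positivity

theorem Ch.left_le {c u v b : ℝ} (h : Ch c u v b) :
    Real.log (|v - c| / |u - c|) ≤ Real.log (cr c u v b) := by
  rw [h.log_cr]
  obtain ⟨h1, h2, h3, h4, h5, h6⟩ := h.facts
  have : 0 ≤ Real.log (|u - b| / |v - b|) := Real.log_nonneg (by rw [one_le_div h6]; exact h5.le)
  linarith

theorem cr_comm (a u v b : ℝ) : cr b v u a = cr a u v b := by
  unfold cr; rw [mul_comm |u - b|, mul_comm |v - b|]

theorem lo_congr {c x y : ℝ} (h : c < x ↔ c < y) : lo D c x = lo D c y := by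
  unfold lo; rw [decide_eq_decide.2 h]

theorem Ch.cr_add {c u z v b : ℝ} (h1 : Ch c u z b) (h2 : Ch c z v b) (h3 : Ch c u v b) :
    Real.log (cr c u v b) = Real.log (cr c u z b) + Real.log (cr c z v b) := by
  obtain ⟨a1, a2, a3, a4, a5, a6⟩ := h1.facts
  obtain ⟨b1, b2, b3, b4, b5, b6⟩ := h2.facts
  rw [h1.log_cr, h2.log_cr, h3.log_cr]
  rw [Real.log_div, Real.log_div, Real.log_div, Real.log_div, Real.log_div, Real.log_div]
  · ring
  all_goals first | exact ne_of_gt (by assumption) | linarith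

/-- distortion near a critical endpoint -/
theorem Loc.gz (H : Hyp D) {ε : ℝ} (L : Loc D ε) {c u z : ℝ} (hc : c ∈ D.C) (hu : u ∈ unitI)
    (hz : z ∈ unitI) (hs : c < u ↔ c < z) (h0 : 0 < |u - c|) (h1 : |u - c| < |z - c|) (hzε : |z - c| ≤ ε) :
    lo D c u * Real.log (|z - c| / |u - c|) - 2 * Real.log (1 / ε) ≤
      Real.log (|D.f z - D.f c| / |D.f u - D.f c|) ∧
    (1 + ε) * Real.log (|z - c| / |u - c|) ≤ Real.log (|D.f z - D.f c| / |D.f u - D.f c|) := by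
  have hε := L.pos
  have huc : u ≠ c := fun h => by rw [h] at h0; simp at h0
  have hzc : z ≠ c := fun h => by rw [h] at h1; simp at h1; linarith [abs_nonneg (u - c)]
  have h0z : 0 < |z - c| := h0.trans h1
  refine ⟨?_, L.rm c hc u hu z hz huc hs h1.le hzε⟩
  have a1 := L.lb c hc z hz hzc hzε
  have a2 := L.ub c hc u hu huc (h1.le.trans hzε)
  rw [← lo_congr hs] at a1
  have hlb := L.lb c hc u hu huc (h1.le.trans hzε)
  have p1 : 0 < |D.f u - D.f c| := lt_of_lt_of_le (by positivity) hlb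
  have p2 : 0 < |D.f z - D.f c| := lt_of_lt_of_le (by positivity) a1
  have b1 := Real.log_le_log (by positivity) a1
  have b2 := Real.log_le_log (by positivity) a2
  rw [Real.log_mul hε.ne' (by positivity), Real.log_rpow h0z] at b1
  rw [Real.log_mul hε.ne' (by positivity), Real.log_rpow h0] at b2
  rw [Real.log_div h0z.ne' h0.ne', Real.log_div p2.ne' p1.ne', one_div, Real.log_inv]
  linarith

theorem ex_z {c u v b rz : ℝ} (h : Ch c u v b) (h1 : |u - c| < rz) (h2 : rz < |v - c|) :
    ∃ z, |z - c| = rz ∧ Ch c u z b ∧ Ch c z v b := by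
  rcases h with ⟨a1, a2, a3⟩ | ⟨a1, a2, a3⟩
  · rw [abs_of_pos (by linarith)] at h1 h2
    refine ⟨c + rz, by rw [add_sub_cancel_left, abs_of_pos (by linarith)], Or.inl ⟨?_, ?_, ?_⟩, Or.inl ⟨?_, ?_, ?_⟩⟩ <;> linarith
  · rw [abs_of_neg (by linarith)] at h1 h2
    refine ⟨c - rz, by rw [sub_sub_cancel_left, abs_neg, abs_of_pos (by linarith)], Or.inr ⟨?_, ?_, ?_⟩, Or.inr ⟨?_, ?_, ?_⟩⟩ <;> linarith

theorem Ch.memI {a u v b : ℝ} (h : Ch a u v b) (ha : a ∈ unitI) (hb : b ∈ unitI) : u ∈ unitI ∧ v ∈ unitI := by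
  obtain ⟨p1, p2⟩ := ha
  obtain ⟨q1, q2⟩ := hb
  rcases h with ⟨a1, a2, a3⟩ | ⟨a1, a2, a3⟩ <;>
    exact ⟨⟨by linarith, by linarith⟩, ⟨by linarith, by linarith⟩⟩

theorem Std.stepC {X : Set ℝ} {K : Kst} (S : Std D X K) {F : ℝ → ℝ} (hF : FP K F)
    {e₁ e₂ c b u v P Q : ℝ} (hP : Bar D X e₁ P) (hQ : Bar D X e₂ Q) (hb : b ∈ X)
    (hc : c ∈ D.C) (hcX : c ∈ X) (h1 : e₁ = c ∨ Bt e₁ c u) (h2 : b = e₂ ∨ (b ∈ D.C ∧ Bt v b e₂))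
    (hch : Ch c u v b) (hnC : ∀ d ∈ D.C, ¬ Bt c d b)
    (hFM : F (Real.log (cr (D.f c) (D.f u) (D.f v) (D.f b))) ≤
      wt D K.B (D.f c) * Real.log (1 * |D.f u - D.f b| / (|D.f u - D.f c| * |D.f c - D.f b|))) :
    F (Real.log (cr e₁ u v e₂)) ≤ max (max
      (wt D K.B e₁ * Real.log (P * |u - e₂| / (|u - e₁| * |e₁ - e₂|)))
      (wt D K.B e₂ * Real.log (Q * |v - e₁| / (|v - e₂| * |e₁ - e₂|)))) K.M₀ := by
  have H := S.cx.H
  have L := S.lc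
  have hε := K.hε
  have hcI := S.cx.XI hcX
  have hbI := S.cx.XI hb
  have he1I := S.cx.XI (S.cx.barX hP)
  have he2I := S.cx.XI (S.cx.barX hQ)
  obtain ⟨huI, hvI⟩ := hch.memI hcI hbI
  obtain ⟨hch', hcr'⟩ := H.ch hcI hbI hnC hch
  have h2' : b = e₂ ∨ Bt v b e₂ := h2.imp id And.right
  obtain ⟨d1, d2, d3, d4, d5, d6, d7, d8, d9, d10⟩ := dist_facts hch h1 h2'
  obtain ⟨f1, f2, f3, f4, f5, f6⟩ := hch'.facts
  obtain ⟨s1, s2⟩ := hch.side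
  have hB1 : 1 ≤ K.B := by linarith [K.hbB, K.hb1]
  have wge : ∀ p, 1 ≤ wt D K.B p := fun p => one_le_pow₀ hB1
  have wle : ∀ p, wt D K.B p ≤ K.B ^ D.C.card := fun p => pow_le_pow_right₀ hB1 (nn_le p)
  have hwB : K.B * wt D K.B (D.f c) ≤ K.B ^ (D.C.card + 1) := by
    rw [pow_succ, mul_comm]; gcongr; exact wle _
  have hε'1 : 1 ≤ (1 + K.ε') ^ 2 := one_le_pow₀ (by linarith [K.hε'])
  have hBw : K.B * wt D K.B (D.f c) * (1 + K.ε') ^ 2 ≤ K.lm :=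
    le_trans (by gcongr) S.hww
  have hBw2 : K.B * wt D K.B (D.f c) ≤ 2 := by
    have := le_mul_of_one_le_right (mul_nonneg (by linarith) (zero_le_one.trans (wge _)) : 0 ≤ K.B * wt D K.B (D.f c)) hε'1
    linarith [K.hlm2]
  have hw2 : wt D K.B (D.f c) ≤ 2 := by
    have := le_mul_of_one_le_left (zero_le_one.trans (wge (D.f c))) hB1
    linarith
  have hlogε : 0 ≤ Real.log (1 / K.ε) := Real.log_nonneg (by rw [one_le_div hε]; linarith [K.hε2])
  have hΛs : Real.log (cr c u v b) = Real.log (|v - c| * (|b - c| - |u - c|) / (|u - c| * (|b - c| - |v - c|))) := by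
    unfold cr; rw [d9, d10]
  have key := step_core K hF (r := |u - c|) (rv := |v - c|) (ls := |b - c|) (ρ := |e₁ - c|) (κ := |e₂ - b|)
    (P := P) (Q := Q) (w₁ := wt D K.B e₁) (w₂ := wt D K.B e₂) (w' := wt D K.B (D.f c)) (l := lo D c u)
    (M' := wt D K.B (D.f c) * Real.log (1 * |D.f u - D.f b| / (|D.f u - D.f c| * |D.f c - D.f b|)))
    (Λ' := Real.log (cr (D.f c) (D.f u) (D.f v) (D.f b))) d1 d2 d3 (abs_nonneg _) (abs_nonneg _)
    ?_ (S.c0 _ _ hP) (S.c0 _ _ hQ) (wge _) (wge _) (wge _) ?_ hBw2 ?_ ?_ ?_ ?_ ?_ ?_ ?_ ?_ ?_ hFM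
  · have : cr e₁ u v e₂ = (|v - c| + |e₁ - c|) * (|b - c| - |u - c| + |e₂ - b|) /
        ((|u - c| + |e₁ - c|) * (|b - c| - |v - c| + |e₂ - b|)) := by
      unfold cr; rw [d4, d5, d6, d7]
    rw [this, d4, d5, d6, d7, d8]; exact key
  · rw [← d8, abs_le]
    exact ⟨by linarith [he1I.1, he2I.2], by linarith [he1I.2, he2I.1]⟩
  · refine le_trans ?_ hBw
    have := K.hbB.le
    have := wge (D.f c)
    gcongr
  · rw [S.lm]; exact L.l1 c hc u
  · rw [S.lM]; exact L.l2 c hc u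
  · -- hM
    have huc : u ≠ c := fun h => by rw [h] at d1; simp at d1
    have a0 : K.ε * (min |u - c| K.ε) ^ lo D c u ≤ |D.f u - D.f c| := by
      rcases le_total (|u - c|) K.ε with h | h
      · rw [min_eq_left h]; exact L.lb c hc u huI huc h
      · rw [min_eq_right h]
        rcases eq_or_lt_of_le h with h | h
        · have := L.lb c hc u huI huc h.ge
          rwa [← h] at this
        · obtain ⟨z, hz1, hz2⟩ : ∃ z, |z - c| = K.ε ∧ Ch c z u b := by
            rcases hch with ⟨a1, a2, a3⟩ | ⟨a1, a2, a3⟩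
            · rw [abs_of_pos (by linarith)] at h
              exact ⟨c + K.ε, by rw [add_sub_cancel_left, abs_of_pos hε], Or.inl ⟨by linarith, by linarith, by linarith⟩⟩
            · rw [abs_of_neg (by linarith)] at h
              exact ⟨c - K.ε, by rw [sub_sub_cancel_left, abs_neg, abs_of_pos hε], Or.inr ⟨by linarith, by linarith, by linarith⟩⟩
          have hzI := (hz2.memI hcI hbI).1
          have hzc : z ≠ c := fun h => by rw [h] at hz1; simp at hz1; linarith
          have b1 := L.lb c hc z hzI hzc hz1.le
          rw [hz1, lo_congr hz2.side.1] at b1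
          have b2 := (H.ch hcI hbI hnC hz2).1.facts.2.1
          linarith
    have hmin : 0 < min |u - c| K.ε := lt_min d1 hε
    have a1 := Real.log_le_log (by positivity) a0
    rw [Real.log_mul hε.ne' (by positivity), Real.log_rpow hmin] at a1
    have f5' : 0 < |D.f u - D.f b| := f6.trans f5
    have a2 : Real.log (1 * |D.f u - D.f b| / (|D.f u - D.f c| * |D.f c - D.f b|)) ≤ - Real.log |D.f u - D.f c| := by
      rw [← Real.log_inv]
      have : 0 < |D.f c - D.f b| := f5'.trans f4
      apply Real.log_le_log (by positivity)
      rw [div_le_iff₀ (by positivity), inv_mul_cancel_left₀ f1.ne']; linarith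
    have a3 : Real.log (1 * |D.f u - D.f b| / (|D.f u - D.f c| * |D.f c - D.f b|)) ≤
        -(lo D c u) * Real.log (min |u - c| K.ε) + Real.log (1 / K.ε) := by
      rw [one_div, Real.log_inv]; linarith
    have a4 := mul_le_mul_of_nonneg_left a3 (zero_le_one.trans (wge (D.f c)))
    have a5 := mul_le_mul_of_nonneg_right hw2 hlogε
    rw [S.C1]; linarith
  · -- hS1
    rw [← hΛs]; exact Real.log_le_log hch.cr_pos hcr'
  · -- hsh1
    intro rz r1 r2 r3 r4
    rw [← hΛs]
    have hlog2 : 0 ≤ Real.log 2 := Real.log_nonneg (by norm_num)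
    have hcrl := Real.log_le_log hch.cr_pos hcr'
    rcases eq_or_lt_of_le r1 with h | r1
    · rw [← h, div_self d1.ne', Real.log_one, S.C2]; linarith
    have main : ∀ z, Ch c u z b → |z - c| = rz →
        (lo D c u - 1) * Real.log (rz / |u - c|) - K.C₂ ≤
          Real.log (cr (D.f c) (D.f u) (D.f z) (D.f b)) - Real.log (cr c u z b) := by
      intro z hz hzr
      have hzI := (hz.memI hcI hbI).2
      obtain ⟨g1, -⟩ := L.gz H hc huI hzI hz.side.1 d1 (by rw [hzr]; exact r1) (by rw [hzr]; exact r4)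
      have g2 := (H.ch hcI hbI hnC hz).1.left_le
      have g3 : Real.log (|u - b| / |z - b|) ≤ Real.log 2 := by
        obtain ⟨_, _, _, _, _, _, _, _, z9, z10⟩ := dist_facts (e₁ := c) (e₂ := b) hz (Or.inl rfl) (Or.inl rfl)
        have z5 := hz.facts.2.2.2.2
        apply Real.log_le_log (div_pos (z5.2.trans z5.1) z5.2)
        rw [div_le_iff₀ z5.2, z9, z10, hzr]; linarith
      rw [hz.log_cr, hzr, S.C2]
      rw [hzr] at g1
      linarith
    rcases eq_or_lt_of_le r2 with h | r2
    · exact main v hch h.symm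
    · obtain ⟨z, z1, z2, z3⟩ := ex_z hch r1 r2
      have m1 := main z z2 z1
      have q := H.ch hcI hbI hnC z3
      have m2 := Real.log_le_log z3.cr_pos q.2
      have m3 := z2.cr_add z3 hch
      have m4 := (H.ch hcI hbI hnC z2).1.cr_add q.1 hch'
      linarith
  · -- hsh2
    intro r3 r4
    obtain ⟨g1, g2⟩ := L.gz H hc huI hvI s1 d1 d2 r4
    have g3 := hch'.left_le
    have hlog2 : 0 ≤ Real.log 2 := Real.log_nonneg (by norm_num)
    rw [S.C2, S.rm]
    exact ⟨by linarith, by linarith⟩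
  · -- hnear
    intro hn
    have hbc : b ≠ c := fun h => by rw [h] at d3; simp at d3; linarith [abs_nonneg (v - c)]
    have hbe : b = e₂ := by
      rcases h2 with h | h
      · exact h
      · exact absurd h.1 (L.nC c hc b hbI hbc (hn.trans S.ρε))
    refine ⟨by rw [hbe]; simp, ?_⟩
    have := S.b4 e₂ Q hQ c hc (hbe ▸ hbc) (by rw [← hbe]; exact hn)
    rw [← hbe, ← lo_congr s2] at this
    exact this
  · intro h
    have : e₁ = c := sub_eq_zero.1 (abs_eq_zero.1 h)
    rw [this]; unfold wt; rw [S.cx.nn_crit hc hcX, pow_succ, mul_comm]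
  · intro h hle
    have hne : e₁ ≠ c := fun h' => by rw [h'] at h; simp at h
    have a1 := S.b4 e₁ P hP c hc hne hle
    have a2 := S.LG0
    have hlog : Real.log |e₁ - c| ≤ 0 := Real.log_nonpos (abs_nonneg _) (by linarith [K.hρ1])
    have a3 : K.lm ≤ wt D K.B (D.f c) * lo D c e₁ := by
      have := L.l1 c hc e₁
      rw [S.lm]
      exact this.trans (le_mul_of_one_le_left (by linarith) (wge _))
    have := mul_le_mul_of_nonpos_right (by linarith : K.lm - 1 ≤ wt D K.B (D.f c) * lo D c e₁ - 1) hlog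
    linarith

end W17

namespace W17

variable {D : CritData}

def Xq (D : CritData) (B e₁ e₂ u P : ℝ) : ℝ :=
  wt D B e₁ * Real.log (P * |u - e₂| / (|u - e₁| * |e₁ - e₂|))

def Mq (D : CritData) (B e₁ e₂ u v P Q : ℝ) : ℝ := max (Xq D B e₁ e₂ u P) (Xq D B e₂ e₁ v Q)

open Classical in
def nP (D : CritData) (a P : ℝ) : ℝ := if a ∈ D.C then 1 else P * |deriv D.f a|

theorem Mq_comm (B e₁ e₂ u v P Q : ℝ) : Mq D B e₁ e₂ u v P Q = Mq D B e₂ e₁ v u Q P := max_comm _ _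

theorem cr_shrink {e₁ e₂ a b u v : ℝ} (h : Ch a u v b) (h1 : e₁ = a ∨ Bt e₁ a u) (h2 : b = e₂ ∨ Bt v b e₂) :
    Ch e₁ u v e₂ ∧ cr e₁ u v e₂ ≤ cr a u v b := by
  obtain ⟨d1, d2, d3, d4, d5, d6, d7, d8, d9, d10⟩ := dist_facts h h1 h2
  have k1 := abs_nonneg (e₁ - a)
  have k2 := abs_nonneg (e₂ - b)
  constructor
  · rcases h with ⟨a1, a2, a3⟩ | ⟨a1, a2, a3⟩
    · refine Or.inl ⟨?_, a2, ?_⟩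
      · rcases h1 with h | h | h <;> linarith
      · rcases h2 with h | h | h <;> linarith
    · refine Or.inr ⟨?_, a2, ?_⟩
      · rcases h2 with h | h | h <;> linarith
      · rcases h1 with h | h | h <;> linarith
  · unfold cr
    rw [d4, d5, d6, d7, d9, d10, mul_div_mul_comm, mul_div_mul_comm]
    have q1 : (|v - a| + |e₁ - a|) / (|u - a| + |e₁ - a|) ≤ |v - a| / |u - a| := by
      rw [div_le_div_iff₀ (by linarith) d1]
      linarith [mul_le_mul_of_nonneg_right d2.le k1]
    have q2 : (|b - a| - |u - a| + |e₂ - b|) / (|b - a| - |v - a| + |e₂ - b|) ≤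
        (|b - a| - |u - a|) / (|b - a| - |v - a|) := by
      rw [div_le_div_iff₀ (by linarith) (by linarith)]
      linarith [mul_le_mul_of_nonneg_right d2.le k2]
    refine mul_le_mul q1 q2 (div_nonneg (by linarith) (by linarith)) (div_nonneg (by linarith) d1.le)

theorem Ch.log_pos {c u v b : ℝ} (h : Ch c u v b) : 0 < Real.log (cr c u v b) := by
  rw [h.log_cr]
  obtain ⟨h1, h2, h3, h4, h5, h6⟩ := h.facts
  have : 0 < Real.log (|u - b| / |v - b|) := Real.log_pos (by rw [one_lt_div h6]; exact h5)
  have : 0 < Real.log (|v - c| / |u - c|) := Real.log_pos (by rw [one_lt_div h1]; exact h2)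
  linarith

theorem Std.half {X : Set ℝ} {K : Kst} (S : Std D X K) {F : ℝ → ℝ} (hF : FP K F)
    {e₁ e₂ a b u v P Q : ℝ} (hP : Bar D X e₁ P) (hQ : Bar D X e₂ Q) (ha : a ∈ X) (hb : b ∈ X)
    (h1 : e₁ = a ∨ (a ∈ D.C ∧ Bt e₁ a u)) (h2 : b = e₂ ∨ (b ∈ D.C ∧ Bt v b e₂))
    (hch : Ch a u v b) (hnC : ∀ d ∈ D.C, ¬ Bt a d b)
    (hFM : F (Real.log (cr (D.f a) (D.f u) (D.f v) (D.f b))) ≤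
      Xq D K.B (D.f a) (D.f b) (D.f u) (nP D a P)) :
    F (Real.log (cr e₁ u v e₂)) ≤ max (Mq D K.B e₁ e₂ u v P Q) K.M₀ := by
  by_cases haC : a ∈ D.C
  · have e1 : nP D a P = 1 := if_pos haC
    rw [e1] at hFM
    have := S.stepC hF hP hQ hb haC ha (h1.imp id And.right) h2 hch hnC hFM
    unfold Mq Xq
    rw [abs_sub_comm e₂ e₁]
    exact this
  · have e1 : e₁ = a := h1.resolve_right (fun h => haC h.1)
    subst e1
    have e1 : nP D e₁ P = P * |deriv D.f e₁| := if_neg haC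
    have H := S.cx.H
    have haI := S.cx.XI ha
    have hbI := S.cx.XI hb
    have h2' : b = e₂ ∨ Bt v b e₂ := h2.imp id And.right
    obtain ⟨hE, hcrE⟩ := cr_shrink hch (Or.inl rfl) h2'
    obtain ⟨hI, hcrI⟩ := H.ch haI hbI hnC hch
    have hB1 : 1 ≤ K.B := by linarith [K.hbB, K.hb1]
    have wge : ∀ p, 1 ≤ wt D K.B p := fun p => one_le_pow₀ hB1
    have hk : 0 < K.k := by have := K.hk1; have := K.hc1; linarith
    have hl := Real.log_le_log hE.cr_pos (hcrE.trans hcrI)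
    have hm := hF.F1 _ _ hE.log_pos hl
    have hm2 : F (Real.log (cr e₁ u v e₂)) ≤ F (Real.log (cr (D.f e₁) (D.f u) (D.f v) (D.f b))) := by
      have := mul_nonneg hk.le (sub_nonneg.2 hl)
      linarith
    refine (hm2.trans hFM).trans (le_trans ?_ (le_max_left _ _))
    refine le_trans ?_ (le_max_left _ _)
    have hP0 : 0 < P := lt_of_lt_of_le K.hc0 (S.c0 _ _ hP)
    have hs2 := H.s2 haI hbI haC hnC hch.bt1
    unfold Xq
    rw [e1]
    have : wt D K.B (D.f e₁) = wt D K.B e₁ := by unfold wt; rw [nn_step haC]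
    rw [this]
    refine mul_le_mul_of_nonneg_left ?_ (zero_le_one.trans (wge _))
    obtain ⟨f1, f2, f3, f4, f5, f6⟩ := hI.facts
    have hd := abs_pos.2 (H.dne haI haC)
    have p1 := f6.trans f5
    have p2 := p1.trans f4
    apply Real.log_le_log (by positivity)
    obtain ⟨d1, d2, d3, d4, d5, d6, d7, d8, d9, d10⟩ := dist_facts (e₁ := e₁) hch (Or.inl rfl) h2'
    have q1 := mul_le_mul_of_nonneg_left hs2 hP0.le
    have q2 : |u - b| / |e₁ - b| ≤ |u - e₂| / |e₁ - e₂| := by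
      rw [d5, d8, d9, abs_sub_comm e₁ b, sub_self, abs_zero, zero_add]
      rw [div_le_div_iff₀ (by linarith) (by linarith [abs_nonneg (e₂ - b)])]
      linarith [mul_nonneg d1.le (abs_nonneg (e₂ - b))]
    have q3 := mul_le_mul_of_nonneg_left q2 (div_pos hP0 d1).le
    calc _ = P * (|deriv D.f e₁| * |D.f u - D.f b| / (|D.f u - D.f e₁| * |D.f e₁ - D.f b|)) := by ring
      _ ≤ P * (|u - b| / (|u - e₁| * |e₁ - b|)) := q1
      _ = P / |u - e₁| * (|u - b| / |e₁ - b|) := by rw [div_mul_div_comm, mul_div_assoc]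
      _ ≤ _ := q3
      _ = _ := by rw [div_mul_div_comm]

theorem Std.step {X : Set ℝ} {K : Kst} (S : Std D X K) {F : ℝ → ℝ} (hF : FP K F)
    {e₁ e₂ a b u v P Q : ℝ} (hP : Bar D X e₁ P) (hQ : Bar D X e₂ Q) (ha : a ∈ X) (hb : b ∈ X)
    (h1 : e₁ = a ∨ (a ∈ D.C ∧ Bt e₁ a u)) (h2 : e₂ = b ∨ (b ∈ D.C ∧ Bt e₂ b v))
    (hch : Ch a u v b) (hnC : ∀ d ∈ D.C, ¬ Bt a d b)
    (hFM : F (Real.log (cr (D.f a) (D.f u) (D.f v) (D.f b))) ≤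
      Mq D K.B (D.f a) (D.f b) (D.f u) (D.f v) (nP D a P) (nP D b Q)) :
    F (Real.log (cr e₁ u v e₂)) ≤ max (Mq D K.B e₁ e₂ u v P Q) K.M₀ := by
  rcases le_max_iff.1 hFM with h | h
  · exact S.half hF hP hQ ha hb h1 (h2.imp Eq.symm (fun h => ⟨h.1, h.2.swap⟩)) hch hnC h
  · rw [Mq_comm, ← cr_comm]
    rw [← cr_comm] at h
    exact S.half hF hQ hP hb ha h2 (h1.imp Eq.symm (fun h => ⟨h.1, h.2.swap⟩)) hch.swap
      (fun d hd hbt => hnC d hd hbt.swap) h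

theorem Bar.nP {X : Set ℝ} (K : Ctx D X) {e a P u : ℝ} (h : Bar D X e P) (ha : a ∈ X)
    (h1 : e = a ∨ (a ∈ D.C ∧ Bt e a u)) : Bar D X (D.f a) (nP D a P) := by
  unfold W17.nP
  split_ifs with hc
  · exact Bar.new hc ha
  · have : e = a := h1.resolve_right (fun h => hc h.1)
    subst this
    exact h.next hc

end W17

namespace W17

variable {D : CritData}

structure Wd (D : CritData) (X : Set ℝ) (x0 x1 : ℝ) : Prop where
  lt : x0 < x1
  WX : ∀ x ∈ Icc x0 x1, x ∈ X
  av : ∀ m : ℕ, ∀ x ∈ Icc x0 x1, D.f^[m] x ∉ D.C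

structure Sd (D : CritData) (X : Set ℝ) (p x0 x1 : ℝ) (m : ℕ) (e : ℝ) : Prop where
  eX : e ∈ X
  bt : ∀ x ∈ Icc x0 x1, ∀ y ∈ Icc x0 x1, Bt p x y → Bt e (D.f^[m] x) (D.f^[m] y)
  sub : ∀ x ∈ Icc x0 x1, ∀ z, Bt e z (D.f^[m] x) → z ∈ X

theorem Bt.left {e a u v : ℝ} (h : Bt e u v) (h1 : Bt e a u) : Bt a u v := by
  rcases h with h | h <;> rcases h1 with h1 | h1
  · exact Or.inl ⟨h1.2, h.2⟩
  · linarith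
  · linarith
  · exact Or.inr ⟨h.1, h1.1⟩

theorem Bt.widen {e a t u : ℝ} (h : Bt e a u) (h1 : Bt a t u) : Bt e t u := by
  rcases h with h | h <;> rcases h1 with h1 | h1
  · exact Or.inl ⟨by linarith, h1.2⟩
  · linarith
  · linarith
  · exact Or.inr ⟨h1.1, by linarith⟩

theorem Bt.narrow {e c u v : ℝ} (h : Bt e c u) (h1 : Bt e u v) : Bt e c v := by
  rcases h with h | h <;> rcases h1 with h1 | h1
  · exact Or.inl ⟨by linarith, by linarith⟩
  · linarith
  · linarith
  · exact Or.inr ⟨by linarith, by linarith⟩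

/-- intermediate values, strict version -/
theorem ivtBt {g : ℝ → ℝ} {a b z : ℝ} (hg : ContinuousOn g (uIcc a b)) (h : Bt (g a) z (g b)) :
    ∃ t, Bt a t b ∧ g t = z := by
  have h1 := intermediate_value_uIcc hg
  have h2 : z ∈ uIcc (g a) (g b) := by
    rw [mem_uIcc]; rcases h with h | h
    · exact Or.inl ⟨h.1.le, h.2.le⟩
    · exact Or.inr ⟨h.1.le, h.2.le⟩
  obtain ⟨t, ht, e⟩ := h1 h2
  refine ⟨t, ?_, e⟩
  have n1 : t ≠ a := by rintro rfl; rw [e] at h; rcases h with h | h <;> linarith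
  have n2 : t ≠ b := by rintro rfl; rw [e] at h; rcases h with h | h <;> linarith
  rw [mem_uIcc] at ht
  rcases ht with h | h
  · exact Or.inl ⟨lt_of_le_of_ne h.1 n1.symm, lt_of_le_of_ne h.2 n2⟩
  · exact Or.inr ⟨lt_of_le_of_ne h.1 n2.symm, lt_of_le_of_ne h.2 n1⟩

theorem uIcc_sub {a b : ℝ} (ha : a ∈ unitI) (hb : b ∈ unitI) : uIcc a b ⊆ unitI :=
  (convex_Icc (0:ℝ) 1).ordConnected.uIcc_subset ha hb

theorem Wd.conn {X : Set ℝ} (K : Ctx D X) {x0 x1 : ℝ} (W : Wd D X x0 x1) {m : ℕ} {x y c e : ℝ}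
    (hx : x ∈ Icc x0 x1) (hy : y ∈ Icc x0 x1) (hc : c ∈ D.C) (h : Bt e c (D.f^[m] x)) :
    Bt e c (D.f^[m] y) := by
  have hne : D.f^[m] y ≠ c := fun h => W.av m y hy (h ▸ hc)
  have hno : ¬ Bt (D.f^[m] x) c (D.f^[m] y) := by
    intro hb
    obtain ⟨t, ht, e⟩ := ivtBt (g := D.f^[m]) (a := x) (b := y)
      ((K.H.iterCont m).mono (uIcc_sub (K.XI (W.WX x hx)) (K.XI (W.WX y hy)))) hb
    have : t ∈ Icc x0 x1 := by
      rcases ht with ht | ht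
      · exact ⟨hx.1.trans ht.1.le, ht.2.le.trans hy.2⟩
      · exact ⟨hy.1.trans ht.1.le, ht.2.le.trans hx.2⟩
    exact W.av m t this (e ▸ hc)
  unfold Bt at *
  rcases lt_or_gt_of_ne hne with h1 | h1
  · rcases h with h | h
    · exact absurd (Or.inr ⟨h1, h.2⟩) hno
    · exact Or.inr ⟨h1, h.2⟩
  · rcases h with h | h
    · exact Or.inl ⟨h.1, h1⟩
    · exact absurd (Or.inl ⟨h.1, h1⟩) hno

theorem Sd.cut {X : Set ℝ} (K : Ctx D X) {p x0 x1 e : ℝ} {m : ℕ} (W : Wd D X x0 x1) (S : Sd D X p x0 x1 m e) :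
    ∃ a, a ∈ X ∧ (e = a ∨ (a ∈ D.C ∧ ∀ x ∈ Icc x0 x1, Bt e a (D.f^[m] x))) ∧
      (∀ c ∈ D.C, ∀ x ∈ Icc x0 x1, ¬ Bt a c (D.f^[m] x)) ∧
      ((∃ c ∈ D.C, ∃ x ∈ Icc x0 x1, Bt e c (D.f^[m] x)) → a ∈ D.C) := by
  classical
  have h0 : x0 ∈ Icc x0 x1 := ⟨le_rfl, W.lt.le⟩
  set T := D.C.filter (fun c => Bt e c (D.f^[m] x0)) with hT
  rcases T.eq_empty_or_nonempty with hE | hne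
  · have hno : ∀ c ∈ D.C, ∀ x ∈ Icc x0 x1, ¬ Bt e c (D.f^[m] x) := by
      intro c hc x hx hb
      have : c ∈ T := by rw [hT, Finset.mem_filter]; exact ⟨hc, W.conn K hx h0 hc hb⟩
      rw [hE] at this; simp at this
    refine ⟨e, S.eX, Or.inl rfl, hno, ?_⟩
    rintro ⟨c, hc, x, hx, hb⟩
    exact absurd hb (hno c hc x hx)
  · obtain ⟨a, ha, hmax⟩ := T.exists_max_image (fun c => |c - e|) hne
    rw [hT, Finset.mem_filter] at ha
    refine ⟨a, S.sub x0 h0 a ha.2, Or.inr ⟨ha.1, fun x hx => W.conn K h0 hx ha.1 ha.2⟩, ?_, fun _ => ha.1⟩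
    intro c hc x hx hb
    have h1 := W.conn K hx h0 hc hb
    have h2 := ha.2.widen h1
    have h3 := hmax c (by rw [hT, Finset.mem_filter]; exact ⟨hc, h2⟩)
    rcases ha.2 with h | h <;> rcases h1 with h1 | h1
    · rw [abs_of_pos (by linarith), abs_of_pos (by linarith)] at h3; linarith
    · linarith
    · linarith
    · rw [abs_of_neg (by linarith), abs_of_neg (by linarith)] at h3; linarith

theorem Sd.next {X : Set ℝ} (K : Ctx D X) {p x0 x1 e a : ℝ} {m : ℕ} (W : Wd D X x0 x1) (S : Sd D X p x0 x1 m e)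
    (ha : a ∈ X) (h1 : e = a ∨ (a ∈ D.C ∧ ∀ x ∈ Icc x0 x1, Bt e a (D.f^[m] x)))
    (h2 : ∀ c ∈ D.C, ∀ x ∈ Icc x0 x1, ¬ Bt a c (D.f^[m] x)) : Sd D X p x0 x1 (m + 1) (D.f a) := by
  have hI : ∀ x ∈ Icc x0 x1, D.f^[m] x ∈ unitI := fun x hx => K.H.iter (K.XI (W.WX x hx)) m
  refine ⟨K.fX _ ha, ?_, ?_⟩
  · intro x hx y hy hb
    have := S.bt x hx y hy hb
    rw [Function.iterate_succ_apply', Function.iterate_succ_apply']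
    have h3 : Bt a (D.f^[m] x) (D.f^[m] y) := by
      rcases h1 with rfl | h1
      · exact this
      · exact this.left (h1.2 x hx)
    exact K.H.bt (K.XI ha) (hI y hy) (fun c hc => h2 c hc y hy) h3
  · intro x hx z hz
    rw [Function.iterate_succ_apply'] at hz
    obtain ⟨t, ht, e⟩ := ivtBt (K.H.cont.mono (uIcc_sub (K.XI ha) (hI x hx))) hz
    rw [← e]
    apply K.fX
    apply S.sub x hx
    rcases h1 with rfl | h1
    · exact ht
    · exact (h1.2 x hx).widen ht

/-- both: an end state with a barrier -/
def En (D : CritData) (X : Set ℝ) (p x0 x1 : ℝ) (m : ℕ) (e P : ℝ) : Prop := Sd D X p x0 x1 m e ∧ Bar D X e P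

theorem En.step {X : Set ℝ} (K : Ctx D X) {p x0 x1 e P : ℝ} {m : ℕ} (W : Wd D X x0 x1) (S : En D X p x0 x1 m e P) :
    ∃ a, a ∈ X ∧ (e = a ∨ (a ∈ D.C ∧ ∀ x ∈ Icc x0 x1, Bt e a (D.f^[m] x))) ∧
      (∀ c ∈ D.C, ∀ x ∈ Icc x0 x1, ¬ Bt a c (D.f^[m] x)) ∧ En D X p x0 x1 (m + 1) (D.f a) (nP D a P) := by
  obtain ⟨a, h1, h2, h3, -⟩ := S.1.cut K W
  have h0 : x0 ∈ Icc x0 x1 := ⟨le_rfl, W.lt.le⟩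
  exact ⟨a, h1, h2, h3, S.1.next K W h1 h2 h3, S.2.nP K h1 (h2.imp id (fun h => ⟨h.1, h.2 x0 h0⟩))⟩

theorem En.later {X : Set ℝ} (K : Ctx D X) {p x0 x1 e P : ℝ} {m : ℕ} (W : Wd D X x0 x1) (S : En D X p x0 x1 m e P)
    {n : ℕ} (h : m ≤ n) : ∃ e P, En D X p x0 x1 n e P := by
  induction n, h using Nat.le_induction with
  | base => exact ⟨e, P, S⟩
  | succ n _ ih =>
    obtain ⟨e, P, S⟩ := ih
    obtain ⟨a, -, -, -, h⟩ := S.step K W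
    exact ⟨_, _, h⟩

theorem initEn {X : Set ℝ} (K : Ctx D X) {p x0 x1 : ℝ} (W : Wd D X x0 x1) (hp : p ∈ X)
    (hpW : p ∉ Icc x0 x1) (hsub : ∀ x ∈ Icc x0 x1, ∀ z, Bt p z x → z ∈ X)
    (hcut : ∃ i w, (∀ x ∈ Icc x0 x1, Bt p w x) ∧ D.f^[i] w ∈ D.C) : ∃ m e P, En D X p x0 x1 m e P := by
  classical
  have h0 : x0 ∈ Icc x0 x1 := ⟨le_rfl, W.lt.le⟩
  obtain ⟨w, hw, hwC⟩ := Nat.find_spec hcut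
  set i := Nat.find hcut with hi
  have hmin : ∀ m < i, ∀ w, (∀ x ∈ Icc x0 x1, Bt p w x) → D.f^[m] w ∉ D.C := by
    intro m hm w hw hC
    exact Nat.find_min hcut hm ⟨w, hw, hC⟩
  have key : ∀ m ≤ i, Sd D X p x0 x1 m (D.f^[m] p) ∧
      ∀ x ∈ Icc x0 x1, Bt (D.f^[m] p) (D.f^[m] w) (D.f^[m] x) := by
    intro m
    induction m with
    | zero => intro _; exact ⟨⟨hp, fun x _ y _ h => h, hsub⟩, hw⟩
    | succ m ih =>
      intro hm
      obtain ⟨S, hbt⟩ := ih (by omega)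
      have hno : ∀ c ∈ D.C, ∀ x ∈ Icc x0 x1, ¬ Bt (D.f^[m] p) c (D.f^[m] x) := by
        intro c hc x hx hb
        obtain ⟨t, ht, e⟩ := ivtBt (g := D.f^[m]) (a := p) (b := x)
          ((K.H.iterCont m).mono (uIcc_sub (K.XI hp) (K.XI (W.WX x hx)))) hb
        by_cases htW : t ∈ Icc x0 x1
        · exact W.av m t htW (e ▸ hc)
        · refine hmin m (by omega) t (fun y hy => ?_) (e ▸ hc)
          simp only [mem_Icc, not_and_or, not_le] at htW hpW hx hy
          rcases ht with ht | ht
          · have : t < x0 := htW.resolve_right (by linarith)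
            exact Or.inl ⟨ht.1, by linarith⟩
          · have : x1 < t := htW.resolve_left (by linarith)
            exact Or.inr ⟨by linarith, ht.2⟩
      have S' := S.next K W S.eX (Or.inl rfl) hno
      rw [← Function.iterate_succ_apply' D.f m p] at S'
      refine ⟨S', fun x hx => ?_⟩
      simp only [Function.iterate_succ_apply']
      exact K.H.bt (K.XI S.eX) (K.H.iter (K.XI (W.WX x hx)) m) (fun c hc => hno c hc x hx) (hbt x hx)
  obtain ⟨S, hbt⟩ := key i le_rfl
  obtain ⟨a, h1, h2, h3, h4⟩ := S.cut K W
  have haC := h4 ⟨_, hwC, x0, h0, hbt x0 h0⟩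
  exact ⟨i + 1, D.f a, 1, S.next K W h1 h2 h3, Bar.new haC h1⟩

end W17

namespace W17

variable {D : CritData}

theorem Bt.other {p q x y : ℝ} (hx : Bt p x q) (hy : Bt p y q) (h : Bt p x y) : Bt q y x := by
  rcases hx with hx | hx <;> rcases hy with hy | hy <;> rcases h with h | h <;>
    first
    | exact Or.inl ⟨by linarith, by linarith⟩
    | exact Or.inr ⟨by linarith, by linarith⟩
    | linarith

theorem Bt.toCh {a u v b : ℝ} (h : Bt a u v) (h2 : Bt b v u) : Ch a u v b := by
  rcases h with h | h <;> rcases h2 with h2 | h2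
  · linarith
  · exact Or.inl ⟨h.1, h.2, h2.2⟩
  · exact Or.inr ⟨h2.1, h.1, h.2⟩
  · linarith

structure Prm where
  (k Λ1 γ γ2 M₀ : ℝ)
  N : ℕ

structure Gd (D : CritData) (X : Set ℝ) (R : Prm) (B x0 x1 p q : ℝ) (m : ℕ) (e₁ e₂ P Q : ℝ) : Prop where
  E1 : En D X p x0 x1 m e₁ P
  E2 : En D X q x0 x1 m e₂ Q
  good : ∀ T > 0, ∀ x ∈ Icc x0 x1, ∀ y ∈ Icc x0 x1, Bt p x y →
    Fg R.k R.Λ1 R.γ R.γ2 T (Real.log (cr e₁ (D.f^[m] x) (D.f^[m] y) e₂)) ≤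
      Mq D B e₁ e₂ (D.f^[m] x) (D.f^[m] y) P Q →
    T * phi R.Λ1 R.γ R.γ2 |D.f^[R.N] x - D.f^[R.N] y| ≤ R.M₀
  len : ∀ x ∈ Icc x0 x1, ∀ y ∈ Icc x0 x1, Bt p x y →
    0 < |D.f^[R.N] x - D.f^[R.N] y| ∧
    |D.f^[R.N] x - D.f^[R.N] y| ≤ Real.log (cr e₁ (D.f^[m] x) (D.f^[m] y) e₂)

theorem Gd.ch {X : Set ℝ} {R : Prm} {B x0 x1 p q : ℝ} {m : ℕ} {e₁ e₂ P Q : ℝ}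
    (G : Gd D X R B x0 x1 p q m e₁ e₂ P Q) (hpq : ∀ x ∈ Icc x0 x1, Bt p x q) {x y : ℝ}
    (hx : x ∈ Icc x0 x1) (hy : y ∈ Icc x0 x1) (h : Bt p x y) : Ch e₁ (D.f^[m] x) (D.f^[m] y) e₂ :=
  (G.E1.1.bt x hx y hy h).toCh (G.E2.1.bt y hy x hx ((hpq x hx).other (hpq y hy) h))

theorem Gd.swap {X : Set ℝ} {R : Prm} {B x0 x1 p q : ℝ} {m : ℕ} {e₁ e₂ P Q : ℝ}
    (G : Gd D X R B x0 x1 p q m e₁ e₂ P Q) (hpq : ∀ x ∈ Icc x0 x1, Bt p x q) :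
    Gd D X R B x0 x1 q p m e₂ e₁ Q P := by
  refine ⟨G.E2, G.E1, ?_, ?_⟩
  · intro T hT x hx y hy h hF
    have h' := ((hpq x hx).swap).other ((hpq y hy).swap) h
    rw [Mq_comm, cr_comm] at hF
    rw [abs_sub_comm]
    exact G.good T hT y hy x hx h' hF
  · intro x hx y hy h
    have h' := ((hpq x hx).swap).other ((hpq y hy).swap) h
    rw [abs_sub_comm, cr_comm]
    exact G.len y hy x hx h'

theorem Gd.step {X : Set ℝ} {K : Kst} (S : Std D X K) {R : Prm} {x0 x1 p q : ℝ} {m : ℕ} {e₁ e₂ P Q : ℝ}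
    (hF : ∀ T > 0, FP K (Fg R.k R.Λ1 R.γ R.γ2 T)) (hM : K.M₀ = R.M₀) (hk : 0 < R.k) (hΛ : 0 < R.Λ1)
    (hγ : 0 ≤ R.γ) (hγ2 : 0 ≤ R.γ2)
    (W : Wd D X x0 x1) (hpq : ∀ x ∈ Icc x0 x1, Bt p x q)
    (G : Gd D X R K.B x0 x1 p q m e₁ e₂ P Q) :
    ∃ e₁ e₂ P Q, Gd D X R K.B x0 x1 p q (m + 1) e₁ e₂ P Q := by
  have Kx := S.cx
  obtain ⟨a, a1, a2, a3, a4⟩ := G.E1.step Kx W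
  obtain ⟨b, b1, b2, b3, b4⟩ := G.E2.step Kx W
  have hch : ∀ x ∈ Icc x0 x1, ∀ y ∈ Icc x0 x1, Bt p x y → Ch a (D.f^[m] x) (D.f^[m] y) b := by
    intro x hx y hy h
    have c1 := G.E1.1.bt x hx y hy h
    have c2 := G.E2.1.bt y hy x hx ((hpq x hx).other (hpq y hy) h)
    have c3 : Bt a (D.f^[m] x) (D.f^[m] y) := by
      rcases a2 with rfl | h
      · exact c1
      · exact c1.left (h.2 x hx)
    have c4 : Bt b (D.f^[m] y) (D.f^[m] x) := by
      rcases b2 with rfl | h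
      · exact c2
      · exact c2.left (h.2 y hy)
    exact c3.toCh c4
  have hnC : ∀ x ∈ Icc x0 x1, ∀ y ∈ Icc x0 x1, Bt p x y → ∀ d ∈ D.C, ¬ Bt a d b := by
    intro x hx y hy h d hd hb
    have h1 := a3 d hd x hx
    have h2 := b3 d hd x hx
    have h3 : D.f^[m] x ≠ d := fun h => W.av m x hx (h ▸ hd)
    unfold Bt at h1 h2 hb
    have h4 := hch x hx y hy h
    rcases lt_or_gt_of_ne h3 with h3 | h3
    · apply h1
      rcases h4 with h4 | h4 <;> rcases hb with hb | hb
      · exact absurd (Or.inr ⟨h3, hb.2⟩) h2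
      · linarith
      · linarith
      · exact Or.inr ⟨h3, hb.2⟩
    · apply h1
      rcases h4 with h4 | h4 <;> rcases hb with hb | hb
      · exact Or.inl ⟨hb.1, h3⟩
      · linarith
      · linarith
      · exact absurd (Or.inl ⟨hb.1, h3⟩) h2
  refine ⟨_, _, _, _, a4, b4, ?_, ?_⟩
  · intro T hT x hx y hy h hFM
    simp only [Function.iterate_succ_apply'] at hFM
    have st := S.step (hF T hT) G.E1.2 G.E2.2 a1 b1 (a2.imp id (fun h => ⟨h.1, h.2 x hx⟩))
      (b2.imp id (fun h => ⟨h.1, h.2 y hy⟩)) (hch x hx y hy h) (hnC x hx y hy h) hFM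
    rcases le_max_iff.1 st with h1 | h1
    · exact G.good T hT x hx y hy h h1
    · obtain ⟨l1, l2⟩ := G.len x hx y hy h
      have := phi_mono (γ := R.γ) (γ2 := R.γ2) hΛ hγ hγ2 l1 l2
      have := mul_le_mul_of_nonneg_left this hT.le
      have h3 := mul_pos hk (l1.trans_le l2)
      unfold Fg at h1
      rw [← hM]; linarith
  · intro x hx y hy h
    obtain ⟨l1, l2⟩ := G.len x hx y hy h
    refine ⟨l1, l2.trans ?_⟩
    simp only [Function.iterate_succ_apply']
    have c1 := G.ch hpq hx hy h
    have c2 := hch x hx y hy h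
    apply Real.log_le_log c1.cr_pos
    refine (cr_shrink c2 (a2.imp id (fun h => h.2 x hx))
      (b2.imp Eq.symm (fun h => (h.2 y hy).swap))).2.trans ?_
    exact (Kx.H.ch (Kx.XI a1) (Kx.XI b1) (hnC x hx y hy h) c2).2

/-- initial state -/
theorem Gd.start {X : Set ℝ} (Kx : Ctx D X) {k Λ1 γ γ2 B x0 x1 p q : ℝ} {N : ℕ} {e₁ e₂ P Q : ℝ}
    (hk : 0 < k) (hΛ : 0 < Λ1) (hγ : 0 ≤ γ) (hγ2 : 0 ≤ γ2) (hB : 1 ≤ B) (hP : 0 < P) (hQ : 0 < Q)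
    (W : Wd D X x0 x1) (hpq : ∀ x ∈ Icc x0 x1, Bt p x q)
    (E1 : En D X p x0 x1 N e₁ P) (E2 : En D X q x0 x1 N e₂ Q) :
    ∃ M₁, ∀ M₀ ≥ M₁, Gd D X ⟨k, Λ1, γ, γ2, M₀, N⟩ B x0 x1 p q N e₁ e₂ P Q := by
  have hch : ∀ x ∈ Icc x0 x1, ∀ y ∈ Icc x0 x1, Bt p x y → Ch e₁ (D.f^[N] x) (D.f^[N] y) e₂ := fun x hx y hy h =>
    (E1.1.bt x hx y hy h).toCh (E2.1.bt y hy x hx ((hpq x hx).other (hpq y hy) h))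
  have hWI : Icc x0 x1 ⊆ unitI := fun x hx => Kx.XI (W.WX x hx)
  have hcont : ContinuousOn (D.f^[N]) (Icc x0 x1) := (Kx.H.iterCont N).mono hWI
  have bd : ∀ (e e' r P : ℝ), 0 < P → e ∈ unitI → e' ∈ unitI → e ≠ e' →
      (∀ x ∈ Icc x0 x1, D.f^[N] x ≠ e) → (∀ x ∈ Icc x0 x1, D.f^[N] x ≠ e') →
      ∃ M, ∀ x ∈ Icc x0 x1, Xq D B e e' (D.f^[N] x) P ≤ M := by
    intro e e' r P hP he he' hee hne hne'
    have hc : ContinuousOn (fun x => Xq D B e e' (D.f^[N] x) P) (Icc x0 x1) := by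
      unfold Xq
      apply ContinuousOn.mul continuousOn_const
      apply ContinuousOn.log
      · apply ContinuousOn.div
        · exact continuousOn_const.mul (hcont.sub continuousOn_const).abs
        · exact (hcont.sub continuousOn_const).abs.mul continuousOn_const
        · intro x hx
          exact mul_ne_zero (abs_ne_zero.2 (sub_ne_zero.2 (hne x hx))) (abs_ne_zero.2 (sub_ne_zero.2 hee))
      · intro x hx
        exact div_ne_zero (mul_ne_zero hP.ne' (abs_ne_zero.2 (sub_ne_zero.2 (hne' x hx))))
          (mul_ne_zero (abs_ne_zero.2 (sub_ne_zero.2 (hne x hx))) (abs_ne_zero.2 (sub_ne_zero.2 hee)))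
    obtain ⟨z, hz, hm⟩ := isCompact_Icc.exists_isMaxOn (nonempty_Icc.2 W.lt.le) hc
    exact ⟨_, fun x hx => hm hx⟩
  have hx0 : x0 ∈ Icc x0 x1 := ⟨le_rfl, W.lt.le⟩
  have hx1 : x1 ∈ Icc x0 x1 := ⟨W.lt.le, le_rfl⟩
  have ex : ∀ x ∈ Icc x0 x1, D.f^[N] x ≠ e₁ ∧ D.f^[N] x ≠ e₂ ∧ e₁ ≠ e₂ := by
    intro x hx
    obtain ⟨y, hy, hne⟩ : ∃ y ∈ Icc x0 x1, y ≠ x := by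
      by_cases h : x = x0
      · exact ⟨x1, hx1, by rw [h]; exact W.lt.ne'⟩
      · exact ⟨x0, hx0, Ne.symm h⟩
    have : Bt p x y ∨ Bt p y x := by
      have g1 := hpq x hx
      have g2 := hpq y hy
      rcases lt_or_gt_of_ne hne with h | h <;> rcases g1 with g1 | g1 <;> rcases g2 with g2 | g2 <;>
        first
        | exact Or.inl (Or.inl ⟨by linarith, by linarith⟩)
        | exact Or.inl (Or.inr ⟨by linarith, by linarith⟩)
        | exact Or.inr (Or.inl ⟨by linarith, by linarith⟩)
        | exact Or.inr (Or.inr ⟨by linarith, by linarith⟩)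
    rcases this with h | h
    · have := hch x hx y hy h
      rcases this with ⟨t1, t2, t3⟩ | ⟨t1, t2, t3⟩
      · exact ⟨by linarith, by linarith, by linarith⟩
      · exact ⟨by linarith, by linarith, by linarith⟩
    · have := hch y hy x hx h
      rcases this with ⟨t1, t2, t3⟩ | ⟨t1, t2, t3⟩
      · exact ⟨by linarith, by linarith, by linarith⟩
      · exact ⟨by linarith, by linarith, by linarith⟩
  have he1 := Kx.XI E1.1.eX
  have he2 := Kx.XI E2.1.eX
  obtain ⟨M1, hM1⟩ := bd e₁ e₂ 0 P hP he1 he2 (ex x0 hx0).2.2 (fun x hx => (ex x hx).1) (fun x hx => (ex x hx).2.1)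
  obtain ⟨M2, hM2⟩ := bd e₂ e₁ 0 Q hQ he2 he1 (ex x0 hx0).2.2.symm (fun x hx => (ex x hx).2.1) (fun x hx => (ex x hx).1)
  have hlen : ∀ x ∈ Icc x0 x1, ∀ y ∈ Icc x0 x1, Bt p x y →
    0 < |D.f^[N] x - D.f^[N] y| ∧
    |D.f^[N] x - D.f^[N] y| ≤ Real.log (cr e₁ (D.f^[N] x) (D.f^[N] y) e₂) := by
    intro x hx y hy h
    have c := hch x hx y hy h
    refine ⟨abs_pos.2 (sub_ne_zero.2 ?_), ?_⟩
    · rcases c with c | c <;> linarith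
    · refine le_trans ?_ c.left_le
      obtain ⟨h1, h2, -⟩ := c.facts
      refine le_trans ?_ (one_sub_le_log h1 h2)
      have hv : |D.f^[N] y - e₁| ≤ 1 := by
        have := Kx.H.iter (hWI hy) N
        rw [abs_le]; exact ⟨by linarith [this.1, he1.2], by linarith [this.2, he1.1]⟩
      have hd : |D.f^[N] x - D.f^[N] y| = |D.f^[N] y - e₁| - |D.f^[N] x - e₁| := by
        rcases c with ⟨c1, c2, c3⟩ | ⟨c1, c2, c3⟩
        · rw [abs_of_neg (by linarith), abs_of_pos (by linarith), abs_of_pos (by linarith)]; ring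
        · rw [abs_of_pos (by linarith), abs_of_neg (by linarith), abs_of_neg (by linarith)]; ring
      rw [hd, le_div_iff₀ (h1.trans h2)]
      exact mul_le_of_le_one_right (by linarith) hv
  refine ⟨max M1 M2, fun M₀ hM => ⟨E1, E2, ?_, hlen⟩⟩
  intro T hT x hx y hy h hF
  obtain ⟨l1, l2⟩ := hlen x hx y hy h
  have := phi_mono (γ := γ) (γ2 := γ2) hΛ hγ hγ2 l1 l2
  have := mul_le_mul_of_nonneg_left this hT.le
  have h3 := mul_pos hk (l1.trans_le l2)
  unfold Fg at hF
  have : Mq D B e₁ e₂ (D.f^[N] x) (D.f^[N] y) P Q ≤ M₀ :=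
    le_trans (max_le_max (hM1 x hx) (hM2 y hy)) hM
  simp only at *
  linarith

end W17

namespace W17

variable {D : CritData}

theorem chain {η ψ : ℝ → ℝ} {θ C β S : ℝ} (hη : ContinuousOn η (Icc 0 1)) (hθ : 0 < θ) (hθ1 : θ < 1)
    (hC : 0 < C) (hβ : 0 < β) (hS : 0 < S) (hSη : ∀ t ∈ Icc (0:ℝ) 1, S ≤ η t)
    (hd : ∀ s ∈ Icc (0:ℝ) 1, ∀ t ∈ Icc (0:ℝ) 1, s < t → θ * η s ≤ η t → |ψ s - ψ t| ≤ C * (η t) ^ (-β)) :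
    |ψ 0 - ψ 1| ≤ C / (1 - θ ^ β) * S ^ (-β) := by
  have hθβ : θ ^ β < 1 := Real.rpow_lt_one hθ.le hθ1 hβ
  have hθβ0 : 0 < θ ^ β := by positivity
  set C2 := C / (1 - θ ^ β) with hC2
  have hpos : 0 < 1 - θ ^ β := by linarith
  have hC2e : C2 * θ ^ β + C = C2 := by rw [hC2]; field_simp; ring
  have hC2p : 0 < C2 := div_pos hC hpos
  have hCC : C ≤ C2 := by linarith [mul_pos hC2p hθβ0]
  have key : ∀ n : ℕ, ∀ s ∈ Icc (0:ℝ) 1, ∀ t ∈ Icc (0:ℝ) 1, s < t → θ ^ n * η s ≤ η t →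
      |ψ s - ψ t| ≤ C2 * (η t) ^ (-β) := by
    intro n
    induction n with
    | zero =>
      intro s hs t ht hst h
      have h1 := hSη s hs
      have ht0 := hS.trans_le (hSη t ht)
      have h2 : θ * η s ≤ η t := by
        refine le_trans ?_ h
        simp only [pow_zero, one_mul]
        exact mul_le_of_le_one_left (by linarith) hθ1.le
      refine (hd s hs t ht hst h2).trans ?_
      gcongr
    | succ n ih =>
      intro s hs t ht hst h
      have ht0 := hS.trans_le (hSη t ht)
      by_cases h2 : θ * η s ≤ η t
      · refine (hd s hs t ht hst h2).trans ?_
        gcongr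
      · rw [not_le] at h2
        have hsub : Icc s t ⊆ Icc 0 1 := Icc_subset_Icc hs.1 ht.2
        have iv := intermediate_value_Icc' hst.le (hη.mono hsub)
        have hm : η t / θ ∈ Icc (η t) (η s) := by
          constructor
          · rw [le_div_iff₀ hθ]; exact mul_le_of_le_one_right ht0.le hθ1.le
          · rw [div_le_iff₀ hθ]; linarith
        obtain ⟨z, hz, hze⟩ := iv hm
        have hz1 : s < z := by
          refine lt_of_le_of_ne hz.1 ?_
          rintro rfl
          rw [hze, mul_div_cancel₀ _ hθ.ne'] at h2; exact lt_irrefl _ h2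
        have hz2 : z < t := by
          refine lt_of_le_of_ne hz.2 ?_
          rintro rfl
          rw [eq_div_iff hθ.ne'] at hze
          have := mul_lt_mul_of_pos_left hθ1 ht0
          linarith
        have a1 := ih s hs z (hsub hz) hz1 (by
          rw [hze, le_div_iff₀ hθ]; rw [pow_succ] at h; linarith)
        have a2 := hd z (hsub hz) t ht hz2 (by rw [hze, mul_div_cancel₀ _ hθ.ne'])
        have a3 : (η z) ^ (-β) = θ ^ β * (η t) ^ (-β) := by
          rw [hze, Real.div_rpow ht0.le hθ.le, Real.rpow_neg hθ.le, div_inv_eq_mul, mul_comm]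
        rw [a3] at a1
        have a4 := abs_sub_le (ψ s) (ψ z) (ψ t)
        calc _ ≤ C2 * (θ ^ β * (η t) ^ (-β)) + C * (η t) ^ (-β) := by linarith
          _ = (C2 * θ ^ β + C) * (η t) ^ (-β) := by ring
          _ = _ := by rw [hC2e]
  have m0 : (0:ℝ) ∈ Icc (0:ℝ) 1 := by simp
  have m1 : (1:ℝ) ∈ Icc (0:ℝ) 1 := by simp
  have h1 := hS.trans_le (hSη 1 m1)
  have h0 := hS.trans_le (hSη 0 m0)
  obtain ⟨n, hn⟩ := exists_pow_lt_of_lt_one (div_pos h1 h0) hθ1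
  rw [lt_div_iff₀ h0] at hn
  refine (key n 0 m0 1 m1 one_pos hn.le).trans ?_
  have := Real.rpow_le_rpow_of_nonpos hS (hSη 1 m1) (neg_nonpos.2 hβ.le)
  gcongr

theorem phi_lower {Λ1 γ γ2 d : ℝ} (h1 : 0 < Λ1) (hγ : 0 ≤ γ) (hγ2 : γ ≤ γ2) (hd : 0 < d) (hd1 : d ≤ 1) :
    (d / max Λ1 1) ^ γ2 ≤ phi Λ1 γ γ2 d := by
  have hm : 1 ≤ max Λ1 1 := le_max_right _ _
  have hm0 : 0 < max Λ1 1 := by linarith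
  have hq : d / max Λ1 1 ≤ d / Λ1 := by gcongr; exact le_max_left _ _
  have hq0 : 0 < d / max Λ1 1 := by positivity
  have hq1 : d / max Λ1 1 ≤ 1 := by rw [div_le_one hm0]; linarith
  unfold phi
  apply le_min
  · exact Real.rpow_le_rpow hq0.le hq (by linarith)
  · exact (Real.rpow_le_rpow_of_exponent_ge hq0 hq1 hγ2).trans (Real.rpow_le_rpow hq0.le hq hγ)

theorem final_num {k Λ1 γ γ2 M₀ Λ d x : ℝ} (hk : 0 < k) (h1 : 0 < Λ1) (hγ : 0 < γ) (hγ1 : γ < 1) (hγ2 : 1 ≤ γ2)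
    (hM : 0 < M₀) (hΛ : 0 < Λ) (hd : 0 < d) (hd1 : d ≤ 1) (hx : 0 < x) (hΛx : Λ ≤ x / (2 * k))
    (h : x / (2 * phi Λ1 γ γ2 Λ) * phi Λ1 γ γ2 d ≤ M₀) :
    d ≤ max Λ1 1 * (2 * M₀ * (2 * k * Λ1) ^ (-γ)) ^ (1 / γ2) * x ^ (-((1 - γ) / γ2)) := by
  have hp := phi_pos (γ := γ) (γ2 := γ2) h1 hΛ
  have hl := phi_lower (γ := γ) (γ2 := γ2) h1 hγ.le (by linarith) hd hd1
  have hm0 : 0 < max Λ1 1 := lt_of_lt_of_le one_pos (le_max_right _ _)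
  have u1 : phi Λ1 γ γ2 Λ ≤ (x / (2 * k) / Λ1) ^ γ := by
    unfold phi
    refine (min_le_right _ _).trans ?_
    have : 0 < Λ / Λ1 := by positivity
    gcongr
  have u2 : (x / (2 * k) / Λ1) ^ γ = x ^ γ * (2 * k * Λ1) ^ (-γ) := by
    rw [div_div, Real.div_rpow hx.le (by positivity), Real.rpow_neg (by positivity), div_eq_mul_inv]
  have u3 : x * phi Λ1 γ γ2 d ≤ 2 * M₀ * phi Λ1 γ γ2 Λ := by
    rw [div_mul_eq_mul_div, div_le_iff₀ (by positivity)] at h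
    linarith
  have u4 : (d / max Λ1 1) ^ γ2 ≤ 2 * M₀ * (2 * k * Λ1) ^ (-γ) * x ^ (γ - 1) := by
    rw [Real.rpow_sub_one hx.ne', ← mul_div_assoc, le_div_iff₀ hx]
    have := mul_le_mul_of_nonneg_left (u1.trans_eq u2) (by positivity : 0 ≤ 2 * M₀)
    have := mul_le_mul_of_nonneg_left hl hx.le
    linarith
  have hq0 : 0 < d / max Λ1 1 := by positivity
  have u5 := Real.rpow_le_rpow (by positivity) u4 (by positivity : 0 ≤ 1 / γ2)
  rw [← Real.rpow_mul hq0.le, mul_one_div_cancel (by linarith), Real.rpow_one,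
    Real.mul_rpow (by positivity) (by positivity), ← Real.rpow_mul hx.le, div_le_iff₀ hm0] at u5
  have e : (γ - 1) * (1 / γ2) = -((1 - γ) / γ2) := by ring
  rw [e] at u5
  linarith

theorem Gd.halfFin {X : Set ℝ} (Kx : Ctx D X) {R : Prm} {B x0 x1 p q c0 S : ℝ} {m : ℕ} {e₁ e₂ P Q : ℝ}
    (G : Gd D X R B x0 x1 p q m e₁ e₂ P Q) (W : Wd D X x0 x1) (hpq : ∀ x ∈ Icc x0 x1, Bt p x q)
    (hk : 0 < R.k) (hΛ : 0 < R.Λ1) (hγ : 0 < R.γ) (hγ1 : R.γ < 1) (hγ2 : 1 ≤ R.γ2) (hM : 0 < R.M₀) (hB : 1 ≤ B)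
    (hc0 : 0 < c0) (hP : c0 ≤ P) {g : ℝ → ℝ} (hg : ContinuousOn g (Icc 0 1))
    (hgW : ∀ t ∈ Icc (0:ℝ) 1, g t ∈ Icc x0 x1)
    (hgb : ∀ s ∈ Icc (0:ℝ) 1, ∀ t ∈ Icc (0:ℝ) 1, s < t → Bt p (g s) (g t)) (hS : 0 < S)
    (hSη : ∀ t ∈ Icc (0:ℝ) 1, S ≤ Real.log (c0 * |D.f^[m] (g t) - e₂| / (|D.f^[m] (g t) - e₁| * |e₁ - e₂|))) :
    |D.f^[R.N] (g 0) - D.f^[R.N] (g 1)| ≤ max R.Λ1 1 * (2 * R.M₀ * (2 * R.k * R.Λ1) ^ (-R.γ)) ^ (1 / R.γ2) /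
      (1 - (1 - min (1 / 2) (1 / (2 * R.k))) ^ ((1 - R.γ) / R.γ2)) * S ^ (-((1 - R.γ) / R.γ2)) := by
  have hWI : Icc x0 x1 ⊆ unitI := fun x hx => Kx.XI (W.WX x hx)
  have hcont : ContinuousOn (fun t => D.f^[m] (g t)) (Icc 0 1) :=
    (Kx.H.iterCont m).comp hg (fun t ht => hWI (hgW t ht))
  have hmin : 0 < min (1 / 2) (1 / (2 * R.k)) := lt_min (by norm_num) (by positivity)
  have hmin2 : min (1 / 2) (1 / (2 * R.k)) ≤ 1 / 2 := min_le_left _ _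
  have hm0 : 0 < max R.Λ1 1 := lt_of_lt_of_le one_pos (le_max_right _ _)
  have hch : ∀ s ∈ Icc (0:ℝ) 1, ∀ t ∈ Icc (0:ℝ) 1, s < t → Ch e₁ (D.f^[m] (g s)) (D.f^[m] (g t)) e₂ :=
    fun s hs t ht h => G.ch hpq (hgW s hs) (hgW t ht) (hgb s hs t ht h)
  have hne : ∀ t ∈ Icc (0:ℝ) 1, D.f^[m] (g t) ≠ e₁ ∧ D.f^[m] (g t) ≠ e₂ ∧ e₁ ≠ e₂ := by
    intro t ht
    by_cases h : t = 0
    · have := hch t ht 1 (by simp) (by rw [h]; exact one_pos)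
      rcases this with ⟨a, b, c⟩ | ⟨a, b, c⟩ <;> exact ⟨by linarith, by linarith, by linarith⟩
    · have := hch 0 (by simp) t ht (lt_of_le_of_ne ht.1 (Ne.symm h))
      rcases this with ⟨a, b, c⟩ | ⟨a, b, c⟩ <;> exact ⟨by linarith, by linarith, by linarith⟩
  have hP0 : 0 < P := hc0.trans_le hP
  apply chain (η := fun t => Real.log (c0 * |D.f^[m] (g t) - e₂| / (|D.f^[m] (g t) - e₁| * |e₁ - e₂|)))
    (ψ := fun t => D.f^[R.N] (g t)) _ (by linarith) (by linarith) (by positivity)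
    (div_pos (by linarith) (by linarith)) hS hSη
  · intro s hs t ht hst hle
    have c := hch s hs t ht hst
    obtain ⟨f1, f2, f3, f4, f5, f6⟩ := c.facts
    have es := hSη s hs
    have et := hSη t ht
    have p1 := f6.trans f5
    have p2 := f1.trans f2
    have p3 := p1.trans f4
    set ηs := Real.log (c0 * |D.f^[m] (g s) - e₂| / (|D.f^[m] (g s) - e₁| * |e₁ - e₂|)) with hηs
    set ηt := Real.log (c0 * |D.f^[m] (g t) - e₂| / (|D.f^[m] (g t) - e₁| * |e₁ - e₂|)) with hηt
    have hdiff : ηs - ηt = Real.log (cr e₁ (D.f^[m] (g s)) (D.f^[m] (g t)) e₂) := by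
      rw [hηs, hηt, ← Real.log_div (by positivity) (by positivity)]
      congr 1
      unfold cr
      field_simp
    obtain ⟨l1, l2⟩ := G.len _ (hgW s hs) _ (hgW t ht) (hgb s hs t ht hst)
    set Λ := Real.log (cr e₁ (D.f^[m] (g s)) (D.f^[m] (g t)) e₂) with hΛd
    have hΛ0 : 0 < Λ := l1.trans_le l2
    have hηs0 : 0 < ηs := hS.trans_le es
    have hΛx : Λ ≤ ηs / (2 * R.k) := by
      have a1 : Λ ≤ min (1 / 2) (1 / (2 * R.k)) * ηs := by
        have hle2 : (1 - min (1 / 2) (1 / (2 * R.k))) * ηs ≤ ηt := hle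
        linarith
      have a2 := mul_le_mul_of_nonneg_right (min_le_right (1 / 2) (1 / (2 * R.k))) hηs0.le
      rw [div_eq_mul_one_div, mul_comm]; linarith
    have hp := phi_pos (γ := R.γ) (γ2 := R.γ2) hΛ hΛ0
    have hd1 : |D.f^[R.N] (g s) - D.f^[R.N] (g t)| ≤ 1 := by
      have i1 := Kx.H.iter (hWI (hgW s hs)) R.N
      have i2 := Kx.H.iter (hWI (hgW t ht)) R.N
      rw [abs_le]; exact ⟨by linarith [i1.1, i2.2], by linarith [i1.2, i2.1]⟩
    have gd := G.good (ηs / (2 * phi R.Λ1 R.γ R.γ2 Λ)) (by positivity) _ (hgW s hs) _ (hgW t ht) (hgb s hs t ht hst) (by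
      refine le_trans ?_ (le_max_left _ _)
      have q1 : Fg R.k R.Λ1 R.γ R.γ2 (ηs / (2 * phi R.Λ1 R.γ R.γ2 Λ)) Λ ≤ ηs := by
        unfold Fg
        have : ηs / (2 * phi R.Λ1 R.γ R.γ2 Λ) * phi R.Λ1 R.γ R.γ2 Λ = ηs / 2 := by field_simp
        rw [this]
        have := mul_le_mul_of_nonneg_left hΛx hk.le
        have e : R.k * (ηs / (2 * R.k)) = ηs / 2 := by field_simp
        linarith
      refine q1.trans ?_
      have q2 : ηs ≤ Real.log (P * |D.f^[m] (g s) - e₂| / (|D.f^[m] (g s) - e₁| * |e₁ - e₂|)) := by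
        apply Real.log_le_log (by positivity)
        gcongr
      unfold Xq
      exact q2.trans (le_mul_of_one_le_left (by linarith) (one_le_pow₀ hB)))
    have fn := final_num hk hΛ hγ hγ1 hγ2 hM hΛ0 l1 hd1 hηs0 hΛx gd
    refine fn.trans ?_
    have := Real.rpow_le_rpow_of_nonpos (hS.trans_le et) (by linarith : ηt ≤ ηs)
      (neg_nonpos.2 (div_pos (by linarith : 0 < 1 - R.γ) (by linarith : 0 < R.γ2)).le)
    gcongr
  · apply ContinuousOn.log
    · apply ContinuousOn.div
      · exact continuousOn_const.mul (hcont.sub continuousOn_const).abs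
      · exact (hcont.sub continuousOn_const).abs.mul continuousOn_const
      · intro x hx
        obtain ⟨n1, n2, n3⟩ := hne x hx
        exact mul_ne_zero (abs_ne_zero.2 (sub_ne_zero.2 n1)) (abs_ne_zero.2 (sub_ne_zero.2 n3))
    · intro x hx
      obtain ⟨n1, n2, n3⟩ := hne x hx
      exact div_ne_zero (mul_ne_zero hc0.ne' (abs_ne_zero.2 (sub_ne_zero.2 n2)))
          (mul_ne_zero (abs_ne_zero.2 (sub_ne_zero.2 n1)) (abs_ne_zero.2 (sub_ne_zero.2 n3)))

end W17

namespace W17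

variable {D : CritData}

theorem Gd.finH {X : Set ℝ} (Kx : Ctx D X) {R : Prm} {B x0 x1 p q c0 S τ xa xm : ℝ} {m : ℕ} {e₁ e₂ P Q : ℝ}
    (G : Gd D X R B x0 x1 p q m e₁ e₂ P Q) (W : Wd D X x0 x1) (hpq : ∀ x ∈ Icc x0 x1, Bt p x q)
    (hk : 0 < R.k) (hΛ : 0 < R.Λ1) (hγ : 0 < R.γ) (hγ1 : R.γ < 1) (hγ2 : 1 ≤ R.γ2) (hM : 0 < R.M₀) (hB : 1 ≤ B)
    (hc0 : 0 < c0) (hP : c0 ≤ P) (hS : 0 < S) (hτ : 0 < τ) (hSτ : S ≤ Real.log (c0 / (2 * τ)))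
    (hxa : xa ∈ Icc x0 x1) (hxm : xm ∈ Icc x0 x1) (hb : Bt p xa xm)
    (hsm : ∀ x ∈ Icc x0 x1, min |D.f^[m] x - e₁| |D.f^[m] x - e₂| ≤ τ)
    (hmid : |D.f^[m] xm - e₁| ≤ |D.f^[m] xm - e₂|) :
    |D.f^[R.N] xa - D.f^[R.N] xm| ≤ max R.Λ1 1 * (2 * R.M₀ * (2 * R.k * R.Λ1) ^ (-R.γ)) ^ (1 / R.γ2) /
      (1 - (1 - min (1 / 2) (1 / (2 * R.k))) ^ ((1 - R.γ) / R.γ2)) * S ^ (-((1 - R.γ) / R.γ2)) := by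
  have hgb : ∀ s ∈ Icc (0:ℝ) 1, ∀ t ∈ Icc (0:ℝ) 1, s < t → Bt p (xa + s * (xm - xa)) (xa + t * (xm - xa)) := by
    intro s hs t ht hst
    rcases hb with hb | hb
    · have h1 := mul_nonneg hs.1 (by linarith : 0 ≤ xm - xa)
      have h2 := mul_lt_mul_of_pos_right hst (by linarith : 0 < xm - xa)
      exact Or.inl ⟨by linarith, by linarith⟩
    · have h1 := mul_nonneg hs.1 (by linarith : 0 ≤ xa - xm)
      have h2 := mul_lt_mul_of_pos_right hst (by linarith : 0 < xa - xm)
      exact Or.inr ⟨by linarith, by linarith⟩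
  have hgW : ∀ t ∈ Icc (0:ℝ) 1, xa + t * (xm - xa) ∈ Icc x0 x1 := by
    intro t ht
    have := (convex_Icc x0 x1) hxa hxm (by linarith [ht.2] : 0 ≤ 1 - t) ht.1 (by ring)
    simp only [smul_eq_mul] at this
    convert this using 1; ring
  have := G.halfFin Kx W hpq hk hΛ hγ hγ1 hγ2 hM hB hc0 hP (g := fun t => xa + t * (xm - xa)) (by fun_prop)
    hgW hgb hS (by
      intro t ht
      have e1 : xa + 1 * (xm - xa) = xm := by ring
      have hx := hgW t ht
      have key : 0 < |D.f^[m] (xa + t * (xm - xa)) - e₁| ∧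
          |D.f^[m] (xa + t * (xm - xa)) - e₁| ≤ |D.f^[m] (xa + t * (xm - xa)) - e₂| ∧
          |e₁ - e₂| = |D.f^[m] (xa + t * (xm - xa)) - e₁| + |D.f^[m] (xa + t * (xm - xa)) - e₂| := by
        rcases eq_or_lt_of_le ht.2 with h | h
        · rw [h, e1]
          have c := G.ch hpq hxa hxm hb
          have c2 := c.facts
          refine ⟨by linarith, hmid, ?_⟩
          rcases c with ⟨c1, c2, c3⟩ | ⟨c1, c2, c3⟩
          · rw [abs_of_neg (by linarith), abs_of_pos (by linarith), abs_of_neg (by linarith)]; ring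
          · rw [abs_of_pos (by linarith), abs_of_neg (by linarith), abs_of_pos (by linarith)]; ring
        · have hb2 := hgb t ht 1 (by simp) h
          rw [e1] at hb2
          have c := G.ch hpq hx hxm hb2
          have c2 := c.facts
          refine ⟨by linarith, by linarith, ?_⟩
          rcases c with ⟨c1, c2, c3⟩ | ⟨c1, c2, c3⟩
          · rw [abs_of_neg (by linarith), abs_of_pos (by linarith), abs_of_neg (by linarith)]; ring
          · rw [abs_of_pos (by linarith), abs_of_neg (by linarith), abs_of_pos (by linarith)]; ring
      obtain ⟨k1, k2, k3⟩ := key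
      have k4 := hsm _ hx
      rw [min_eq_left k2] at k4
      refine hSτ.trans (Real.log_le_log (by positivity) ?_)
      rw [k3]
      set a := |D.f^[m] (xa + t * (xm - xa)) - e₁|
      set b := |D.f^[m] (xa + t * (xm - xa)) - e₂|
      have hb0 : 0 < b := k1.trans_le k2
      rw [div_le_div_iff₀ (by positivity) (by positivity), mul_assoc]
      apply mul_le_mul_of_nonneg_left _ hc0.le
      have a1 := mul_le_mul_of_nonneg_right k4 (by linarith : 0 ≤ a + b)
      have a2 := mul_le_mul_of_nonneg_left k2 hτ.le
      linarith)
  have e1 : xa + 1 * (xm - xa) = xm := by ring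
  simp only [zero_mul, add_zero] at this
  rw [e1] at this
  exact this

theorem small_min {a u v b ω : ℝ} (h : Ch a u v b) (hω : 0 < ω) (hl : ω ≤ Real.log (cr a u v b)) :
    min |u - a| |v - b| ≤ 2 * |u - v| / ω := by
  obtain ⟨h1, h2, h3, h4, h5, h6⟩ := h.facts
  rw [h.log_cr] at hl
  have d1 : |v - a| - |u - a| = |u - v| := by
    rcases h with ⟨c1, c2, c3⟩ | ⟨c1, c2, c3⟩
    · rw [abs_of_pos (by linarith), abs_of_pos (by linarith), abs_of_neg (by linarith)]; ring
    · rw [abs_of_neg (by linarith), abs_of_neg (by linarith), abs_of_pos (by linarith)]; ring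
  have d2 : |u - b| - |v - b| = |u - v| := by
    rcases h with ⟨c1, c2, c3⟩ | ⟨c1, c2, c3⟩
    · rw [abs_of_neg (by linarith), abs_of_neg (by linarith), abs_of_neg (by linarith)]; ring
    · rw [abs_of_pos (by linarith), abs_of_pos (by linarith), abs_of_pos (by linarith)]; ring
  have l1 := log_ratio_le h1 (h1.trans h2)
  have l2 := log_ratio_le h6 (h6.trans h5)
  rw [d1] at l1
  rw [d2] at l2
  by_contra hc
  rw [not_le, lt_min_iff] at hc
  obtain ⟨c1, c2⟩ := hc
  rw [div_lt_iff₀ hω] at c1 c2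
  have q1 : |u - v| / |u - a| < ω / 2 := by rw [div_lt_iff₀ h1]; linarith
  have q2 : |u - v| / |v - b| < ω / 2 := by rw [div_lt_iff₀ h6]; linarith
  linarith

theorem fin {X : Set ℝ} (Kx : Ctx D X) {x0 x1 p q e₁ e₂ P Q : ℝ} {N : ℕ} (W : Wd D X x0 x1)
    (hp : p < x0) (hq : x1 < q) (E1 : En D X p x0 x1 N e₁ P) (E2 : En D X q x0 x1 N e₂ Q)
    (hlim : ∀ τ > 0, ∃ M, ∀ m ≥ M, |D.f^[m] x0 - D.f^[m] x1| ≤ τ) : False := by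
  have hpq : ∀ x ∈ Icc x0 x1, Bt p x q := fun x hx => Or.inl ⟨by linarith [hx.1], by linarith [hx.2]⟩
  obtain ⟨ε, L⟩ := Kx.H.exLoc
  obtain ⟨B, LG, k, Λ1, γ, γ2, hB, hk, hΛ1, hγ, hγ1, hγ2, hBN, hex⟩ := exK L.pos L.half D.C.card
  obtain ⟨c0, hc0, hc01, hc⟩ := Kx.exc0
  have hBN' : B ^ D.C.card ≤ 1 + ε := (pow_le_pow_right₀ hB.le (Nat.le_succ _)).trans hBN
  obtain ⟨ρ, hρ, hb4⟩ := Kx.B4 L hB.le hBN' LG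
  set ρ0 := min ρ (min ε (1 / 2)) with hρ0
  have hρ0p : 0 < ρ0 := lt_min hρ (lt_min L.pos (by norm_num))
  have hρ1 : ρ0 ≤ ρ := min_le_left _ _
  have hρ2 : ρ0 ≤ ε := (min_le_right _ _).trans (min_le_left _ _)
  have hρ3 : ρ0 ≤ 1 / 2 := (min_le_right _ _).trans (min_le_right _ _)
  obtain ⟨M1, hM1⟩ := hex ρ0 c0 hρ0p (by linarith) hc0 hc01
  obtain ⟨M2, hM2⟩ := Gd.start Kx (k := k) (Λ1 := Λ1) (γ := γ) (γ2 := γ2) (B := B) hk hΛ1 hγ.le (by linarith) hB.le (hc0.trans_le (hc _ _ E1.2))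
    (hc0.trans_le (hc _ _ E2.2)) W hpq E1 E2
  set M₀ := max (max M1 M2) 1 with hM₀
  have hM₀1 : M₀ ≥ M1 := (le_max_left _ _).trans (le_max_left _ _)
  have hM₀2 : M₀ ≥ M2 := (le_max_right _ _).trans (le_max_left _ _)
  have hM₀p : 0 < M₀ := lt_of_lt_of_le one_pos (le_max_right _ _)
  obtain ⟨K, hK⟩ := hM1 M₀ hM₀1
  have hKε := hK.e_ε
  have hLGK : 0 ≤ K.LG := by
    have h1 := K.hLG
    have h2 := mul_nonneg (by linarith [K.hlm, K.hlM] : 0 ≤ 2 * K.lM + 1) (by linarith [K.hd2] : 0 ≤ K.d₀)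
    linarith [K.hC1]
  have S : Std D X K := by
    refine ⟨Kx, by rw [hKε]; exact L, by rw [hKε]; exact hK.e_lm, by rw [hKε]; exact hK.e_lM,
      by rw [hKε]; exact hK.e_rm, by rw [hKε]; exact hK.e_C1, by rw [hKε]; exact hK.e_C2,
      by rw [hK.e_B, hK.e_lm]; exact hK.e_hww, by rw [hK.e_c0]; exact hc, ?_, hLGK, by rw [hKε, hK.e_ρ0]; exact hρ2⟩
    rw [hK.e_LG, hK.e_ρ0, hK.e_B]
    exact fun p P hb c hcC hne hle => hb4 p P hb c hcC hne (hle.trans hρ1)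
  set R : Prm := ⟨k, Λ1, γ, γ2, M₀, N⟩ with hR
  have all : ∀ m ≥ N, ∃ e₁ e₂ P Q, Gd D X R B x0 x1 p q m e₁ e₂ P Q := by
    intro m hm
    induction m, hm using Nat.le_induction with
    | base => exact ⟨_, _, _, _, hM2 M₀ hM₀2⟩
    | succ m _ ih =>
      obtain ⟨e₁, e₂, P, Q, G⟩ := ih
      rw [← hK.e_B] at G ⊢
      exact G.step S (R := R) hK.e_F hK.e_M₀ hk hΛ1 hγ.le (by simp only [hR]; linarith) W hpq
  have hlt := W.lt
  set xm := (x0 + x1) / 2 with hxm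
  have i0 : x0 ∈ Icc x0 x1 := ⟨le_rfl, W.lt.le⟩
  have i1 : x1 ∈ Icc x0 x1 := ⟨W.lt.le, le_rfl⟩
  have im : xm ∈ Icc x0 x1 := ⟨by rw [hxm]; linarith, by rw [hxm]; linarith⟩
  have b0 : Bt p x0 xm := Or.inl ⟨hp, by rw [hxm]; linarith⟩
  have b1 : Bt q x1 xm := Or.inr ⟨by rw [hxm]; linarith, hq⟩
  have b1' : Bt p xm x1 := Or.inl ⟨by rw [hxm]; linarith, by rw [hxm]; linarith⟩
  have b01 : Bt p x0 x1 := Or.inl ⟨hp, hlt⟩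
  have G0 := hM2 M₀ hM₀2
  have l0 := (G0.len x0 i0 xm im b0).1
  have l1 := (G0.len xm im x1 i1 b1').1
  have l01 := (G0.len x0 i0 x1 i1 b01).1
  simp only at l0 l1 l01
  set δ := min |D.f^[N] x0 - D.f^[N] xm| |D.f^[N] xm - D.f^[N] x1| with hδ
  have hδ0 : 0 < δ := lt_min l0 l1
  set ω := |D.f^[N] x0 - D.f^[N] x1| with hω
  set Cs := max Λ1 1 * (2 * M₀ * (2 * k * Λ1) ^ (-γ)) ^ (1 / γ2) /
      (1 - (1 - min (1 / 2) (1 / (2 * k))) ^ ((1 - γ) / γ2)) with hCs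
  have hβ : 0 < (1 - γ) / γ2 := div_pos (by linarith) (by linarith)
  obtain ⟨S', hS', hS'2⟩ : ∃ S' > 0, Cs * S' ^ (-((1 - γ) / γ2)) < δ := by
    have t1 : Tendsto (fun s : ℝ => Cs * s ^ (-((1 - γ) / γ2))) atTop (𝓝 (Cs * 0)) :=
      (tendsto_rpow_neg_atTop hβ).const_mul Cs
    rw [mul_zero] at t1
    obtain ⟨s, h1, h2⟩ := ((eventually_gt_atTop (0:ℝ)).and (t1.eventually_lt_const hδ0)).exists
    exact ⟨s, h1, h2⟩
  set τ := c0 / (2 * Real.exp S') with hτ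
  have hτ0 : 0 < τ := by positivity
  have hSτ : S' ≤ Real.log (c0 / (2 * τ)) := by
    have : c0 / (2 * τ) = Real.exp S' := by rw [hτ]; field_simp
    rw [this, Real.log_exp]
  set τ1 := τ / (2 / ω + 1) with hτ1
  obtain ⟨M, hM⟩ := hlim τ1 (by positivity)
  obtain ⟨e₁, e₂, P, Q, G⟩ := all (max M N) (le_max_right _ _)
  set m := max M N with hm
  have hsmall := hM m (le_max_left _ _)
  have hs1 : 2 * |D.f^[m] x0 - D.f^[m] x1| / ω + |D.f^[m] x0 - D.f^[m] x1| ≤ τ := by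
    have : |D.f^[m] x0 - D.f^[m] x1| * (2 / ω + 1) ≤ τ := by
      rwa [hτ1, le_div_iff₀ (by positivity)] at hsmall
    calc _ = |D.f^[m] x0 - D.f^[m] x1| * (2 / ω + 1) := by ring
      _ ≤ τ := this
  have hmn := small_min (G.ch hpq i0 i1 b01) l01 (G.len x0 i0 x1 i1 b01).2
  have hsm : ∀ x ∈ Icc x0 x1, min |D.f^[m] x - e₁| |D.f^[m] x - e₂| ≤ τ := by
    intro x hx
    have g1 : |D.f^[m] x - D.f^[m] x0| ≤ |D.f^[m] x0 - D.f^[m] x1| ∧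
        |D.f^[m] x - D.f^[m] x1| ≤ |D.f^[m] x0 - D.f^[m] x1| := by
      rcases eq_or_lt_of_le hx.1 with h | h
      · rw [← h]; simp
      rcases eq_or_lt_of_le hx.2 with h' | h'
      · rw [h', abs_sub_comm]; simp
      have c1 := G.ch hpq i0 hx (Or.inl ⟨hp, h⟩)
      have c2 := G.ch hpq hx i1 (Or.inl ⟨hp.trans h, h'⟩)
      rcases c1 with ⟨u1, u2, u3⟩ | ⟨u1, u2, u3⟩ <;> rcases c2 with ⟨v1, v2, v3⟩ | ⟨v1, v2, v3⟩
      · rw [abs_of_pos (by linarith), abs_of_neg (by linarith), abs_of_neg (by linarith)]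
        exact ⟨by linarith, by linarith⟩
      · linarith
      · linarith
      · rw [abs_of_neg (by linarith), abs_of_pos (by linarith), abs_of_pos (by linarith)]
        exact ⟨by linarith, by linarith⟩
    rcases min_le_iff.1 hmn with h | h
    · refine (min_le_left _ _).trans ?_
      have := abs_sub_le (D.f^[m] x) (D.f^[m] x0) e₁
      linarith
    · refine (min_le_right _ _).trans ?_
      have := abs_sub_le (D.f^[m] x) (D.f^[m] x1) e₂
      linarith
  rcases le_total |D.f^[m] xm - e₁| |D.f^[m] xm - e₂| with h | h
  · have := G.finH Kx W hpq hk hΛ1 hγ hγ1 hγ2 hM₀p hB.le hc0 (hc _ _ G.E1.2) hS' hτ0 hSτ i0 im b0 hsm h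
    simp only [hR] at this
    have := min_le_left |D.f^[N] x0 - D.f^[N] xm| |D.f^[N] xm - D.f^[N] x1|
    linarith
  · have := (G.swap hpq).finH Kx W (fun x hx => (hpq x hx).swap) hk hΛ1 hγ hγ1 hγ2 hM₀p hB.le hc0 (hc _ _ G.E2.2)
      hS' hτ0 hSτ i1 im b1 (fun x hx => by rw [min_comm]; exact hsm x hx) h
    simp only [hR] at this
    rw [abs_sub_comm (D.f^[N] x1) (D.f^[N] xm)] at this
    have := min_le_right |D.f^[N] x0 - D.f^[N] xm| |D.f^[N] xm - D.f^[N] x1|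
    linarith

end W17

namespace W17

variable {D : CritData}

theorem Hyp.img1 (H : Hyp D) {a b : ℝ} (hab : a < b) (hs : Icc a b ⊆ unitI) :
    ∃ α β, α < β ∧ D.f '' Icc a b = Icc α β ∧ Icc α β ⊆ unitI := by
  have hi := ContinuousOn.image_Icc hab.le (H.cont.mono hs)
  have ha : a ∈ Icc a b := ⟨le_rfl, hab.le⟩
  have hsub : D.f '' Icc a b ⊆ unitI := by
    rintro _ ⟨x, hx, rfl⟩; exact H.maps (hs hx)
  refine ⟨_, _, ?_, hi, hi ▸ hsub⟩
  obtain ⟨δ, hδ, hfree⟩ := exists_free D.C a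
  set y := min (a + δ) b with hy
  have hy1 : a < y := lt_min (by linarith) hab
  have hy2 : y ≤ b := min_le_right _ _
  have hy3 : y ≤ a + δ := min_le_left _ _
  have hyI : y ∈ Icc a b := ⟨hy1.le, hy2⟩
  have hne : D.f a ≠ D.f y := by
    refine (H.bt (u := (a + y) / 2) (hs ha) (hs hyI) ?_ (Or.inl ⟨by linarith, by linarith⟩)).ne
    rintro c hc (h | h)
    · refine hfree c ?_ ?_ hc <;> rw [abs_of_pos (by linarith)] <;> linarith
    · linarith
  by_contra hcon
  have m1 : D.f a ∈ D.f '' Icc a b := mem_image_of_mem _ ha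
  have m2 : D.f y ∈ D.f '' Icc a b := mem_image_of_mem _ hyI
  rw [hi] at m1 m2
  apply hne
  push Not at hcon
  linarith [m1.1, m1.2, m2.1, m2.2]

theorem Hyp.img (H : Hyp D) (k : ℕ) {a b : ℝ} (hab : a < b) (hs : Icc a b ⊆ unitI) :
    ∃ α β, α < β ∧ D.f^[k] '' Icc a b = Icc α β ∧ Icc α β ⊆ unitI := by
  induction k with
  | zero => exact ⟨a, b, hab, by simp, hs⟩
  | succ k ih =>
    obtain ⟨α, β, h1, h2, h3⟩ := ih
    rw [Function.iterate_succ', image_comp, h2]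
    exact H.img1 h1 h3

theorem cyc_inv {f : ℝ → ℝ} {X : Set ℝ} (h : IsCycle f X) : ∀ x ∈ X, f x ∈ X := by
  obtain ⟨J, n, ⟨a, b, hab, rfl⟩, hJ, hn, hfn, -, rfl⟩ := h
  intro x hx
  simp only [mem_iUnion, Finset.mem_range] at hx ⊢
  obtain ⟨i, hi, y, hy, rfl⟩ := hx
  by_cases h : i + 1 < n
  · exact ⟨i + 1, h, y, hy, Function.iterate_succ_apply' f i y⟩
  · have : i + 1 = n := by omega
    refine ⟨0, by omega, f^[n] y, hfn ⟨y, hy, rfl⟩, ?_⟩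
    rw [← this, Function.iterate_succ_apply']; rfl

theorem inv_iter {f : ℝ → ℝ} {X : Set ℝ} (h : ∀ x ∈ X, f x ∈ X) (k : ℕ) : ∀ x ∈ X, f^[k] x ∈ X := by
  intro x hx
  induction k with
  | zero => exact hx
  | succ k ih => rw [Function.iterate_succ_apply']; exact h _ ih

/-- a small invariant interval inside a minimal cycle generates it -/
theorem gen {f : ℝ → ℝ} {X : Set ℝ} (hX : IsMinimalCycle f X) {a b : ℝ} (hab : a < b) (hI : Icc a b ⊆ unitI)
    (hs : Icc a b ⊆ X) {k : ℕ} (hk : 1 ≤ k) (hf : f^[k] '' Icc a b ⊆ Icc a b) :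
    ∃ n ≤ k, X = ⋃ i ∈ Finset.range n, f^[i] '' Icc a b := by
  classical
  have hex : ∃ k, 1 ≤ k ∧ f^[k] '' Icc a b ⊆ Icc a b := ⟨k, hk, hf⟩
  refine ⟨Nat.find hex, Nat.find_min' hex ⟨hk, hf⟩, ?_⟩
  symm
  apply hX.2
  · refine ⟨Icc a b, Nat.find hex, ⟨a, b, hab, rfl⟩, hI, (Nat.find_spec hex).1, (Nat.find_spec hex).2, ?_, rfl⟩
    intro m h1 h2 h3
    exact Nat.find_min hex h2 ⟨h1, h3⟩
  · intro x hx
    simp only [mem_iUnion] at hx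
    obtain ⟨i, -, y, hy, rfl⟩ := hx
    exact inv_iter (cyc_inv hX.1) i y (hs hy)

/-- the pieces of a minimal cycle -/
theorem Hyp.piece (H : Hyp D) {X : Set ℝ} (hX : IsMinimalCycle D.f X) :
    X ⊆ unitI ∧ IsClosed X ∧ ∃ n, 1 ≤ n ∧ ∀ x ∈ X, ∃ α β, α < β ∧ x ∈ Icc α β ∧ Icc α β ⊆ X ∧
      D.f^[n] '' Icc α β ⊆ Icc α β := by
  have hinv := cyc_inv hX.1
  obtain ⟨J, n, ⟨a, b, hab, rfl⟩, hJ, hn, hfn, -, hXe⟩ := hX.1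
  refine ⟨?_, ?_, n, hn, ?_⟩
  · rw [hXe]
    intro x hx
    simp only [mem_iUnion] at hx
    obtain ⟨i, -, y, hy, rfl⟩ := hx
    exact H.iter (hJ hy) i
  · rw [hXe]
    apply Set.Finite.isClosed_biUnion (Finset.finite_toSet _)
    intro i _
    obtain ⟨α, β, -, h, -⟩ := H.img i hab hJ
    rw [h]; exact isClosed_Icc
  · intro x hx
    have hx' := hx
    rw [hXe] at hx'
    simp only [mem_iUnion] at hx'
    obtain ⟨i, hi, hxi⟩ := hx'
    obtain ⟨α, β, h1, h2, -⟩ := H.img i hab hJ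
    refine ⟨α, β, h1, h2 ▸ hxi, ?_, ?_⟩
    · rw [← h2]
      intro z hz
      rw [hXe]
      simp only [mem_iUnion]
      exact ⟨i, hi, hz⟩
    · rw [← h2]
      rintro _ ⟨_, ⟨z, hz, rfl⟩, rfl⟩
      refine ⟨D.f^[n] z, hfn ⟨z, hz, rfl⟩, ?_⟩
      rw [← Function.iterate_add_apply, ← Function.iterate_add_apply, add_comm]

theorem Hyp.surj (H : Hyp D) {X : Set ℝ} (hX : IsMinimalCycle D.f X) : ∀ x ∈ X, ∃ y ∈ X, D.f y = x := by
  have hinv := cyc_inv hX.1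
  obtain ⟨hXI, -, n, hn, hp⟩ := H.piece hX
  obtain ⟨x₀, hx₀⟩ : X.Nonempty := by
    obtain ⟨J, n, ⟨a, b, hab, rfl⟩, hJ, hn, hfn, -, hXe⟩ := hX.1
    refine ⟨a, ?_⟩
    rw [hXe]; simp only [mem_iUnion, Finset.mem_range]
    exact ⟨0, hn, a, ⟨le_rfl, hab.le⟩, rfl⟩
  obtain ⟨α, β, h1, -, h3, h4⟩ := hp x₀ hx₀
  obtain ⟨α', β', g1, g2, g3⟩ := H.img1 h1 (h3.trans hXI)
  have hsub : Icc α' β' ⊆ X := by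
    rw [← g2]; rintro _ ⟨z, hz, rfl⟩; exact hinv z (h3 hz)
  obtain ⟨m, -, hm⟩ := gen hX g1 g3 hsub hn (by
    rw [← g2]
    rintro _ ⟨_, ⟨z, hz, rfl⟩, rfl⟩
    refine ⟨D.f^[n] z, h4 ⟨z, hz, rfl⟩, ?_⟩
    rw [← Function.iterate_succ_apply' (f := D.f), Function.iterate_succ_apply])
  intro x hx
  rw [hm] at hx
  simp only [mem_iUnion] at hx
  obtain ⟨i, -, y, hy, rfl⟩ := hx
  rw [← g2] at hy
  obtain ⟨z, hz, rfl⟩ := hy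
  exact ⟨D.f^[i] z, inv_iter hinv i z (h3 hz), by
    rw [← Function.iterate_succ_apply' (f := D.f), Function.iterate_succ_apply]⟩

theorem Hyp.surjIter (H : Hyp D) {X : Set ℝ} (hX : IsMinimalCycle D.f X) (m : ℕ) :
    ∀ x ∈ X, ∃ y ∈ X, D.f^[m] y = x := by
  induction m with
  | zero => exact fun x hx => ⟨x, hx, rfl⟩
  | succ m ih =>
    intro x hx
    obtain ⟨y, hy, rfl⟩ := H.surj hX x hx
    obtain ⟨z, hz, rfl⟩ := ih y hy
    exact ⟨z, hz, Function.iterate_succ_apply' _ _ _⟩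

end W17

namespace W17

variable {D : CritData}

theorem Hyp.crit_small (H : Hyp D) {c : ℝ} (hc : c ∈ D.C) {η : ℝ} (hη : 0 < η) :
    ∀ᶠ x in 𝓝[unitI] c, |D.f x - D.f c| ≤ η * |x - c| := by
  obtain ⟨ε, L⟩ := H.exLoc
  have hε := L.pos
  have t : Tendsto (fun x : ℝ => |x - c| ^ ε) (𝓝 c) (𝓝 0) := by
    have : Continuous (fun x : ℝ => |x - c| ^ ε) :=
      (continuous_abs.comp (continuous_id.sub continuous_const)).rpow_const (fun x => Or.inr hε.le)
    have h := this.tendsto c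
    simpa [Real.zero_rpow hε.ne'] using h
  have e1 := t.eventually_lt_const (show 0 < η * ε by positivity)
  have e2 : ∀ᶠ x in 𝓝 c, |x - c| < ε := by
    have := Metric.ball_mem_nhds c hε
    filter_upwards [this] with x hx
    rwa [Metric.mem_ball, Real.dist_eq] at hx
  filter_upwards [mem_nhdsWithin_of_mem_nhds e1, mem_nhdsWithin_of_mem_nhds e2, self_mem_nhdsWithin] with x h1 h2 hx
  by_cases hxc : x = c
  · subst hxc; simp
  have h3 := L.ub c hc x hx hxc h2.le
  have h0 : 0 < |x - c| := abs_pos.2 (sub_ne_zero.2 hxc)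
  have h4 : |x - c| ^ (lo D c x) ≤ |x - c| ^ (1 + ε) :=
    Real.rpow_le_rpow_of_exponent_ge h0 (by linarith [L.half]) (L.l1 c hc x)
  rw [Real.rpow_add h0, Real.rpow_one] at h4
  have h5 : |x - c| * |x - c| ^ ε ≤ |x - c| * (η * ε) := mul_le_mul_of_nonneg_left h1.le h0.le
  have h6 : ε * |D.f x - D.f c| ≤ ε * (η * |x - c|) := by linarith
  exact le_of_mul_le_mul_left h6 hε

theorem Hyp.lip1 (H : Hyp D) {y : ℝ} (hy : y ∈ unitI) :
    ∃ L > 0, ∀ᶠ x in 𝓝[unitI] y, |D.f x - D.f y| ≤ L * |x - y| := by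
  by_cases hC : y ∈ D.C
  · exact ⟨1, one_pos, H.crit_small hC one_pos⟩
  · have h := (H.diff hy hC).isBigO_sub
    obtain ⟨L, hL, h2⟩ := h.exists_pos
    refine ⟨L, hL, mem_nhdsWithin_of_mem_nhds ?_⟩
    exact h2.bound

theorem Hyp.lip (H : Hyp D) {y : ℝ} (hy : y ∈ unitI) (k : ℕ) :
    ∃ L > 0, ∀ᶠ x in 𝓝[unitI] y, |D.f^[k] x - D.f^[k] y| ≤ L * |x - y| := by
  induction k with
  | zero => exact ⟨1, one_pos, by simp⟩
  | succ k ih =>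
    obtain ⟨L, hL, h⟩ := ih
    obtain ⟨L', hL', h'⟩ := H.lip1 (H.iter hy k)
    have t : Tendsto (D.f^[k]) (𝓝[unitI] y) (𝓝[unitI] (D.f^[k] y)) :=
      tendsto_nhdsWithin_iff.2 ⟨H.iterCont k y hy, by
        filter_upwards [self_mem_nhdsWithin] with x hx using H.iter hx k⟩
    refine ⟨L' * L, by positivity, ?_⟩
    filter_upwards [h, t.eventually h'] with x h1 h2
    rw [Function.iterate_succ_apply', Function.iterate_succ_apply']
    have := mul_le_mul_of_nonneg_left h1 hL'.le
    linarith

theorem Hyp.crit_contr (H : Hyp D) {c : ℝ} (hc : c ∈ D.C) (k : ℕ) :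
    ∀ᶠ x in 𝓝[unitI] c, |D.f^[k + 1] x - D.f^[k + 1] c| ≤ |x - c| := by
  have hcI : c ∈ unitI := H.pc.1 hc
  obtain ⟨L, hL, h⟩ := H.lip (H.maps hcI) k
  have t : Tendsto D.f (𝓝[unitI] c) (𝓝[unitI] (D.f c)) :=
    tendsto_nhdsWithin_iff.2 ⟨H.cont c hcI, by
      filter_upwards [self_mem_nhdsWithin] with x hx using H.maps hx⟩
  filter_upwards [t.eventually h, H.crit_small hc (inv_pos.2 hL)] with x h1 h2
  rw [Function.iterate_succ_apply, Function.iterate_succ_apply]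
  have := mul_le_mul_of_nonneg_left h2 hL.le
  rw [← mul_assoc, mul_inv_cancel₀ hL.ne', one_mul] at this
  linarith

theorem Hyp.nonper (H : Hyp D) {X : Set ℝ} (hX : IsMinimalCycle D.f X) :
    ∀ c ∈ D.C, c ∈ X → ∀ i, D.f^[i] (D.f c) ≠ c := by
  intro c hc hcX i hi
  rw [← Function.iterate_succ_apply] at hi
  obtain ⟨hXI, -, n, hn, hp⟩ := H.piece hX
  obtain ⟨α, β, h1, h2, h3, h4⟩ := hp c hcX
  have hcI := hXI hcX
  -- the return map
  obtain ⟨k, hk⟩ : ∃ k, (i + 1) * n = k + 1 := ⟨(i + 1) * n - 1, by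
    have : 1 ≤ (i + 1) * n := Nat.mul_pos (by omega) hn
    omega⟩
  have hfix : D.f^[k + 1] c = c := by
    rw [← hk, Function.iterate_mul]
    exact Function.iterate_fixed hi n
  have hinvP : ∀ x ∈ Icc α β, D.f^[k + 1] x ∈ Icc α β := by
    intro x hx
    rw [← hk, mul_comm, Function.iterate_mul]
    exact inv_iter (f := D.f^[n]) (fun y hy => h4 ⟨y, hy, rfl⟩) (i + 1) x hx
  -- a point of X off the orbit of c
  obtain ⟨x, hx, hxo⟩ : ∃ x ∈ Icc α β, x ∉ (fun j => D.f^[j] c) '' (Finset.range (k + 1) : Set ℕ) := by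
    have hinf : (Icc α β).Infinite := Icc_infinite h1
    have hfin : ((fun j => D.f^[j] c) '' (Finset.range (k + 1) : Set ℕ)).Finite :=
      (Finset.finite_toSet _).image _
    obtain ⟨x, hx, hx2⟩ := hinf.exists_notMem_finite hfin
    exact ⟨x, hx, hx2⟩
  have ev : ∀ᶠ y in 𝓝[unitI] c, ∀ j ∈ Finset.range (k + 1), D.f^[j] y ≠ x := by
    rw [Filter.eventually_all_finset]
    intro j hj
    have := H.iterCont j c hcI
    exact this.eventually_ne (fun h => hxo ⟨j, hj, h⟩)
  have ev2 := ev.and (H.crit_contr hc k)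
  rw [hfix] at ev2
  obtain ⟨ε, hε, hball⟩ := Metric.mem_nhdsWithin_iff.1 ev2
  have hgood : ∀ y ∈ unitI, |y - c| < ε → (∀ j ∈ Finset.range (k + 1), D.f^[j] y ≠ x) ∧
      |D.f^[k + 1] y - c| ≤ |y - c| := fun y hy hyc =>
    hball ⟨by rwa [Metric.mem_ball, Real.dist_eq], hy⟩
  set a := max α (c - ε / 2) with ha
  set b := min β (c + ε / 2) with hb
  have hac : a ≤ c := max_le h2.1 (by linarith)
  have hcb : c ≤ b := le_min h2.2 (by linarith)
  have hab : a < b := by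
    rw [ha, hb, max_lt_iff, lt_min_iff, lt_min_iff]
    exact ⟨⟨h1, by linarith [h2.1]⟩, by linarith [h2.2], by linarith⟩
  have haP : α ≤ a := le_max_left _ _
  have hbP : b ≤ β := min_le_left _ _
  have ha2 : c - ε / 2 ≤ a := le_max_right _ _
  have hb2 : b ≤ c + ε / 2 := min_le_right _ _
  have hsub : Icc a b ⊆ Icc α β := Icc_subset_Icc haP hbP
  have hsm : ∀ y ∈ Icc a b, |y - c| ≤ ε / 2 := by
    intro y hy
    rw [abs_le]; exact ⟨by linarith [hy.1], by linarith [hy.2]⟩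
  obtain ⟨m, hm, hXe⟩ := gen hX hab ((hsub.trans h3).trans hXI) (hsub.trans h3) (k := k + 1) (by omega) (by
    rintro _ ⟨y, hy, rfl⟩
    have g1 := (hgood y (hXI (h3 (hsub hy))) (by linarith [hsm y hy])).2
    have g2 := hinvP y (hsub hy)
    have g3 := abs_le.1 (g1.trans (hsm y hy))
    exact ⟨max_le g2.1 (by linarith), le_min g2.2 (by linarith)⟩)
  have hxX := h3 hx
  rw [hXe] at hxX
  simp only [mem_iUnion, Finset.mem_range] at hxX
  obtain ⟨j, hj, y, hy, hyx⟩ := hxX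
  exact (hgood y (hXI (h3 (hsub hy))) (by linarith [hsm y hy])).1 j (Finset.mem_range.2 (by omega)) hyx

theorem Hyp.disj (H : Hyp D) {X : Set ℝ} (hX : IsMinimalCycle D.f X) {c : ℝ} (hc : c ∈ D.C) (hcX : c ∈ X)
    {S : Set ℝ} (hS : IsPreconnected S) (hSX : S ⊆ X) {a b : ℝ} (hab : a < b) (hI : Icc a b ⊆ S)
    (hav : ∀ i, ∀ x ∈ S, D.f^[i] x ≠ c) {i k : ℕ} (hk : 1 ≤ k) {x y : ℝ} (hx : x ∈ S) (hy : y ∈ S)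
    (hxy : D.f^[i] x = D.f^[i + k] y) : False := by
  obtain ⟨hXI, hXc, -⟩ := H.piece hX
  have hinv := cyc_inv hX.1
  set E : Set ℝ := ⋃ n : ℕ, D.f^[i + n * k] '' S with hE
  have memE : ∀ n, ∀ z ∈ S, D.f^[i + n * k] z ∈ E := fun n z hz => mem_iUnion.2 ⟨n, z, hz, rfl⟩
  have hEX : E ⊆ X := by
    intro z hz
    obtain ⟨n, w, hw, rfl⟩ := mem_iUnion.1 hz
    exact inv_iter hinv _ _ (hSX hw)
  have hEp : IsPreconnected E := by
    apply IsPreconnected.iUnion_of_chain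
    · intro n
      exact hS.image _ ((H.iterCont _).mono (hSX.trans hXI))
    · intro n
      refine ⟨D.f^[n * k] (D.f^[i + k] y), ⟨x, hx, ?_⟩, ⟨y, hy, ?_⟩⟩
      · rw [← hxy, ← Function.iterate_add_apply, add_comm]
      · rw [← Function.iterate_add_apply]; congr 1; simp only [Nat.succ_eq_succ, Nat.succ_eq_add_one]; ring
  have hEf : ∀ z ∈ E, D.f^[k] z ∈ E := by
    intro z hz
    obtain ⟨n, w, hw, rfl⟩ := mem_iUnion.1 hz
    rw [← Function.iterate_add_apply]
    have : k + (i + n * k) = i + (n + 1) * k := by ring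
    rw [this]; exact memE _ _ hw
  have hEav : ∀ r, ∀ z ∈ E, ∀ m, D.f^[m] (D.f^[r] z) ≠ c := by
    intro r z hz m
    obtain ⟨n, w, hw, rfl⟩ := mem_iUnion.1 hz
    rw [← Function.iterate_add_apply, ← Function.iterate_add_apply]
    exact hav _ _ hw
  obtain ⟨α, β, g1, g2, g3⟩ := H.img i hab ((hI.trans hSX).trans hXI)
  have hsubE : Icc α β ⊆ E := by
    rw [← g2]
    rintro _ ⟨z, hz, rfl⟩
    have := memE 0 z (hI hz)
    simpa using this
  have hbb : BddBelow E := ⟨0, fun z hz => (hXI (hEX hz)).1⟩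
  have hba : BddAbove E := ⟨1, fun z hz => (hXI (hEX hz)).2⟩
  have hne : E.Nonempty := ⟨α, hsubE ⟨le_rfl, g1.le⟩⟩
  set A := sInf E with hA
  set B := sSup E with hB
  have hAB : A < B := by
    have i1 : A ≤ α := csInf_le hbb (hsubE ⟨le_rfl, g1.le⟩)
    have i2 : β ≤ B := le_csSup hba (hsubE ⟨g1.le, le_rfl⟩)
    linarith
  have hIoo : Ioo A B ⊆ E := IsConnected.Ioo_csInf_csSup_subset ⟨hne, hEp⟩ hbb hba
  have hEI : E ⊆ Icc A B := fun z hz => ⟨csInf_le hbb hz, le_csSup hba hz⟩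
  have hcl : closure E = Icc A B := by
    apply Subset.antisymm (closure_minimal hEI isClosed_Icc)
    rw [← closure_Ioo hAB.ne]; exact closure_mono hIoo
  have hJX : Icc A B ⊆ X := hcl ▸ closure_minimal hEX hXc
  obtain ⟨n, -, hXe⟩ := gen hX hAB (hJX.trans hXI) hJX hk (by
    rw [← hcl]
    refine (ContinuousOn.image_closure ((H.iterCont k).mono (by rw [hcl]; exact hJX.trans hXI))).trans ?_
    apply closure_mono
    rintro _ ⟨z, hz, rfl⟩
    exact hEf z hz)
  set F : Set ℝ := ⋃ r ∈ (Finset.range n : Set ℕ), D.f^[r] '' {A, B} with hF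
  have hFfin : F.Finite := (Finset.finite_toSet _).biUnion fun r _ => (toFinite _).image _
  choose z hzX hz using fun m => H.surjIter hX m c hcX
  have hzF : ∀ m, z m ∈ F := by
    intro m
    have h := hzX m
    rw [hXe] at h
    simp only [mem_iUnion] at h
    obtain ⟨r, hr, w, hw, hwz⟩ := h
    have hwE : w ∉ E := fun h => hEav r w h m (by rw [hwz, hz])
    refine mem_biUnion (x := r) hr ⟨w, ?_, hwz⟩
    by_contra hcon
    simp only [mem_insert_iff, mem_singleton_iff, not_or] at hcon
    exact hwE (hIoo ⟨lt_of_le_of_ne hw.1 (Ne.symm hcon.1), lt_of_le_of_ne hw.2 hcon.2⟩)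
  obtain ⟨m, -, m', -, hmm, hzz⟩ := (infinite_univ (α := ℕ)).exists_lt_map_eq_of_mapsTo (fun m _ => hzF m) hFfin
  obtain ⟨d, rfl⟩ : ∃ d, m' = d + 1 + m := ⟨m' - m - 1, by omega⟩
  apply H.nonper hX c hc hcX d
  rw [← Function.iterate_succ_apply]
  have h1 := hz (d + 1 + m)
  rw [← hzz, Function.iterate_add_apply, hz] at h1
  exact h1

end W17

namespace W17

variable {D : CritData}

theorem Hyp.shrink (H : Hyp D) {X : Set ℝ} (hX : IsMinimalCycle D.f X) {c : ℝ} (hc : c ∈ D.C) (hcX : c ∈ X)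
    {x0 x1 : ℝ} (h01 : x0 < x1) (hs : Icc x0 x1 ⊆ X) (hav : ∀ i, ∀ x ∈ Icc x0 x1, D.f^[i] x ≠ c) :
    ∀ τ > 0, ∃ M, ∀ m ≥ M, |D.f^[m] x0 - D.f^[m] x1| ≤ τ := by
  intro τ hτ
  have hXI := (H.piece hX).1
  have hcont : ∀ m, ContinuousOn (D.f^[m]) (Icc x0 x1) := fun m => (H.iterCont m).mono (hs.trans hXI)
  set A : ℕ → Set ℝ := fun m => D.f^[m] '' Icc x0 x1 with hA
  have hmeas : ∀ m, MeasurableSet (A m) := fun m => (isCompact_Icc.image_of_continuousOn (hcont m)).measurableSet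
  have hlt : ∀ i j, i < j → Disjoint (A i) (A j) := by
    intro i j hij
    rw [Set.disjoint_left]
    rintro _ ⟨x, hx, rfl⟩ ⟨y, hy, hxy⟩
    obtain ⟨k, rfl⟩ : ∃ k, j = i + k := ⟨j - i, by omega⟩
    exact H.disj hX hc hcX isPreconnected_Icc hs h01 Subset.rfl hav (k := k) (by omega) hx hy hxy.symm
  have hdisj : Pairwise (Function.onFun Disjoint A) := by
    intro i j hij
    rcases lt_or_gt_of_ne hij with h | h
    · exact hlt i j h
    · exact (hlt j i h).symm
  have hsum : ∑' m, volume (A m) ≠ ⊤ := by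
    rw [← measure_iUnion hdisj hmeas]
    refine ne_top_of_le_ne_top ?_ (measure_mono (t := unitI) ?_)
    · simp [unitI]
    · intro z hz
      obtain ⟨m, x, hx, rfl⟩ := mem_iUnion.1 hz
      exact H.iter (hXI (hs hx)) m
  have ht := ENNReal.tendsto_atTop_zero_of_tsum_ne_top hsum
  have hev := ht.eventually_lt_const (ENNReal.ofReal_pos.2 hτ)
  obtain ⟨M, hM⟩ := eventually_atTop.1 hev
  refine ⟨M, fun m hm => ?_⟩
  have h1 := hM m hm
  have h2 : uIcc (D.f^[m] x0) (D.f^[m] x1) ⊆ A m := by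
    have := intermediate_value_uIcc (f := D.f^[m]) (a := x0) (b := x1) (by rw [uIcc_of_le h01.le]; exact hcont m)
    rwa [uIcc_of_le h01.le] at this
  have h3 := (measure_mono h2).trans h1.le
  rw [Real.volume_interval, ENNReal.ofReal_le_ofReal_iff hτ.le, abs_sub_comm] at h3
  exact h3

/-- two different returns of a wandering interval to a piece cannot have the same uncut side -/
theorem Hyp.one_uncut (H : Hyp D) {X : Set ℝ} (hX : IsMinimalCycle D.f X) {c : ℝ} (hc : c ∈ D.C) (hcX : c ∈ X)
    {α β u v u' v' : ℝ} (hP : Icc α β ⊆ X) (huv : u < v)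
    (hV : Icc u v ⊆ Icc α β) (hV' : Icc u' v' ⊆ Icc α β) (huv' : u' < v')
    {m : ℕ} (hm : 1 ≤ m) (himg : D.f^[m] '' Icc u v = Icc u' v') :
    ¬ ((∀ j, ∀ w ∈ Ioc α v, D.f^[j] w ∉ D.C) ∧ (∀ j, ∀ w ∈ Ioc α v', D.f^[j] w ∉ D.C)) ∧
    ¬ ((∀ j, ∀ w ∈ Ico u β, D.f^[j] w ∉ D.C) ∧ (∀ j, ∀ w ∈ Ico u' β, D.f^[j] w ∉ D.C)) := by
  have hXI := (H.piece hX).1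
  have u1 := (hV ⟨le_rfl, huv.le⟩).1
  have v1 := (hV ⟨huv.le, le_rfl⟩).2
  have u1' := (hV' ⟨le_rfl, huv'.le⟩).1
  have v1' := (hV' ⟨huv'.le, le_rfl⟩).2
  constructor
  · rintro ⟨k1, k2⟩
    have hav : ∀ j, ∀ w ∈ Ioc α (max v v'), D.f^[j] w ≠ c := by
      intro j w hw h
      rcases le_max_iff.1 hw.2 with g | g
      · exact k1 j w ⟨hw.1, g⟩ (h ▸ hc)
      · exact k2 j w ⟨hw.1, g⟩ (h ▸ hc)
    have hsub : Icc ((u + v) / 2) v ⊆ Ioc α (max v v') := fun z hz =>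
      ⟨by linarith [hz.1], hz.2.trans (le_max_left _ _)⟩
    have hsX : Ioc α (max v v') ⊆ X := fun z hz => hP ⟨hz.1.le, hz.2.trans (max_le v1 v1')⟩
    obtain ⟨s, t, hst, g2, -⟩ := H.img m (a := (u + v) / 2) (b := v) (by linarith) ((hsub.trans hsX).trans hXI)
    have ht : t ∈ D.f^[m] '' Icc ((u + v) / 2) v := by rw [g2]; exact ⟨hst.le, le_rfl⟩
    have hs : s ∈ D.f^[m] '' Icc ((u + v) / 2) v := by rw [g2]; exact ⟨le_rfl, hst.le⟩
    have hbig : D.f^[m] '' Icc ((u + v) / 2) v ⊆ Icc u' v' := by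
      rw [← himg]; exact image_mono (Icc_subset_Icc (by linarith) le_rfl)
    have hs' := hbig hs
    have ht' := hbig ht
    obtain ⟨y, hy, hyt⟩ := ht
    exact H.disj hX hc hcX isPreconnected_Ioc hsX (a := (u + v) / 2) (b := v) (by linarith) hsub hav
      (i := 0) (k := m) hm (x := t) (y := y) ⟨by linarith [hs'.1], ht'.2.trans (le_max_right _ _)⟩ (hsub hy)
      (by simpa using hyt.symm)
  · rintro ⟨k1, k2⟩
    have hav : ∀ j, ∀ w ∈ Ico (min u u') β, D.f^[j] w ≠ c := by
      intro j w hw h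
      rcases min_le_iff.1 hw.1 with g | g
      · exact k1 j w ⟨g, hw.2⟩ (h ▸ hc)
      · exact k2 j w ⟨g, hw.2⟩ (h ▸ hc)
    have hsub : Icc u ((u + v) / 2) ⊆ Ico (min u u') β := fun z hz =>
      ⟨(min_le_left _ _).trans hz.1, by linarith [hz.2]⟩
    have hsX : Ico (min u u') β ⊆ X := fun z hz => hP ⟨(le_min u1 u1').trans hz.1, hz.2.le⟩
    obtain ⟨s, t, hst, g2, -⟩ := H.img m (a := u) (b := (u + v) / 2) (by linarith) ((hsub.trans hsX).trans hXI)
    have ht : t ∈ D.f^[m] '' Icc u ((u + v) / 2) := by rw [g2]; exact ⟨hst.le, le_rfl⟩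
    have hs : s ∈ D.f^[m] '' Icc u ((u + v) / 2) := by rw [g2]; exact ⟨le_rfl, hst.le⟩
    have hbig : D.f^[m] '' Icc u ((u + v) / 2) ⊆ Icc u' v' := by
      rw [← himg]; exact image_mono (Icc_subset_Icc le_rfl (by linarith))
    have hs' := hbig hs
    have ht' := hbig ht
    obtain ⟨y, hy, hyt⟩ := hs
    exact H.disj hX hc hcX isPreconnected_Ico hsX (a := u) (b := (u + v) / 2) (by linarith) hsub hav
      (i := 0) (k := m) hm (x := s) (y := y) ⟨(min_le_right _ _).trans hs'.1, by linarith [ht'.2]⟩ (hsub hy)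
      (by simpa using hyt.symm)

/-- the core contradiction: a homterval which is cut on both sides -/
theorem Ctx.twocut {X : Set ℝ} (K : Ctx D X) (hX : IsMinimalCycle D.f X) {c : ℝ} (hc : c ∈ D.C) (hcX : c ∈ X)
    {α β u v : ℝ} (hP : Icc α β ⊆ X) (huv : u < v) (hV : Icc u v ⊆ Icc α β)
    (hav : ∀ j, ∀ x ∈ Icc u v, D.f^[j] x ∉ D.C)
    (hl : ∃ j, ∃ w ∈ Ioc α v, D.f^[j] w ∈ D.C) (hr : ∃ j, ∃ w ∈ Ico u β, D.f^[j] w ∈ D.C) : False := by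
  have u1 := (hV ⟨le_rfl, huv.le⟩).1
  have v1 := (hV ⟨huv.le, le_rfl⟩).2
  set x0 := u + (v - u) / 3 with hx0
  set x1 := v - (v - u) / 3 with hx1
  have l0 : u < x0 := by rw [hx0]; linarith
  have l1 : x1 < v := by rw [hx1]; linarith
  have l01 : x0 < x1 := by rw [hx0, hx1]; linarith
  have hsV : Icc x0 x1 ⊆ Icc u v := Icc_subset_Icc l0.le l1.le
  have W : Wd D X x0 x1 := ⟨l01, fun x hx => hP (hV (hsV hx)), fun m x hx => hav m x (hsV hx)⟩
  have hαX : α ∈ X := hP ⟨le_rfl, by linarith⟩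
  have hβX : β ∈ X := hP ⟨by linarith, le_rfl⟩
  obtain ⟨m1, e1, P1, E1⟩ := initEn K W hαX (fun h => by linarith [h.1])
    (by
      rintro x hx z (h | h)
      · exact hP ⟨h.1.le, by linarith [hx.2, h.2]⟩
      · linarith [hx.1, h.1, h.2])
    (by
      obtain ⟨j, w, hw, hwC⟩ := hl
      have hwu : w < u := by
        by_contra hcon
        exact hav j w ⟨not_lt.1 hcon, hw.2⟩ hwC
      exact ⟨j, w, fun x hx => Or.inl ⟨hw.1, by linarith [hx.1]⟩, hwC⟩)
  obtain ⟨m2, e2, P2, E2⟩ := initEn K W hβX (fun h => by linarith [h.2])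
    (by
      rintro x hx z (h | h)
      · linarith [hx.2, h.1, h.2]
      · exact hP ⟨by linarith [hx.1, h.1], h.2.le⟩)
    (by
      obtain ⟨j, w, hw, hwC⟩ := hr
      have hwu : v < w := by
        by_contra hcon
        exact hav j w ⟨hw.1, not_lt.1 hcon⟩ hwC
      exact ⟨j, w, fun x hx => Or.inr ⟨by linarith [hx.2], hw.2⟩, hwC⟩)
  obtain ⟨e1', P1', E1'⟩ := E1.later K W (le_max_left m1 m2)
  obtain ⟨e2', P2', E2'⟩ := E2.later K W (le_max_right m1 m2)
  exact fin K W (by linarith) (by linarith) E1' E2'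
    (K.H.shrink hX hc hcX l01 W.WX (fun i x hx h => W.av i x hx (h ▸ hc)))

theorem main {X : Set ℝ} (K : Ctx D X) (hX : IsMinimalCycle D.f X) {c : ℝ} (hc : c ∈ D.C) (hcX : c ∈ X) :
    X ⊆ closure (⋃ i : ℕ, D.f^[i] ⁻¹' {c}) := by
  intro y hyX
  by_contra hycl
  have H := K.H
  obtain ⟨hXI, hXc, n, hn, hpiece⟩ := H.piece hX
  obtain ⟨α, β, h1, h2, h3, h4⟩ := hpiece y hyX
  -- an interval avoiding the preimages of c
  obtain ⟨a, b, hab, habP, havc⟩ : ∃ a b, a < b ∧ Icc a b ⊆ Icc α β ∧ ∀ i, ∀ x ∈ Icc a b, D.f^[i] x ≠ c := by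
    obtain ⟨ε, hε, hball⟩ := Metric.isOpen_iff.1 isClosed_closure.isOpen_compl y hycl
    refine ⟨max α (y - ε / 2), min β (y + ε / 2), ?_, Icc_subset_Icc (le_max_left _ _) (min_le_left _ _), ?_⟩
    · rw [max_lt_iff, lt_min_iff, lt_min_iff]
      exact ⟨⟨h1, by linarith [h2.1]⟩, by linarith [h2.2], by linarith⟩
    · intro i x hx hxc
      refine hball (a := x) ?_ (subset_closure (mem_iUnion.2 ⟨i, hxc⟩))
      rw [Metric.mem_ball, Real.dist_eq, abs_lt]
      have := (le_max_right _ _).trans hx.1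
      have := hx.2.trans (min_le_right _ _)
      exact ⟨by linarith, by linarith⟩
  have habX : Icc a b ⊆ X := habP.trans h3
  -- eventually no critical points
  obtain ⟨N, hN⟩ : ∃ N, ∀ i ≥ N, ∀ x ∈ Icc a b, D.f^[i] x ∉ D.C := by
    have hev : ∀ᶠ i in atTop, ∀ d ∈ D.C, ∀ x ∈ Icc a b, D.f^[i] x ≠ d := by
      rw [Filter.eventually_all_finset]
      intro d hd
      by_cases hex : ∃ i, ∃ x ∈ Icc a b, D.f^[i] x = d
      · obtain ⟨i, x, hx, hxd⟩ := hex
        filter_upwards [eventually_gt_atTop i] with j hj z hz hzd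
        obtain ⟨k, rfl⟩ : ∃ k, j = i + k := ⟨j - i, by omega⟩
        exact H.disj hX hc hcX isPreconnected_Icc habX hab Subset.rfl havc (k := k) (by omega) hx hz
          (hxd.trans hzd.symm)
      · push Not at hex
        exact Eventually.of_forall fun i x hx => hex i x hx
    obtain ⟨N, hN⟩ := eventually_atTop.1 hev
    exact ⟨N, fun i hi x hx hC => hN i hi _ hC x hx rfl⟩
  -- the piece containing the images
  obtain ⟨α', β', p1, p2, p3⟩ := H.img N h1 (h3.trans hXI)
  have hinv := cyc_inv hX.1
  have hP' : Icc α' β' ⊆ X := by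
    rw [← p2]; rintro _ ⟨z, hz, rfl⟩; exact inv_iter hinv N z (h3 hz)
  have hfP' : ∀ z ∈ Icc α' β', D.f^[n] z ∈ Icc α' β' := by
    rw [← p2]
    rintro _ ⟨z, hz, rfl⟩
    refine ⟨D.f^[n] z, h4 ⟨z, hz, rfl⟩, ?_⟩
    rw [← Function.iterate_add_apply, ← Function.iterate_add_apply, add_comm]
  have hVs : ∀ i : ℕ, ∃ u v, u < v ∧ D.f^[n * i + N] '' Icc a b = Icc u v ∧ Icc u v ⊆ Icc α' β' ∧
      ∀ j, ∀ x ∈ Icc u v, D.f^[j] x ∉ D.C := by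
    intro i
    obtain ⟨u, v, g1, g2, -⟩ := H.img (n * i + N) hab (habX.trans hXI)
    refine ⟨u, v, g1, g2, ?_, ?_⟩
    · rw [← g2]
      rintro _ ⟨z, hz, rfl⟩
      rw [Function.iterate_add_apply, Function.iterate_mul]
      refine inv_iter (f := D.f^[n]) hfP' i _ ?_
      rw [← p2]; exact ⟨z, habP hz, rfl⟩
    · rw [← g2]
      rintro j _ ⟨z, hz, rfl⟩
      rw [← Function.iterate_add_apply]
      exact hN _ (by omega) z hz
  choose u v huv himg hsub hav using hVs
  have hone : ∀ i j, i < j →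
      ¬ ((∀ k, ∀ w ∈ Ioc α' (v i), D.f^[k] w ∉ D.C) ∧ (∀ k, ∀ w ∈ Ioc α' (v j), D.f^[k] w ∉ D.C)) ∧
      ¬ ((∀ k, ∀ w ∈ Ico (u i) β', D.f^[k] w ∉ D.C) ∧ (∀ k, ∀ w ∈ Ico (u j) β', D.f^[k] w ∉ D.C)) := by
    intro i j hij
    refine H.one_uncut hX hc hcX hP' (huv i) (hsub i) (hsub j) (huv j) (m := n * (j - i))
      (Nat.mul_pos hn (by omega)) ?_
    rw [← himg i, ← image_comp, ← Function.iterate_add, ← himg j]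
    congr 2
    rw [← add_assoc, ← mul_add]; congr 2; omega
  have hcut : ∀ i, (∀ k, ∀ w ∈ Ioc α' (v i), D.f^[k] w ∉ D.C) ∨ (∀ k, ∀ w ∈ Ico (u i) β', D.f^[k] w ∉ D.C) := by
    intro i
    by_contra hcon
    push Not at hcon
    exact K.twocut hX hc hcX hP' (huv i) (hsub i) (hav i) hcon.1 hcon.2
  have o01 := hone 0 1 (by omega)
  have o02 := hone 0 2 (by omega)
  have o12 := hone 1 2 (by omega)
  rcases hcut 0 with q0 | q0 <;> rcases hcut 1 with q1 | q1 <;> rcases hcut 2 with q2 | q2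
  · exact o01.1 ⟨q0, q1⟩
  · exact o01.1 ⟨q0, q1⟩
  · exact o02.1 ⟨q0, q2⟩
  · exact o12.2 ⟨q1, q2⟩
  · exact o12.1 ⟨q1, q2⟩
  · exact o02.2 ⟨q0, q2⟩
  · exact o01.2 ⟨q0, q1⟩
  · exact o01.2 ⟨q0, q1⟩

theorem final (hpc : D.IsPiecewiseC2) (hcont : ContinuousOn D.f unitI) (hsch : D.NegSchwarzian)
    (hII : D.CondII) : ∀ X : Set ℝ, IsMinimalCycle D.f X → ∀ c ∈ D.C, c ∈ X →
      X ⊆ closure (⋃ i : ℕ, D.f^[i] ⁻¹' {c}) := by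
  intro X hX c hc hcX
  have H : Hyp D := ⟨hpc, hcont, hsch⟩
  have K : Ctx D X := ⟨H, hII, (H.piece hX).1, cyc_inv hX.1, H.nonper hX⟩
  exact main K hX hc hcX

end W17

theorem statement17 (D : CritData)
    (hpc : D.IsPiecewiseC2) (hcont : ContinuousOn D.f unitI) (hsch : D.NegSchwarzian)
    (hI : D.CondI) (hII : D.CondII) :
    ∀ X : Set ℝ, IsMinimalCycle D.f X → ∀ c ∈ D.C, c ∈ X →
      X ⊆ closure (⋃ i : ℕ, D.f^[i] ⁻¹' {c}) := by
  exact W17.final hpc hcont hsch hII
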